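/- Let A and B be C*-algebras. If E is a primitive ideal of A and F is a primitive ideal of B, then A ⊗̂ F + E ⊗̂ B is a primitive ideal of the Banach *-algebra A ⊗̂ B. -/

import Mathlib

open scoped TensorProduct
open Pointwise

universe u

noncomputable section

/-- A C⋆-norm on a complex `*`-algebra.  On a matrix algebra over a C⋆-algebra such a
norm is unique, namely the canonical C⋆-norm. -/
structure IsCStarNorm {M : Type*} [NonUnitalRing M] [StarRing M] [Module ℂ M]
    (N : M → ℝ) : Prop where
  add_le : ∀ x y, N (x + y) ≤ N x + N y
  smul_eq : ∀ (c : ℂ) (x : M), N (c • x) = ‖c‖ * N x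
  eq_zero_of : ∀ x, N x = 0 → x = 0
  mul_le : ∀ x y, N (x * y) ≤ N x * N y
  star_mul_self : ∀ x, N (star x * x) = N x * N x

/-- The operator space projective tensor norm `‖·‖_∧` on the algebraic tensor product
`A ⊗ B`, relative to given families of matrix norms on `A` and `B`:
`‖u‖_∧ = inf { ‖α‖ ‖v‖ ‖w‖ ‖β‖ : u = α (v ⊗ w) β }` where `v ∈ M_p(A)`, `w ∈ M_q(B)`,
`α ∈ M_{1,pq}(ℂ)` and `β ∈ M_{pq,1}(ℂ)` (row and column vectors carrying the Euclidean
norm, which is their norm as scalar matrices). -/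
noncomputable def osProjNorm {A B : Type u}
    [AddCommGroup A] [Module ℂ A] [AddCommGroup B] [Module ℂ B]
    (NA : ∀ p : ℕ, Matrix (Fin p) (Fin p) A → ℝ)
    (NB : ∀ q : ℕ, Matrix (Fin q) (Fin q) B → ℝ) (u : A ⊗[ℂ] B) : ℝ :=
  sInf { r : ℝ | ∃ (p q : ℕ) (α : Fin p × Fin q → ℂ) (v : Matrix (Fin p) (Fin p) A)
      (w : Matrix (Fin q) (Fin q) B) (β : Fin p × Fin q → ℂ),
      u = ∑ ik : Fin p × Fin q, ∑ jl : Fin p × Fin q,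
            (α ik * β jl) • (v ik.1 jl.1 ⊗ₜ[ℂ] w ik.2 jl.2) ∧
      r = Real.sqrt (∑ ik, ‖α ik‖ ^ 2) * NA p v * NB q w *
            Real.sqrt (∑ jl, ‖β jl‖ ^ 2) }

/-- `X` is a completion of the algebraic tensor product `A ⊗ B` with respect to the
norm `ν`, via the (necessarily isometric) dense embedding `ι`, and the multiplication and
involution of `X` are the canonical ones induced from `A` and `B`.  Applied with
`ν = osProjNorm NA NB` (for the canonical matrix C⋆-norms `NA`, `NB`) this characterizes
the Banach `*`-algebra `A ⊗̂ B` (the operator space projective tensor product) up to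
isometric `*`-isomorphism; applied with `ν = bsProjNorm` it characterizes the Banach
space projective tensor product `A ⊗_γ B`. -/
structure IsTensorCompletion {A B : Type u} [NonUnitalRing A] [StarRing A] [Module ℂ A]
    [NonUnitalRing B] [StarRing B] [Module ℂ B] (ν : A ⊗[ℂ] B → ℝ)
    (X : Type u) [NonUnitalNormedRing X] [StarRing X] [NormedSpace ℂ X] [CompleteSpace X]
    (ι : A ⊗[ℂ] B →ₗ[ℂ] X) : Prop where
  norm_eq : ∀ u, ‖ι u‖ = ν u
  dense : DenseRange ι
  mul_tmul : ∀ (a c : A) (b d : B),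
    ι (a ⊗ₜ[ℂ] b) * ι (c ⊗ₜ[ℂ] d) = ι ((a * c) ⊗ₜ[ℂ] (b * d))
  star_tmul : ∀ (a : A) (b : B), star (ι (a ⊗ₜ[ℂ] b)) = ι (star a ⊗ₜ[ℂ] star b)

/-- The product ideal `S ⊗̂ T`: the closure in `X` (a completion of `A ⊗ B`) of the span of
elementary tensors `a ⊗ b` with `a ∈ S`, `b ∈ T`. -/
def tensorIdeal {A B : Type u} [NonUnitalRing A] [StarRing A] [Module ℂ A]
    [NonUnitalRing B] [StarRing B] [Module ℂ B]
    {X : Type u} [NonUnitalNormedRing X] [StarRing X] [NormedSpace ℂ X] [CompleteSpace X]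
    (ι : A ⊗[ℂ] B →ₗ[ℂ] X) (S : Set A) (T : Set B) : Set X :=
  closure (ι '' (Submodule.span ℂ (Set.image2 (fun a b => a ⊗ₜ[ℂ] b) S T)))

/-- A closed prime (two-sided) ideal of a Banach algebra: a proper closed two-sided ideal `K`
such that whenever the product of two closed two-sided ideals is contained in `K`, one of them
is contained in `K`. -/
def IsClosedPrimeIdeal {Y : Type u} [NonUnitalNormedRing Y] (K : TwoSidedIdeal Y) : Prop :=
  IsClosed (K : Set Y) ∧ (K : Set Y) ≠ Set.univ ∧
    ∀ I J : TwoSidedIdeal Y, IsClosed (I : Set Y) → IsClosed (J : Set Y) →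
      (∀ x ∈ I, ∀ y ∈ J, x * y ∈ K) → (I : Set Y) ⊆ (K : Set Y) ∨ (J : Set Y) ⊆ (K : Set Y)

/-- An irreducible continuous `*`-representation of a Banach `*`-algebra `Y` on a complex
Hilbert space. -/
structure IrreducibleRepOn (Y : Type u)
    [NonUnitalNormedRing Y] [StarRing Y] [NormedSpace ℂ Y] where
  H : Type u
  [normH : NormedAddCommGroup H]
  [ipsH : InnerProductSpace ℂ H]
  [csH : CompleteSpace H]
  π : Y →⋆ₙₐ[ℂ] (H →L[ℂ] H)
  continuous : Continuous π
  nonzero : ∃ y, π y ≠ 0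
  irreducible : ∀ S : Submodule ℂ H, IsClosed (S : Set H) →
    (∀ y : Y, ∀ v ∈ S, π y v ∈ S) → S = ⊥ ∨ S = ⊤

/-- A primitive ideal: the kernel of an irreducible `*`-representation. -/
def IsPrimitiveIdeal {Y : Type u} [NonUnitalNormedRing Y] [StarRing Y] [NormedSpace ℂ Y]
    (K : TwoSidedIdeal Y) : Prop :=
  ∃ ρ : IrreducibleRepOn Y, ∀ y, y ∈ K ↔ ρ.π y = 0

/-- A subset `K` of a ring is modular (as an ideal) if there is a relative unit `e`
with `x * e - x ∈ K` and `e * x - x ∈ K` for every `x`. -/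
def IsModularIdealSet {Y : Type u} [NonUnitalRing Y] (K : Set Y) : Prop :=
  ∃ e : Y, ∀ x : Y, x * e - x ∈ K ∧ e * x - x ∈ K

/-- A maximal modular (two-sided) ideal: a modular ideal which is proper and maximal among
proper two-sided ideals. -/
def IsMaximalModularIdeal {Y : Type u} [NonUnitalRing Y] (K : TwoSidedIdeal Y) : Prop :=
  IsModularIdealSet (K : Set Y) ∧ (K : Set Y) ≠ Set.univ ∧
    ∀ L : TwoSidedIdeal Y, (K : Set Y) ⊆ (L : Set Y) →
      (L : Set Y) = (K : Set Y) ∨ (L : Set Y) = Set.univ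

/-- The operator norm of a `p × p` matrix of bounded operators on a Hilbert space `H`,
viewed as an operator on the `ℓ²`-direct sum `H ⊕ ⋯ ⊕ H`. -/
noncomputable def opMatrixNorm {H : Type u} [NormedAddCommGroup H] [InnerProductSpace ℂ H]
    {p : ℕ} (T : Matrix (Fin p) (Fin p) (H →L[ℂ] H)) : ℝ :=
  sSup { r : ℝ | ∃ x : Fin p → H, (∑ i, ‖x i‖ ^ 2) ≤ 1 ∧
      r = Real.sqrt (∑ i, ‖∑ j, (T i j) (x j)‖ ^ 2) }

/-- An operator algebra structure on a Banach algebra `Y`: a bicontinuous algebra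
homomorphism of `Y` into the bounded operators on some Hilbert space. -/
structure OperatorAlgebraEmbedding (Y : Type u) [NonUnitalNormedRing Y] [NormedSpace ℂ Y] where
  H : Type u
  [normH : NormedAddCommGroup H]
  [ipsH : InnerProductSpace ℂ H]
  [csH : CompleteSpace H]
  ρ : Y →ₙₐ[ℂ] (H →L[ℂ] H)
  c : ℝ
  C : ℝ
  c_pos : 0 < c
  lower : ∀ y, c * ‖y‖ ≤ ‖ρ y‖
  upper : ∀ y, ‖ρ y‖ ≤ C * ‖y‖

/-- The matrix norms on `Y` induced by an operator algebra embedding, giving `Y` its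
operator space structure: the norm of `v ∈ M_p(Y)` is the operator norm of the matrix
of operators obtained by applying the embedding entrywise. -/
noncomputable def OperatorAlgebraEmbedding.matrixNorm {Y : Type u}
    [NonUnitalNormedRing Y] [NormedSpace ℂ Y] (e : OperatorAlgebraEmbedding Y)
    (p : ℕ) (v : Matrix (Fin p) (Fin p) Y) : ℝ :=
  letI := e.normH; letI := e.ipsH
  opMatrixNorm (v.map e.ρ)

/-- The Banach space projective tensor norm `‖·‖_γ` on the algebraic tensor product. -/
noncomputable def bsProjNorm {A B : Type u} [NonUnitalNormedRing A] [NormedSpace ℂ A]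
    [NonUnitalNormedRing B] [NormedSpace ℂ B] (u : A ⊗[ℂ] B) : ℝ :=
  sInf { r : ℝ | ∃ (n : ℕ) (a : Fin n → A) (b : Fin n → B),
      u = ∑ i, a i ⊗ₜ[ℂ] b i ∧ r = ∑ i, ‖a i‖ * ‖b i‖ }

/-- A C⋆-algebra `A` is subhomogeneous if there is `n : ℕ` bounding the (finite)
dimensions of all its irreducible `*`-representations. -/
def IsSubhomogeneous (A : Type u) [NonUnitalCStarAlgebra A] : Prop :=
  ∃ n : ℕ, ∀ ρ : IrreducibleRepOn A,
    letI := ρ.normH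
    letI := ρ.ipsH
    FiniteDimensional ℂ ρ.H ∧ Module.finrank ℂ ρ.H ≤ n


set_option linter.all false

section SecP1
section NCGT
variable {C : Type*} [CStarAlgebra C] [PartialOrder C] [StarOrderedRing C]

theorem gt_unitary_aux (a : C) (ha : IsSelfAdjoint a) (hn : ‖a‖ ≤ 1) :
    ∃ d : C, IsSelfAdjoint d ∧ 0 ≤ d ∧ d ≤ a * a ∧
      (1 - d) + Complex.I • a ∈ unitary C ∧ (1 - d) - Complex.I • a ∈ unitary C := by
  have hspec : ∀ s ∈ spectrum ℝ a, s ^ 2 ≤ 1 := by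
    intro s hs
    cases subsingleton_or_nontrivial C
    · exact absurd hs (by simp [spectrum.of_subsingleton])
    have h1 := (spectrum.norm_le_norm_of_mem hs).trans hn
    rw [Real.norm_eq_abs] at h1
    exact (sq_le_one_iff_abs_le_one s).2 h1
  set g : C := cfc (fun s : ℝ => Real.sqrt (1 - s ^ 2)) a with hg
  have hgc : Continuous (fun s : ℝ => Real.sqrt (1 - s ^ 2)) := by fun_prop
  have hgsa : IsSelfAdjoint g := cfc_predicate _ _
  have hgg : g * g = 1 - a * a := by
    rw [hg, ← cfc_mul _ _ a hgc.continuousOn hgc.continuousOn]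
    have : a * a = cfc (fun s : ℝ => s * s) a := by
      rw [cfc_mul (fun s : ℝ => s) (fun s : ℝ => s) a]
      simp [cfc_id' ℝ a]
    rw [this, ← cfc_one ℝ a, ← cfc_sub _ _ a]
    apply cfc_congr
    intro s hs
    have := hspec s hs
    simp only [Pi.one_apply]
    rw [Real.mul_self_sqrt (by linarith)]; ring
  have hcomm : Commute g a := by
    have h : Commute g (cfc (fun s : ℝ => s) a) := cfc_commute_cfc _ _ a
    rwa [cfc_id' ℝ a] at h
  have hca : g * a = a * g := hcomm
  have hI : ∀ y : C, Complex.I • Complex.I • y = -y := fun y => by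
    rw [smul_smul, Complex.I_mul_I, neg_one_smul]
  refine ⟨1 - g, (IsSelfAdjoint.one C).sub hgsa, ?_, ?_, ?_, ?_⟩
  · rw [sub_nonneg, hg]
    refine cfc_le_one _ a fun s hs => ?_
    exact Real.sqrt_le_one.2 (by nlinarith [sq_nonneg s])
  · have h2 : a * a = 1 - g * g := by rw [hgg]; abel
    rw [h2, hg, ← cfc_mul _ _ a hgc.continuousOn hgc.continuousOn]
    gcongr
    rw [cfc_le_iff _ _ a]
    intro s hs
    have h0 : Real.sqrt (1 - s^2) ≤ 1 := Real.sqrt_le_one.2 (by nlinarith [sq_nonneg s])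
    nlinarith [Real.sqrt_nonneg (1 - s^2)]
  · rw [sub_sub_cancel, Unitary.mem_iff]
    constructor
    · simp only [star_add, star_smul, hgsa.star_eq, ha.star_eq, mul_add, add_mul, hgg, smul_mul_assoc,
        mul_smul_comm, hca]
      simp [hI]
    · simp only [star_add, star_smul, hgsa.star_eq, ha.star_eq, mul_add, add_mul, hgg, smul_mul_assoc,
        mul_smul_comm, hca]
      simp [hI]
  · rw [sub_sub_cancel, Unitary.mem_iff]
    constructor
    · simp only [star_sub, star_smul, hgsa.star_eq, ha.star_eq, mul_sub, sub_mul, hgg, smul_mul_assoc,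
        mul_smul_comm, hca]
      simp [hI]; abel
    · simp only [star_sub, star_smul, hgsa.star_eq, ha.star_eq, mul_sub, sub_mul, hgg, smul_mul_assoc,
        mul_smul_comm, hca]
      simp [smul_sub, hI]; abel

variable {D : Type*} [CStarAlgebra D] [PartialOrder D] [StarOrderedRing D]

structure GTNear (V : C →ₗ[ℂ] D →ₗ[ℂ] ℂ) (M δ : ℝ) : Prop where
  bd : ∀ x y, ‖V x y‖ ≤ ‖x‖ * ‖y‖
  le : ∀ p ∈ unitary C, ∀ q ∈ unitary D, (V p q).re ≤ M
  near : M - δ ≤ (V 1 1).re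

theorem gt_norm_one_le (C : Type*) [CStarAlgebra C] : ‖(1 : C)‖ ≤ 1 := by
  cases subsingleton_or_nontrivial C
  · rw [Subsingleton.elim (1 : C) 0]; simp
  · simp

theorem GTNear.flip {V : C →ₗ[ℂ] D →ₗ[ℂ] ℂ} {M δ : ℝ} (h : GTNear V M δ) :
    GTNear V.flip M δ where
  bd x y := by rw [LinearMap.flip_apply, mul_comm]; exact h.bd y x
  le p hp q hq := h.le q hq p hp
  near := h.near

theorem gt_unit_smul {c : ℂ} (hc : ‖c‖ = 1) {p : C} (hp : p ∈ unitary C) : c • p ∈ unitary C := by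
  rw [Unitary.mem_iff] at hp ⊢
  have h : star c * c = 1 := by
    rw [Complex.star_def, Complex.conj_mul', hc]; simp
  constructor
  · rw [star_smul, smul_mul_smul_comm, hp.1, h, one_smul]
  · rw [star_smul, smul_mul_smul_comm, hp.2, mul_comm, h, one_smul]

theorem GTNear.le_sa {V : C →ₗ[ℂ] D →ₗ[ℂ] ℂ} {M δ : ℝ} (h : GTNear V M δ) {x : C}
    (hx : IsSelfAdjoint x) (hn : ‖x‖ ≤ 1) {q : D} (hq : q ∈ unitary D) : (V x q).re ≤ M := by
  obtain ⟨d, -, -, -, h1, h2⟩ := gt_unitary_aux x hx hn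
  have e1 := h.le _ (gt_unit_smul (c := -Complex.I) (by simp) h1) q hq
  have e2 := h.le _ (gt_unit_smul (c := Complex.I) (by simp) h2) q hq
  have : x = (1/2 : ℂ) • ((-Complex.I) • (1 - d + Complex.I • x) + Complex.I • (1 - d - Complex.I • x)) := by
    have : (-Complex.I) • (1 - d + Complex.I • x) + Complex.I • (1 - d - Complex.I • x) = (2:ℂ) • x := by
      simp only [smul_add, smul_sub, neg_smul, smul_smul, Complex.I_mul_I]
      rw [two_smul]; simp; abel
    rw [this, smul_smul]; norm_num
  rw [this, map_smul, map_add, LinearMap.smul_apply, LinearMap.add_apply, smul_eq_mul,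
    show (1/2:ℂ) = ((1/2:ℝ):ℂ) by norm_num, Complex.re_ofReal_mul, Complex.add_re]
  linarith

theorem gt_re_le_norm {z : ℂ} : |z.re| ≤ ‖z‖ := Complex.abs_re_le_norm z

/-- quadratic estimate -/
theorem GTNear.lemA_one {V : C →ₗ[ℂ] D →ₗ[ℂ] ℂ} {M δ : ℝ} (h : GTNear V M δ) {a : C} {b : D}
    (ha : IsSelfAdjoint a) (han : ‖a‖ ≤ 1) (hb : IsSelfAdjoint b) (hbn : ‖b‖ ≤ 1) :
    ∃ d : C, ∃ d' : D, 0 ≤ d ∧ d ≤ a * a ∧ 0 ≤ d' ∧ d' ≤ b * b ∧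
      |(V a b).re| ≤ δ + (V d 1).re + (V 1 d').re + ‖d‖ * ‖d'‖ := by
  obtain ⟨d, -, d0, d1, h1, h2⟩ := gt_unitary_aux a ha han
  obtain ⟨d', -, d0', d1', h1', h2'⟩ := gt_unitary_aux b hb hbn
  refine ⟨d, d', d0, d1, d0', d1', ?_⟩
  have e1 := h.le _ h1 _ h1'
  have e2 := h.le _ h2 _ h2'
  have e3 := h.le _ h1 _ h2'
  have e4 := h.le _ h2 _ h1'
  have h5 := (abs_le.1 ((Complex.abs_re_le_norm _).trans (h.bd d d'))).1
  have h6 := h.near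
  have key : ∀ z : ℂ, (Complex.I * (Complex.I * z)).re = - z.re := fun z => by
    rw [← mul_assoc, Complex.I_mul_I]; simp
  simp only [map_add, map_sub, map_smul, LinearMap.add_apply, LinearMap.sub_apply,
    LinearMap.smul_apply, smul_eq_mul, Complex.add_re, Complex.sub_re, key, mul_add, mul_sub] at e1 e2 e3 e4
  rw [abs_le]
  constructor <;> linarith

theorem GTNear.lemB_one {V : C →ₗ[ℂ] D →ₗ[ℂ] ℂ} {M δ : ℝ} (h : GTNear V M δ) {c e : C} {b : D}
    (hp : IsSelfAdjoint (1 - e + c)) (hm : IsSelfAdjoint (1 - e - c))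
    (hpn : ‖1 - e + c‖ ≤ 1) (hmn : ‖1 - e - c‖ ≤ 1) (hb : IsSelfAdjoint b) (hbn : ‖b‖ ≤ 1) :
    ∃ d' : D, 0 ≤ d' ∧ d' ≤ b * b ∧
      |(V c b).im| ≤ δ + (V e 1).re + (V 1 d').re - (V e d').re := by
  obtain ⟨d', -, d0', d1', h1', h2'⟩ := gt_unitary_aux b hb hbn
  refine ⟨d', d0', d1', ?_⟩
  have e1 := h.le_sa hp hpn h1'
  have e2 := h.le_sa hm hmn h2'
  have e3 := h.le_sa hp hpn h2'
  have e4 := h.le_sa hm hmn h1'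
  have h6 := h.near
  have key : ∀ z : ℂ, (Complex.I * z).re = - z.im := fun z => by simp
  simp only [map_add, map_sub, map_smul, LinearMap.add_apply, LinearMap.sub_apply,
    LinearMap.smul_apply, smul_eq_mul, Complex.add_re, Complex.sub_re, key, Complex.add_im, Complex.sub_im] at e1 e2 e3 e4
  rw [abs_le]
  constructor <;> linarith

theorem GTNear.lemA {V : C →ₗ[ℂ] D →ₗ[ℂ] ℂ} {M δ t R : ℝ} (h : GTNear V M δ) {ι : Type*} [Fintype ι]
    {a : ι → C} {b : ι → D} (ht : 0 < t) (hR : t * R ≤ 1) (hδ : δ ≤ t ^ 4)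
    (ha : ∀ i, IsSelfAdjoint (a i)) (han : ∀ i, ‖a i‖ ≤ R)
    (hb : ∀ i, IsSelfAdjoint (b i)) (hbn : ∀ i, ‖b i‖ ≤ R) :
    ∑ i, |(V (a i) (b i)).re| ≤ ‖∑ i, a i * a i‖ + ‖∑ i, b i * b i‖ +
      Fintype.card ι * (t ^ 2 * (1 + R ^ 4)) := by
  have hn : ∀ x : C, ‖(t : ℂ) • x‖ = t * ‖x‖ := fun x => by
    rw [norm_smul, Complex.norm_real, Real.norm_of_nonneg ht.le]
  have hn' : ∀ x : D, ‖(t : ℂ) • x‖ = t * ‖x‖ := fun x => by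
    rw [norm_smul, Complex.norm_real, Real.norm_of_nonneg ht.le]
  have hsa : ∀ i, IsSelfAdjoint ((t : ℂ) • a i) := fun i => IsSelfAdjoint.smul (r := (t : ℂ)) (Complex.conj_ofReal t) (ha i)
  have hsb : ∀ i, IsSelfAdjoint ((t : ℂ) • b i) := fun i => IsSelfAdjoint.smul (r := (t : ℂ)) (Complex.conj_ofReal t) (hb i)
  have hna : ∀ i, ‖(t : ℂ) • a i‖ ≤ 1 := fun i => by
    rw [hn]; exact (mul_le_mul_of_nonneg_left (han i) ht.le).trans hR
  have hnb : ∀ i, ‖(t : ℂ) • b i‖ ≤ 1 := fun i => by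
    rw [hn']; exact (mul_le_mul_of_nonneg_left (hbn i) ht.le).trans hR
  choose d d' h0 h1 h0' h1' H using fun i => h.lemA_one (hsa i) (hna i) (hsb i) (hnb i)
  have hd : ∀ i, ‖d i‖ ≤ t ^ 2 * R ^ 2 := fun i => by
    refine (CStarAlgebra.norm_le_norm_of_nonneg_of_le (h0 i) (h1 i)).trans ((norm_mul_le _ _).trans ?_)
    rw [hn]
    have : t * ‖a i‖ ≤ t * R := mul_le_mul_of_nonneg_left (han i) ht.le
    nlinarith [norm_nonneg (a i), mul_nonneg ht.le (norm_nonneg (a i))]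
  have hd' : ∀ i, ‖d' i‖ ≤ t ^ 2 * R ^ 2 := fun i => by
    refine (CStarAlgebra.norm_le_norm_of_nonneg_of_le (h0' i) (h1' i)).trans ((norm_mul_le _ _).trans ?_)
    rw [hn']
    have : t * ‖b i‖ ≤ t * R := mul_le_mul_of_nonneg_left (hbn i) ht.le
    nlinarith [norm_nonneg (b i), mul_nonneg ht.le (norm_nonneg (b i))]
  have hS : ‖∑ i, d i‖ ≤ t ^ 2 * ‖∑ i, a i * a i‖ := by
    refine (CStarAlgebra.norm_le_norm_of_nonneg_of_le (Finset.sum_nonneg fun i _ => h0 i)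
      (Finset.sum_le_sum fun i _ => h1 i)).trans ?_
    simp only [smul_mul_smul_comm, ← Finset.smul_sum, norm_smul]
    simp [sq, abs_of_pos ht]
  have hS' : ‖∑ i, d' i‖ ≤ t ^ 2 * ‖∑ i, b i * b i‖ := by
    refine (CStarAlgebra.norm_le_norm_of_nonneg_of_le (Finset.sum_nonneg fun i _ => h0' i)
      (Finset.sum_le_sum fun i _ => h1' i)).trans ?_
    simp only [smul_mul_smul_comm, ← Finset.smul_sum, norm_smul]
    simp [sq, abs_of_pos ht]
  have hf : ∑ i, (V (d i) 1).re ≤ t ^ 2 * ‖∑ i, a i * a i‖ := by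
    have : ∑ i, (V (d i) 1).re = (V (∑ i, d i) 1).re := by
      rw [map_sum, LinearMap.sum_apply, Complex.re_sum]
    rw [this]
    refine ((Complex.re_le_norm _).trans (h.bd _ _)).trans (le_trans ?_ hS)
    exact mul_le_of_le_one_right (norm_nonneg _) (gt_norm_one_le D)
  have hg : ∑ i, (V 1 (d' i)).re ≤ t ^ 2 * ‖∑ i, b i * b i‖ := by
    have : ∑ i, (V 1 (d' i)).re = (V 1 (∑ i, d' i)).re := by
      rw [map_sum, Complex.re_sum]
    rw [this]
    refine ((Complex.re_le_norm _).trans (h.bd _ _)).trans (le_trans ?_ hS')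
    exact mul_le_of_le_one_left (norm_nonneg _) (gt_norm_one_le C)
  have hsum : t ^ 2 * ∑ i, |(V (a i) (b i)).re| ≤ t ^ 2 * ‖∑ i, a i * a i‖ + t ^ 2 * ‖∑ i, b i * b i‖
      + Fintype.card ι * (t ^ 4 + t ^ 4 * R ^ 4) := by
    have h3 : ∀ i, t ^ 2 * |(V (a i) (b i)).re| ≤ (t ^ 4 + t ^ 4 * R ^ 4) + (V (d i) 1).re + (V 1 (d' i)).re := by
      intro i
      have h4 := H i
      have h5 : V ((t : ℂ) • a i) ((t : ℂ) • b i) = ((t ^ 2 : ℝ) : ℂ) * V (a i) (b i) := by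
        simp only [map_smul, LinearMap.smul_apply, smul_eq_mul]; push_cast; ring
      rw [h5, Complex.re_ofReal_mul, abs_mul, abs_of_nonneg (sq_nonneg t)] at h4
      have h6 : ‖d i‖ * ‖d' i‖ ≤ (t ^ 2 * R ^ 2) * (t ^ 2 * R ^ 2) :=
        mul_le_mul (hd i) (hd' i) (norm_nonneg _) (by positivity)
      nlinarith
    rw [Finset.mul_sum]
    refine (Finset.sum_le_sum fun i _ => h3 i).trans ?_
    rw [Finset.sum_add_distrib, Finset.sum_add_distrib, Finset.sum_const, Finset.card_univ, nsmul_eq_mul]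
    linarith
  have ht2 : 0 < t ^ 2 := by positivity
  refine le_of_mul_le_mul_left (hsum.trans (le_of_eq ?_)) ht2
  ring

theorem gt_spec_abs {a : C} {s R : ℝ} (hs : s ∈ spectrum ℝ a) (hn : ‖a‖ ≤ R) : |s| ≤ R := by
  cases subsingleton_or_nontrivial C
  · exact absurd hs (by simp [spectrum.of_subsingleton])
  · exact (spectrum.norm_le_norm_of_mem hs).trans hn

theorem gt_sq_le {e : C} (he : 0 ≤ e) (hn : ‖e‖ ≤ 1) : e * e ≤ e := by
  have hsa : IsSelfAdjoint e := IsSelfAdjoint.of_nonneg he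
  have h1 : cfc (fun s : ℝ => s * s) e = e * e := by
    rw [cfc_mul (fun s : ℝ => s) (fun s : ℝ => s) e, cfc_id' ℝ e]
  have h2 : cfc (fun s : ℝ => s) e = e := cfc_id' ℝ e
  calc e * e = cfc (fun s : ℝ => s * s) e := h1.symm
    _ ≤ cfc (fun s : ℝ => s) e := by
      refine cfc_mono fun s hs => ?_
      have := (abs_le.1 (gt_spec_abs hs hn)).2
      have h0 : 0 ≤ s := spectrum_nonneg_of_nonneg he hs
      nlinarith
    _ = e := h2

theorem GTNear.lemB {V : C →ₗ[ℂ] D →ₗ[ℂ] ℂ} {M δ t : ℝ} (h : GTNear V M δ) {ι : Type*} [Fintype ι]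
    {c : ι → C} {b : ι → D} (ht : 0 < t) (ht1 : t ≤ 1) (hδ : δ ≤ t ^ 4)
    (hc : ∀ i, IsSelfAdjoint (c i)) (hcn : ∀ i, ‖c i‖ ≤ 1)
    (hb : ∀ i, IsSelfAdjoint (b i)) (hbn : ∀ i, ‖b i‖ ≤ 1) :
    ∑ i, |(V (c i) (b i)).im| ≤ 2 * ‖∑ i, cfc (fun s : ℝ => |s|) (c i)‖ + 2 * ‖∑ i, b i * b i‖ +
      Fintype.card ι * (3 * t ^ 2) := by
  have hc1 : Continuous (fun s : ℝ => |s|) := continuous_abs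
  set e : ι → C := fun i => cfc (fun s : ℝ => |s|) (c i) with he
  have hesa : ∀ i, IsSelfAdjoint (e i) := fun i => cfc_predicate _ _
  have he0 : ∀ i, 0 ≤ e i := fun i => cfc_nonneg fun s _ => abs_nonneg s
  have hen : ∀ i, ‖e i‖ ≤ 1 := fun i => norm_cfc_le zero_le_one fun s hs => by
    simpa using gt_spec_abs hs (hcn i)
  have hid : ∀ i, cfc (fun s : ℝ => s) (c i) = c i := fun i => cfc_id' ℝ (c i)
  have hp : ∀ i, 1 - e i + c i = cfc (fun s : ℝ => 1 - |s| + s) (c i) := fun i => by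
    rw [cfc_add (c i) (fun s : ℝ => 1 - |s|) (fun s => s), cfc_sub (fun _ : ℝ => 1) (fun s => |s|) (c i), hid]
    simp [he, cfc_const_one ℝ (c i)]
  have hm : ∀ i, 1 - e i - c i = cfc (fun s : ℝ => 1 - |s| - s) (c i) := fun i => by
    rw [cfc_sub (fun s : ℝ => 1 - |s|) (fun s => s) (c i), cfc_sub (fun _ : ℝ => 1) (fun s => |s|) (c i), hid]
    simp [he, cfc_const_one ℝ (c i)]
  choose d h0 h1 H using fun i => h.lemB_one (c := c i) (e := e i) (b := b i)
    (by rw [hp]; exact cfc_predicate _ _) (by rw [hm]; exact cfc_predicate _ _)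
    (by
      rw [hp]
      refine norm_cfc_le zero_le_one fun s hs => ?_
      have h2 := gt_spec_abs hs (hcn i)
      rw [Real.norm_eq_abs, abs_le]
      constructor <;> cases abs_cases s <;> linarith)
    (by
      rw [hm]
      refine norm_cfc_le zero_le_one fun s hs => ?_
      have h2 := gt_spec_abs hs (hcn i)
      rw [Real.norm_eq_abs, abs_le]
      constructor <;> cases abs_cases s <;> linarith) (hb i) (hbn i)
  have hdn : ∀ i, ‖d i‖ ≤ 1 := fun i => by
    refine (CStarAlgebra.norm_le_norm_of_nonneg_of_le (h0 i) (h1 i)).trans ((norm_mul_le _ _).trans ?_)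
    nlinarith [norm_nonneg (b i), hbn i]
  have hA := h.lemA (t := t) (R := 1) ht (by linarith) hδ hesa hen (fun i => IsSelfAdjoint.of_nonneg (h0 i)) hdn
  have hS : ‖∑ i, d i‖ ≤ ‖∑ i, b i * b i‖ :=
    CStarAlgebra.norm_le_norm_of_nonneg_of_le (Finset.sum_nonneg fun i _ => h0 i)
      (Finset.sum_le_sum fun i _ => h1 i)
  have hSd : ‖∑ i, d i * d i‖ ≤ ‖∑ i, d i‖ :=
    CStarAlgebra.norm_le_norm_of_nonneg_of_le (Finset.sum_nonneg fun i _ => by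
      have := star_mul_self_nonneg (d i); rwa [(IsSelfAdjoint.of_nonneg (h0 i)).star_eq] at this)
      (Finset.sum_le_sum fun i _ => gt_sq_le (h0 i) (hdn i))
  have hSe : ‖∑ i, e i * e i‖ ≤ ‖∑ i, e i‖ :=
    CStarAlgebra.norm_le_norm_of_nonneg_of_le (Finset.sum_nonneg fun i _ => by
      have := star_mul_self_nonneg (e i); rwa [(hesa i).star_eq] at this)
      (Finset.sum_le_sum fun i _ => gt_sq_le (he0 i) (hen i))
  have hf : ∑ i, (V (e i) 1).re ≤ ‖∑ i, e i‖ := by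
    have : ∑ i, (V (e i) 1).re = (V (∑ i, e i) 1).re := by
      rw [map_sum, LinearMap.sum_apply, Complex.re_sum]
    rw [this]
    refine ((Complex.re_le_norm _).trans (h.bd _ _)).trans ?_
    exact mul_le_of_le_one_right (norm_nonneg _) (gt_norm_one_le D)
  have hg : ∑ i, (V 1 (d i)).re ≤ ‖∑ i, d i‖ := by
    have : ∑ i, (V 1 (d i)).re = (V 1 (∑ i, d i)).re := by
      rw [map_sum, Complex.re_sum]
    rw [this]
    refine ((Complex.re_le_norm _).trans (h.bd _ _)).trans ?_
    exact mul_le_of_le_one_left (norm_nonneg _) (gt_norm_one_le C)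
  have h3 : ∀ i, |(V (c i) (b i)).im| ≤ t ^ 2 + (V (e i) 1).re + (V 1 (d i)).re + |(V (e i) (d i)).re| := by
    intro i
    have h4 := neg_abs_le (V (e i) (d i)).re
    have h5 : t ^ 4 ≤ t ^ 2 := pow_le_pow_of_le_one ht.le ht1 (by norm_num)
    linarith [H i]
  refine (Finset.sum_le_sum fun i _ => h3 i).trans ?_
  rw [Finset.sum_add_distrib, Finset.sum_add_distrib, Finset.sum_add_distrib, Finset.sum_const,
    Finset.card_univ, nsmul_eq_mul]
  norm_num at hA
  linarith

end NCGT

end SecP1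

section SecP2
section NCGT
/-- sign -/
def gtSg (b : Bool) : ℂ := if b then 1 else -1

def gtRad {C : Type*} [AddCommGroup C] [Module ℂ C] {n : ℕ} (h : Fin n → C) (ε : Fin n → Bool) : C :=
  ∑ s, gtSg (ε s) • h s

theorem gtRad_cons {C : Type*} [AddCommGroup C] [Module ℂ C] {n : ℕ} (h : Fin (n+1) → C) (b : Bool)
    (ε : Fin n → Bool) :
    gtRad h (Fin.cons b ε) = gtSg b • h 0 + gtRad (fun s => h s.succ) ε := by
  simp [gtRad, Fin.sum_univ_succ]

theorem gt_sum_cons {E : Type*} [AddCommMonoid E] {n : ℕ} (f : (Fin (n+1) → Bool) → E) :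
    ∑ ε, f ε = ∑ ε : Fin n → Bool, (f (Fin.cons true ε) + f (Fin.cons false ε)) := by
  rw [← (Fin.consEquiv (fun _ : Fin (n+1) => Bool)).sum_comp, Fintype.sum_prod_type, Fintype.sum_bool,
    Finset.sum_add_distrib]
  rfl

theorem gt_bilin {C D E : Type*} [AddCommGroup C] [Module ℂ C] [AddCommGroup D] [Module ℂ D]
    [AddCommGroup E] [Module ℂ E] (B : C →ₗ[ℂ] D →ₗ[ℂ] E) {n : ℕ} (h : Fin n → C) (k : Fin n → D) :
    ∑ ε, B (gtRad h ε) (gtRad k ε) = (2 ^ n : ℕ) • ∑ s, B (h s) (k s) := by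
  induction n with
  | zero => simp [gtRad]
  | succ n ih =>
    rw [gt_sum_cons]
    have : ∀ ε : Fin n → Bool, B (gtRad h (Fin.cons true ε)) (gtRad k (Fin.cons true ε)) +
        B (gtRad h (Fin.cons false ε)) (gtRad k (Fin.cons false ε)) =
        2 • B (h 0) (k 0) + 2 • B (gtRad (fun s => h s.succ) ε) (gtRad (fun s => k s.succ) ε) := by
      intro ε
      simp only [gtRad_cons, gtSg, if_true, one_smul, neg_smul, map_add, LinearMap.add_apply, map_neg, LinearMap.neg_apply,
        Bool.false_eq_true, if_false]
      abel
    simp only [this, Finset.sum_add_distrib, Finset.sum_const, ← Finset.smul_sum, ih]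
    rw [Fin.sum_univ_succ, smul_add, smul_smul, smul_smul, Finset.card_univ, pow_succ, mul_comm (2^n) 2]
    simp [mul_comm]

variable {C : Type*} [CStarAlgebra C] [PartialOrder C] [StarOrderedRing C]

theorem gtSg_sa (b : Bool) : IsSelfAdjoint (gtSg b) := by
  cases b <;> simp [gtSg, IsSelfAdjoint]

theorem gtRad_sa {n : ℕ} {h : Fin n → C} (hh : ∀ s, IsSelfAdjoint (h s)) (ε : Fin n → Bool) :
    IsSelfAdjoint (gtRad h ε) :=
  isSelfAdjoint_sum _ fun s _ => (gtSg_sa _).smul (hh s)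

theorem gtSg_norm (b : Bool) : ‖gtSg b‖ = 1 := by
  cases b <;> simp [gtSg]

theorem gtRad_norm {n : ℕ} {h : Fin n → C} (hh : ∀ s, ‖h s‖ ≤ 1) (ε : Fin n → Bool) :
    ‖gtRad h ε‖ ≤ n := by
  refine (norm_sum_le _ _).trans ((Finset.sum_le_sum (g := fun _ => (1:ℝ)) fun s _ => ?_).trans (by simp))
  rw [norm_smul, gtSg_norm, one_mul]; exact hh s

theorem gt_sumsq {n : ℕ} (h : Fin n → C) :
    ∑ ε, gtRad h ε * gtRad h ε = (2 ^ n : ℕ) • ∑ s, h s * h s :=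
  gt_bilin (LinearMap.mul ℂ C) h h

theorem gt_sum_conj {n : ℕ} (h : Fin n → C) (g : C) :
    ∑ ε, gtRad h ε * g * gtRad h ε = (2 ^ n : ℕ) • ∑ s, h s * g * h s := by
  have := gt_bilin ((LinearMap.mul ℂ C).comp (LinearMap.mulRight ℂ g)) h h
  simpa using this

theorem gt_four_pt {x h : C} (hx : IsSelfAdjoint x) (hh : IsSelfAdjoint h) :
    (h + x) ^ 4 + (-h + x) ^ 4 ≤ 2 • (x ^ 4 + (x * x * (h * h) + h * h * (x * x) + h ^ 4) +
      2 • (h * (x * x) * h + x * (h * h) * x)) := by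
  have e : 2 • (x ^ 4 + (x * x * (h * h) + h * h * (x * x) + h ^ 4) +
      2 • (h * (x * x) * h + x * (h * h) * x)) - ((h + x) ^ 4 + (-h + x) ^ 4)
      = 2 • (star (x * h - h * x) * (x * h - h * x)) := by
    rw [star_sub, star_mul, star_mul, hx.star_eq, hh.star_eq]
    noncomm_ring
  rw [← sub_nonneg, e]
  exact nsmul_nonneg (star_mul_self_nonneg _) 2

theorem gt_conj_nonneg {x g : C} (hx : IsSelfAdjoint x) (hg : 0 ≤ g) : 0 ≤ x * g * x := by
  have := star_left_conjugate_nonneg hg x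
  rwa [hx.star_eq] at this

theorem gt_sq_nonneg {x : C} (hx : IsSelfAdjoint x) : 0 ≤ x * x := by
  have := star_mul_self_nonneg x
  rwa [hx.star_eq] at this

theorem gt_fourth {n : ℕ} (h : Fin n → C) (hh : ∀ s, IsSelfAdjoint (h s)) :
    ∑ ε, gtRad h ε ^ 4 ≤ (2 ^ n : ℕ) • ((∑ s, h s * h s) * (∑ s, h s * h s) +
      2 • ∑ t, h t * (∑ s, h s * h s) * h t) := by
  induction n with
  | zero => simp [gtRad]
  | succ n ih =>
    rw [gt_sum_cons]
    set h' : Fin n → C := fun s => h s.succ with hh'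
    set A := ∑ s, h' s * h' s with hA
    set z := h 0 with hz
    have hz' : IsSelfAdjoint z := hh 0
    have h1 : ∀ ε : Fin n → Bool, gtRad h (Fin.cons true ε) ^ 4 + gtRad h (Fin.cons false ε) ^ 4 ≤
        2 • (gtRad h' ε ^ 4 + (gtRad h' ε * gtRad h' ε * (z * z) + z * z * (gtRad h' ε * gtRad h' ε) + z ^ 4) +
      2 • (z * (gtRad h' ε * gtRad h' ε) * z + gtRad h' ε * (z * z) * gtRad h' ε)) := by
      intro ε
      have := gt_four_pt (x := gtRad h' ε) (h := z) (gtRad_sa (fun s => hh _) ε) hz'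
      simpa [gtRad_cons, gtSg] using this
    refine (Finset.sum_le_sum fun ε _ => h1 ε).trans ?_
    simp only [← Finset.smul_sum, Finset.sum_add_distrib, ← Finset.sum_mul, ← Finset.mul_sum, gt_sumsq, gt_sum_conj,
      Finset.sum_const, Finset.card_univ]
    have h2 := ih h' (fun s => hh _)
    have h3 : (∑ s, h s * h s) = z * z + A := by rw [Fin.sum_univ_succ]
    have h4 : ∑ t, h t * (z * z + A) * h t = z * (z * z) * z + z * A * z + (∑ t, h' t * (z * z) * h' t
        + ∑ t, h' t * A * h' t) := by
      rw [Fin.sum_univ_succ]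
      simp only [mul_add, add_mul, Finset.sum_add_distrib]
      rfl
    have h5 : 0 ≤ z * (z * z) * z := gt_conj_nonneg hz' (gt_sq_nonneg hz')
    rw [h3, h4, pow_succ 2 n, mul_comm, mul_smul]
    refine nsmul_le_nsmul_right ?_ 2
    have h6 : Fintype.card (Fin n → Bool) = 2 ^ n := by simp
    rw [h6]
    calc _ ≤ (2 ^ n : ℕ) • (A * A + 2 • ∑ t, h' t * A * h' t) + ((2^n:ℕ) • A * (z * z) + z * z * ((2^n:ℕ) • A) + (2^n:ℕ) • z ^ 4) +
          2 • (z * ((2^n:ℕ) • A) * z + (2^n:ℕ) • ∑ s, h' s * (z * z) * h' s) := by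
          gcongr
      _ = (2 ^ n : ℕ) • ((z * z + A) * (z * z + A) + 2 • (z * A * z + (∑ t, h' t * (z * z) * h' t
        + ∑ t, h' t * A * h' t))) := by
          generalize (2^n) = N
          simp only [mul_add, add_mul, smul_add, smul_mul_assoc, mul_smul_comm, smul_smul, mul_comm N 2]
          rw [show z ^ 4 = z * z * (z * z) by noncomm_ring]
          abel
      _ ≤ _ := by
          refine nsmul_le_nsmul_right ?_ _
          gcongr
          exact le_add_of_nonneg_left h5

theorem gt_fourth_norm {n : ℕ} (h : Fin n → C) (hh : ∀ s, IsSelfAdjoint (h s))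
    (h1 : ∑ s, h s * h s ≤ 1) : ∑ ε, gtRad h ε ^ 4 ≤ (2 ^ n : ℕ) • (3 : C) := by
  refine (gt_fourth h hh).trans (nsmul_le_nsmul_right ?_ _)
  set A := ∑ s, h s * h s with hA
  have hA0 : 0 ≤ A := Finset.sum_nonneg fun s _ => gt_sq_nonneg (hh s)
  have hAn : ‖A‖ ≤ 1 := (CStarAlgebra.norm_le_norm_of_nonneg_of_le hA0 h1).trans (gt_norm_one_le C)
  have h2 : A * A ≤ 1 := (gt_sq_le hA0 hAn).trans h1
  have h3 : ∑ t, h t * A * h t ≤ 1 := by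
    refine le_trans (Finset.sum_le_sum fun t _ => ?_) h1
    have := star_left_conjugate_le_conjugate h1 (h t)
    rw [(hh t).star_eq] at this
    simpa using this
  calc _ ≤ 1 + 2 • (1 : C) := by gcongr
    _ = 3 := by norm_num

end NCGT

end SecP2

section SecP3
section NCGT

def gtT (s : ℝ) : ℝ := max (-1) (min s 1)

def gtLay : ℕ → ℝ → ℝ
  | 0 => gtT
  | (l+1) => fun s => gtT (s / 2 ^ (l+1)) - gtT (s / 2 ^ l) / 2

theorem gtT_cont : Continuous gtT := by unfold gtT; fun_prop

theorem gtLay_cont (l : ℕ) : Continuous (gtLay l) := by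
  cases l with
  | zero => exact gtT_cont
  | succ l =>
    unfold gtLay
    exact (gtT_cont.comp (by fun_prop)).sub ((gtT_cont.comp (by fun_prop)).div_const 2)

theorem gtT_abs (s : ℝ) : |gtT s| ≤ 1 := by
  unfold gtT; rw [abs_le]; constructor
  · exact le_max_left _ _
  · exact max_le (by norm_num) (min_le_right _ _)

theorem gtT_of {s : ℝ} (h : |s| ≤ 1) : gtT s = s := by
  rw [abs_le] at h
  unfold gtT; rw [min_eq_left h.2, max_eq_right h.1]

theorem gtLay_sum (L : ℕ) (s : ℝ) :
    ∑ l ∈ Finset.range (L+1), 2 ^ l * gtLay l s = 2 ^ L * gtT (s / 2 ^ L) := by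
  induction L with
  | zero => simp [gtLay]
  | succ L ih => rw [Finset.sum_range_succ, ih]; simp only [gtLay]; ring

theorem gtQ_bound (s : ℝ) : |gtT s - gtT (2 * s) / 2| ≤ 1 / 2 ∧ |gtT s - gtT (2 * s) / 2| ≤ 8 * s ^ 4 := by
  have key : |gtT s - gtT (2 * s) / 2| ≤ 1 / 2 := by
    unfold gtT
    rw [abs_le]
    constructor <;> rcases max_cases (-1) (min s 1) with h | h <;>
      rcases max_cases (-1) (min (2*s) 1) with h' | h' <;> rcases min_cases s 1 with g | g <;>
      rcases min_cases (2*s) 1 with g' | g' <;> linarith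
  refine ⟨key, ?_⟩
  by_cases hs : |s| ≤ 1/2
  · rw [gtT_of (by linarith), gtT_of (by rw [abs_mul]; norm_num; linarith)]
    have : s - 2 * s / 2 = 0 := by ring
    rw [this]; simp; positivity
  · push Not at hs
    have h2 : (1/4) ≤ s ^ 2 := by rw [← sq_abs]; nlinarith
    nlinarith

theorem gtLay_abs (l : ℕ) (s : ℝ) : |gtLay l s| ≤ 1 := by
  cases l with
  | zero => exact gtT_abs s
  | succ l =>
    have := (gtQ_bound (s / 2 ^ (l+1))).1
    rw [show 2 * (s / 2 ^ (l+1)) = s / 2 ^ l by rw [pow_succ]; field_simp] at this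
    exact this.trans (by norm_num)

theorem gtLay_bound (l : ℕ) (s : ℝ) : |gtLay l s| ≤ (1/16) ^ l * (1 + 8 * s ^ 4) := by
  cases l with
  | zero =>
    have := gtT_abs s
    simp only [gtLay]
    nlinarith [sq_nonneg (s^2)]
  | succ l =>
    have := (gtQ_bound (s / 2 ^ (l+1))).2
    rw [show 2 * (s / 2 ^ (l+1)) = s / 2 ^ l by rw [pow_succ]; field_simp] at this
    refine this.trans ?_
    have h2 : (s / 2 ^ (l+1)) ^ 4 = (1/16) ^ (l+1) * s ^ 4 := by
      rw [div_pow, ← pow_mul, mul_comm (l+1) 4, pow_mul, one_div, inv_pow, show (2:ℝ)^4 = 16 by norm_num]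
      field_simp
    rw [h2]
    have : (0:ℝ) ≤ (1/16) ^ (l+1) := by positivity
    nlinarith

variable {C : Type*} [CStarAlgebra C] [PartialOrder C] [StarOrderedRing C]
variable {D : Type*} [CStarAlgebra D] [PartialOrder D] [StarOrderedRing D]

def gtL (l : ℕ) (x : C) : C := cfc (gtLay l) x

theorem gtL_sa (l : ℕ) (x : C) : IsSelfAdjoint (gtL l x) := cfc_predicate _ _

theorem gtL_norm (l : ℕ) (x : C) : ‖gtL l x‖ ≤ 1 :=
  norm_cfc_le zero_le_one fun s _ => by simpa using gtLay_abs l s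

theorem gtL_sum {L : ℕ} {x : C} (hx : IsSelfAdjoint x) (hn : ‖x‖ ≤ 2 ^ L) :
    ∑ l ∈ Finset.range (L+1), (2:ℝ) ^ l • gtL l x = x := by
  have h1 : ∑ l ∈ Finset.range (L+1), (2:ℝ) ^ l • gtL l x
      = cfc (fun s => ∑ l ∈ Finset.range (L+1), 2 ^ l * gtLay l s) x := by
    rw [show (fun s => ∑ l ∈ Finset.range (L+1), (2:ℝ) ^ l * gtLay l s) =
      ∑ l ∈ Finset.range (L+1), (fun s => (2:ℝ) ^ l * gtLay l s) by ext s; simp]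
    rw [cfc_sum _ x _ (fun l _ => ((gtLay_cont l).const_mul _ |>.continuousOn))]
    refine Finset.sum_congr rfl fun l _ => ?_
    rw [gtL, ← cfc_smul _ _ _ (gtLay_cont l).continuousOn]
    rfl
  rw [h1]
  conv_rhs => rw [← cfc_id' ℝ x]
  refine cfc_congr fun s hs => ?_
  have h2 := gt_spec_abs hs hn
  simp only [gtLay_sum]
  rw [gtT_of]
  · field_simp
  · rw [abs_div, abs_of_pos (by positivity : (0:ℝ) < 2 ^ L), div_le_one (by positivity)]; exact h2

theorem gt_abs_le (l : ℕ) {x : C} (hx : IsSelfAdjoint x) :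
    cfc (fun s : ℝ => |s|) (gtL l x) ≤ ((1/16:ℝ) ^ l) • (1 + (8:ℝ) • x ^ 4) := by
  have h1 : cfc (fun s : ℝ => |s|) (gtL l x) = cfc (fun s => |gtLay l s|) x := by
    rw [gtL, ← cfc_comp' (fun s : ℝ => |s|) (gtLay l) x continuous_abs.continuousOn (gtLay_cont l).continuousOn]
  have h2 : ((1/16:ℝ) ^ l) • (1 + (8:ℝ) • x ^ 4) = cfc (fun s : ℝ => (1/16) ^ l * (1 + 8 * s ^ 4)) x := by
    rw [cfc_const_mul _ _ x, cfc_add x (fun _ : ℝ => (1:ℝ)) (fun s => 8 * s ^ 4), cfc_const_one ℝ x,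
      cfc_const_mul (8:ℝ) _ x, cfc_pow_id x 4]
  rw [h1, h2]
  exact cfc_mono (fun s _ => gtLay_bound l s) ((gtLay_cont l).abs.continuousOn) (by fun_prop)

theorem gt_sq_le_abs {c : C} (hc : IsSelfAdjoint c) (hn : ‖c‖ ≤ 1) :
    c * c ≤ cfc (fun s : ℝ => |s|) c := by
  have h1 : cfc (fun s : ℝ => s * s) c = c * c := by
    rw [cfc_mul (fun s : ℝ => s) (fun s : ℝ => s) c, cfc_id' ℝ c]
  rw [← h1]
  refine cfc_mono (fun s hs => ?_) (by fun_prop) (by fun_prop)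
  have := gt_spec_abs hs hn
  nlinarith [abs_mul_abs_self s, abs_nonneg s]

theorem gt_E_abs (l : ℕ) {n : ℕ} {h : Fin n → C} (hh : ∀ s, IsSelfAdjoint (h s))
    (h1 : ∑ s, h s * h s ≤ 1) :
    ‖∑ ε, cfc (fun s : ℝ => |s|) (gtL l (gtRad h ε))‖ ≤ 2 ^ n * (25 * (1/16) ^ l) := by
  have h0 : 0 ≤ ∑ ε, cfc (fun s : ℝ => |s|) (gtL l (gtRad h ε)) :=
    Finset.sum_nonneg fun ε _ => cfc_nonneg fun s _ => abs_nonneg s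
  have h2 : ∑ ε, cfc (fun s : ℝ => |s|) (gtL l (gtRad h ε)) ≤ (2 ^ n * (25 * (1/16:ℝ) ^ l)) • (1 : C) := by
    refine (Finset.sum_le_sum fun ε _ => gt_abs_le l (gtRad_sa hh ε)).trans ?_
    rw [← Finset.smul_sum, Finset.sum_add_distrib, ← Finset.smul_sum, Finset.sum_const, Finset.card_univ]
    have h3 := gt_fourth_norm h hh h1
    have h4 : (2 ^ n * (25 * (1/16:ℝ) ^ l)) • (1 : C) = (1/16:ℝ) ^ l •
        ((Fintype.card (Fin n → Bool)) • (1:C) + (8:ℝ) • ((2 ^ n : ℕ) • (3 : C))) := by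
      have e1 : ((Fintype.card (Fin n → Bool)) • (1:C)) = (2^n:ℝ) • (1:C) := by
        simp [← Nat.cast_smul_eq_nsmul ℝ]
      have e2 : (3:C) = (3:ℝ) • (1:C) := by
        rw [show (3:ℝ) = ((3:ℕ):ℝ) by norm_num, Nat.cast_smul_eq_nsmul]; simp
      rw [e1, e2, ← Nat.cast_smul_eq_nsmul ℝ, smul_smul, smul_smul, ← add_smul, smul_smul]
      congr 1; push_cast; ring
    rw [h4]
    have : (0:ℝ) ≤ (1/16:ℝ)^l := by positivity
    gcongr
  refine (CStarAlgebra.norm_le_norm_of_nonneg_of_le h0 h2).trans ?_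
  rw [norm_smul, Real.norm_of_nonneg (by positivity)]
  exact mul_le_of_le_one_right (by positivity) (gt_norm_one_le C)

theorem gt_E_sq (l : ℕ) {n : ℕ} {h : Fin n → C} (hh : ∀ s, IsSelfAdjoint (h s))
    (h1 : ∑ s, h s * h s ≤ 1) :
    ‖∑ ε, gtL l (gtRad h ε) * gtL l (gtRad h ε)‖ ≤ 2 ^ n * (25 * (1/16) ^ l) :=
  (CStarAlgebra.norm_le_norm_of_nonneg_of_le (Finset.sum_nonneg fun ε _ => gt_sq_nonneg (gtL_sa _ _))
    (Finset.sum_le_sum fun ε _ => gt_sq_le_abs (gtL_sa _ _) (gtL_norm _ _))).trans (gt_E_abs l hh h1)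

theorem GTNear.pair {V : C →ₗ[ℂ] D →ₗ[ℂ] ℂ} {M δ t : ℝ} (hV : GTNear V M δ)
    (ht : 0 < t) (ht1 : t ≤ 1) (hδ : δ ≤ t ^ 4)
    {n : ℕ} {h : Fin n → C} (hh : ∀ s, IsSelfAdjoint (h s)) (h1 : ∑ s, h s * h s ≤ 1)
    {k : Fin n → D} (hk : ∀ s, IsSelfAdjoint (k s)) (k1 : ∑ s, k s * k s ≤ 1) (m j : ℕ) :
    ∑ ε, |(V (gtL (m+j) (gtRad h ε)) (gtL m (gtRad k ε))).im| ≤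
      2 ^ n * (100 * (1/4) ^ (m+j+m) + 4 ^ j * (3 * t ^ 2)) := by
  have hw0 : (0:ℝ) < (1/4) ^ j := by positivity
  have hw1 : ((1/4:ℝ)) ^ j ≤ 1 := pow_le_one₀ (by norm_num) (by norm_num)
  have hwc : (((1/4:ℝ) ^ j : ℝ) : ℂ) = (((1/4:ℝ) ^ j : ℝ) : ℂ) := rfl
  have H := hV.lemB (t := t) (ι := Fin n → Bool) (c := fun ε => gtL (m+j) (gtRad h ε))
    (b := fun ε => (((1/4:ℝ) ^ j : ℝ) : ℂ) • gtL m (gtRad k ε)) ht ht1 hδ (fun ε => gtL_sa _ _)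
    (fun ε => gtL_norm _ _)
    (fun ε => IsSelfAdjoint.smul (r := (((1/4:ℝ) ^ j : ℝ) : ℂ)) (Complex.conj_ofReal _) (gtL_sa _ _)) (fun ε => by
      rw [norm_smul, Complex.norm_real, Real.norm_of_nonneg hw0.le]
      exact mul_le_one₀ hw1 (norm_nonneg _) (gtL_norm _ _))
  have H1 := gt_E_abs (m+j) hh h1
  have H2 := gt_E_sq m hk k1
  simp only [smul_mul_smul_comm, ← Finset.smul_sum, norm_smul, map_smul, smul_eq_mul, Complex.im_ofReal_mul, abs_mul,
    abs_of_pos hw0, ← Finset.mul_sum] at H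
  have h3 : ‖(((1/4:ℝ) ^ j : ℝ) : ℂ) * (((1/4:ℝ) ^ j : ℝ) : ℂ)‖ = (1/16) ^ j := by
    rw [norm_mul, Complex.norm_real, Real.norm_of_nonneg hw0.le, ← mul_pow]; norm_num
  rw [h3] at H
  have h4 : (1/16:ℝ) ^ j * ‖∑ ε, gtL m (gtRad k ε) * gtL m (gtRad k ε)‖ ≤ (1/16) ^ j * (2 ^ n * (25 * (1/16) ^ m)) :=
    mul_le_mul_of_nonneg_left H2 (by positivity)
  have hcard : (Fintype.card (Fin n → Bool) : ℝ) = 2 ^ n := by simp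
  rw [hcard] at H
  refine le_of_mul_le_mul_left ?_ hw0
  calc _ ≤ _ := H
    _ ≤ 2 * (2 ^ n * (25 * (1/16) ^ (m+j))) + 2 * ((1/16) ^ j * (2 ^ n * (25 * (1/16) ^ m))) + 2 ^ n * (3 * t ^ 2) := by
      linarith
    _ = _ := by
      have e1 : ((1:ℝ)/4) ^ j * 4 ^ j = 1 := by rw [← mul_pow]; norm_num
      have e2 : (1/4:ℝ) ^ j * (1/4) ^ (m+j+m) = (1/16) ^ (m+j) := by
        rw [show (1/16:ℝ) = (1/4)^2 by norm_num, ← pow_mul, ← pow_add]; congr 1; ring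
      rw [show (1/4:ℝ) ^ j * (2 ^ n * (100 * (1 / 4) ^ (m + j + m) + 4 ^ j * (3 * t ^ 2))) =
        2 ^ n * (100 * ((1/4:ℝ) ^ j * (1/4) ^ (m+j+m)) + ((1/4) ^ j * 4 ^ j) * (3 * t ^ 2)) by ring, e1, e2,
        pow_add]
      ring

theorem GTNear.im_bound {V : C →ₗ[ℂ] D →ₗ[ℂ] ℂ} {M δ t : ℝ} (hV : GTNear V M δ)
    (ht : 0 < t) (ht1 : t ≤ 1) (hδ : δ ≤ t ^ 4)
    {n : ℕ} {h : Fin n → C} (hh : ∀ s, IsSelfAdjoint (h s)) (h1 : ∑ s, h s * h s ≤ 1)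
    {k : Fin n → D} (hk : ∀ s, IsSelfAdjoint (k s)) (k1 : ∑ s, k s * k s ≤ 1)
    (hhn : ∀ s, ‖h s‖ ≤ 1) (hkn : ∀ s, ‖k s‖ ≤ 1) :
    |(∑ s, V (h s) (k s)).im| ≤ 400 + (∑ l ∈ Finset.range (n+1), ∑ m ∈ Finset.range (n+1),
      2 ^ l * 2 ^ m * (4 ^ n * 3)) * t ^ 2 := by
  have pairs : ∀ l ∈ Finset.range (n+1), ∀ m ∈ Finset.range (n+1),
      ∑ ε, |(V (gtL l (gtRad h ε)) (gtL m (gtRad k ε))).im| ≤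
      2 ^ n * (100 * (1/4) ^ (l+m) + 4 ^ n * (3 * t ^ 2)) := by
    intro l hl m hm
    rw [Finset.mem_range] at hl hm
    have h4 : ∀ j : ℕ, j ≤ n → (4:ℝ) ^ j * (3 * t ^ 2) ≤ 4 ^ n * (3 * t ^ 2) := fun j hj =>
      mul_le_mul_of_nonneg_right (pow_le_pow_right₀ (by norm_num) hj) (by positivity)
    rcases le_total m l with hml | hml
    · obtain ⟨j, rfl⟩ := Nat.exists_eq_add_of_le hml
      refine (hV.pair ht ht1 hδ hh h1 hk k1 m j).trans ?_
      have := h4 j (by omega)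
      gcongr
    · obtain ⟨j, rfl⟩ := Nat.exists_eq_add_of_le hml
      have := hV.flip.pair ht ht1 hδ hk k1 hh h1 l j
      simp only [LinearMap.flip_apply] at this
      refine this.trans ?_
      have := h4 j (by omega)
      rw [add_comm l (l+j)]
      gcongr
  have hnn : ∀ n : ℕ, (n : ℝ) ≤ 2 ^ n := fun n => by exact_mod_cast Nat.lt_two_pow_self.le
  have exph : ∀ ε, gtRad h ε = ∑ l ∈ Finset.range (n+1), ((2 ^ l : ℝ) : ℂ) • gtL l (gtRad h ε) := fun ε => by
    conv_lhs => rw [← gtL_sum (L := n) (gtRad_sa hh ε) ((gtRad_norm hhn ε).trans (hnn n))]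
    rfl
  have expk : ∀ ε, gtRad k ε = ∑ l ∈ Finset.range (n+1), ((2 ^ l : ℝ) : ℂ) • gtL l (gtRad k ε) := fun ε => by
    conv_lhs => rw [← gtL_sum (L := n) (gtRad_sa hk ε) ((gtRad_norm hkn ε).trans (hnn n))]
    rfl
  have hexp : ∀ ε, (V (gtRad h ε) (gtRad k ε)).im = ∑ l ∈ Finset.range (n+1), ∑ m ∈ Finset.range (n+1),
      (2:ℝ) ^ l * 2 ^ m * (V (gtL l (gtRad h ε)) (gtL m (gtRad k ε))).im := by
    intro ε
    conv_lhs => rw [exph ε, expk ε]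
    simp only [map_sum, LinearMap.sum_apply, map_smul, LinearMap.smul_apply, smul_eq_mul, Complex.im_sum,
      Finset.mul_sum]
    rw [Finset.sum_comm]
    refine Finset.sum_congr rfl fun l _ => Finset.sum_congr rfl fun m _ => ?_
    rw [← mul_assoc, ← Complex.ofReal_mul, Complex.im_ofReal_mul, mul_comm (2 ^ m)]
  have hB := congrArg Complex.im (gt_bilin V h k)
  rw [Complex.im_sum] at hB
  have h2n : (0:ℝ) < 2 ^ n := by positivity
  refine le_of_mul_le_mul_left ?_ h2n
  have h5 : (2:ℝ) ^ n * |(∑ s, V (h s) (k s)).im| = |∑ ε, (V (gtRad h ε) (gtRad k ε)).im| := by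
    rw [hB, ← Nat.cast_smul_eq_nsmul ℝ, Complex.smul_im, smul_eq_mul, abs_mul]; simp
  rw [h5]
  calc |∑ ε, (V (gtRad h ε) (gtRad k ε)).im|
      ≤ ∑ ε, ∑ l ∈ Finset.range (n+1), ∑ m ∈ Finset.range (n+1),
      (2:ℝ) ^ l * 2 ^ m * |(V (gtL l (gtRad h ε)) (gtL m (gtRad k ε))).im| := by
        refine (Finset.abs_sum_le_sum_abs _ _).trans (Finset.sum_le_sum fun ε _ => ?_)
        rw [hexp ε]
        refine (Finset.abs_sum_le_sum_abs _ _).trans (Finset.sum_le_sum fun l _ => ?_)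
        refine (Finset.abs_sum_le_sum_abs _ _).trans (Finset.sum_le_sum fun m _ => ?_)
        rw [abs_mul, abs_of_pos (by positivity)]
    _ = ∑ l ∈ Finset.range (n+1), ∑ m ∈ Finset.range (n+1),
      (2:ℝ) ^ l * 2 ^ m * ∑ ε, |(V (gtL l (gtRad h ε)) (gtL m (gtRad k ε))).im| := by
        rw [Finset.sum_comm]
        refine Finset.sum_congr rfl fun l _ => ?_
        rw [Finset.sum_comm]
        simp only [Finset.mul_sum]
    _ ≤ ∑ l ∈ Finset.range (n+1), ∑ m ∈ Finset.range (n+1),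
      (2:ℝ) ^ l * 2 ^ m * (2 ^ n * (100 * (1/4) ^ (l+m) + 4 ^ n * (3 * t ^ 2))) := by
        refine Finset.sum_le_sum fun l hl => Finset.sum_le_sum fun m hm => ?_
        exact mul_le_mul_of_nonneg_left (pairs l hl m hm) (by positivity)
    _ = 2 ^ n * (100 * ((∑ l ∈ Finset.range (n+1), (1/2:ℝ) ^ l) * (∑ m ∈ Finset.range (n+1), (1/2:ℝ) ^ m)) +
        (∑ l ∈ Finset.range (n+1), ∑ m ∈ Finset.range (n+1),
      2 ^ l * 2 ^ m * (4 ^ n * 3)) * t ^ 2) := by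
        rw [Finset.sum_mul_sum]
        simp only [Finset.sum_mul, Finset.mul_sum, ← Finset.sum_add_distrib]
        refine Finset.sum_congr rfl fun l hl => Finset.sum_congr rfl fun m hm => ?_
        have e : ∀ l : ℕ, (2:ℝ) ^ l * (1/4) ^ l = (1/2) ^ l := fun l => by rw [← mul_pow]; norm_num
        rw [← e l, ← e m, pow_add]; ring
    _ ≤ _ := by
        have hgeo : ∑ l ∈ Finset.range (n+1), (1/2:ℝ) ^ l ≤ 2 := by
          have := sum_geometric_two_le (n+1)
          simpa using this
        have hgeo0 : 0 ≤ ∑ l ∈ Finset.range (n+1), (1/2:ℝ) ^ l := Finset.sum_nonneg fun _ _ => by positivity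
        have : (∑ l ∈ Finset.range (n+1), (1/2:ℝ) ^ l) * (∑ m ∈ Finset.range (n+1), (1/2:ℝ) ^ m) ≤ 4 := by nlinarith
        gcongr
        linarith

end NCGT

end SecP3

section SecP4
section NCGT
variable {C : Type*} [CStarAlgebra C] [PartialOrder C] [StarOrderedRing C]
variable {D : Type*} [CStarAlgebra D] [PartialOrder D] [StarOrderedRing D]

theorem gt_norm_le_of_sum {n : ℕ} {h : Fin n → C} (hh : ∀ s, IsSelfAdjoint (h s))
    (h1 : ∑ s, h s * h s ≤ 1) (s : Fin n) : ‖h s‖ ≤ 1 := by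
  have h2 : h s * h s ≤ 1 := (Finset.single_le_sum (f := fun s => h s * h s)
    (fun i _ => gt_sq_nonneg (hh i)) (Finset.mem_univ s)).trans h1
  have h3 : ‖h s * h s‖ ≤ 1 :=
    (CStarAlgebra.norm_le_norm_of_nonneg_of_le (gt_sq_nonneg (hh s)) h2).trans (gt_norm_one_le C)
  have h4 : ‖h s * h s‖ = ‖h s‖ * ‖h s‖ := by
    have := CStarRing.norm_star_mul_self (x := h s)
    rwa [(hh s).star_eq] at this
  nlinarith [norm_nonneg (h s)]

theorem GTNear.sa_bound (n : ℕ) : ∃ K : ℝ, 0 ≤ K ∧ ∀ {V : C →ₗ[ℂ] D →ₗ[ℂ] ℂ} {M δ t : ℝ} (hV : GTNear V M δ)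
    (ht : 0 < t) (ht1 : t ≤ 1) (hδ : δ ≤ t ^ 4)
    {h : Fin n → C} (hh : ∀ s, IsSelfAdjoint (h s)) (h1 : ∑ s, h s * h s ≤ 1)
    {k : Fin n → D} (hk : ∀ s, IsSelfAdjoint (k s)) (k1 : ∑ s, k s * k s ≤ 1),
    ‖∑ s, V (h s) (k s)‖ ≤ 402 + K * t ^ 2 := by
  refine ⟨(∑ l ∈ Finset.range (n+1), ∑ m ∈ Finset.range (n+1), 2 ^ l * 2 ^ m * (4 ^ n * 3)) + n * 2,
    by positivity, ?_⟩
  intro V M δ t hV ht ht1 hδ h hh h1 k hk k1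
  have hn := gt_norm_le_of_sum hh h1
  have kn := gt_norm_le_of_sum hk k1
  have e1 := hV.im_bound ht ht1 hδ hh h1 hk k1 hn kn
  have e2 := hV.lemA (R := 1) ht (by linarith) hδ hh hn hk kn
  have e3 : |(∑ s, V (h s) (k s)).re| ≤ ∑ s, |(V (h s) (k s)).re| := by
    rw [Complex.re_sum]; exact Finset.abs_sum_le_sum_abs _ _
  have e4 : ‖∑ s, h s * h s‖ ≤ 1 :=
    (CStarAlgebra.norm_le_norm_of_nonneg_of_le (Finset.sum_nonneg fun s _ => gt_sq_nonneg (hh s)) h1).trans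
      (gt_norm_one_le C)
  have e5 : ‖∑ s, k s * k s‖ ≤ 1 :=
    (CStarAlgebra.norm_le_norm_of_nonneg_of_le (Finset.sum_nonneg fun s _ => gt_sq_nonneg (hk s)) k1).trans
      (gt_norm_one_le D)
  have e6 := Complex.norm_le_abs_re_add_abs_im (∑ s, V (h s) (k s))
  simp only [Fintype.card_fin] at e2
  nlinarith

theorem gt_parts {n : ℕ} {x : Fin n → C} (h1 : ∑ s, star (x s) * x s ≤ 1) (h2 : ∑ s, x s * star (x s) ≤ 1)
    {u : C} (hu : u ∈ unitary C) :
    ∃ h k : Fin n → C, (∀ s, IsSelfAdjoint (h s)) ∧ (∀ s, IsSelfAdjoint (k s)) ∧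
      (∑ s, h s * h s ≤ 1) ∧ (∑ s, k s * k s ≤ 1) ∧ ∀ s, x s = u * (h s + Complex.I • k s) := by
  rw [Unitary.mem_iff] at hu
  set z : Fin n → C := fun s => star u * x s with hz
  have hzz : ∀ s, star (z s) * z s = star (x s) * x s := fun s => by
    simp only [hz, star_mul, star_star]
    rw [mul_assoc, ← mul_assoc u, hu.2, one_mul]
  have hzz' : ∑ s, z s * star (z s) ≤ 1 := by
    have e : ∑ s, z s * star (z s) = star u * (∑ s, x s * star (x s)) * u := by
      simp only [hz, star_mul, star_star, Finset.mul_sum, Finset.sum_mul, mul_assoc]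
    rw [e]
    have := star_left_conjugate_le_conjugate h2 u
    simpa [hu.1] using this
  have hsum : ∀ s, ((realPart (z s) : C) * realPart (z s)) + ((imaginaryPart (z s) : C) * imaginaryPart (z s))
      = (1/2:ℝ) • (star (z s) * z s + z s * star (z s)) := by
    intro s
    rw [star_mul_self_add_self_mul_star, ← Nat.cast_smul_eq_nsmul ℝ, smul_smul]
    norm_num [sq]
  have hle : ∑ s, (((realPart (z s) : C) * realPart (z s)) + ((imaginaryPart (z s) : C) * imaginaryPart (z s))) ≤ 1 := by
    simp only [hsum, ← Finset.smul_sum, Finset.sum_add_distrib, hzz]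
    calc _ ≤ (1/2:ℝ) • ((1:C) + 1) := by
          have : (0:ℝ) ≤ 1/2 := by norm_num
          gcongr
      _ = 1 := by rw [smul_add, ← add_smul]; norm_num
  refine ⟨fun s => realPart (z s), fun s => imaginaryPart (z s), fun s => (realPart (z s)).2,
    fun s => (imaginaryPart (z s)).2, ?_, ?_, ?_⟩
  · refine le_trans (Finset.sum_le_sum fun s _ => ?_) hle
    exact le_add_of_nonneg_right (gt_sq_nonneg (imaginaryPart (z s)).2)
  · refine le_trans (Finset.sum_le_sum fun s _ => ?_) hle
    exact le_add_of_nonneg_left (gt_sq_nonneg (realPart (z s)).2)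
  · intro s
    simp only []
    rw [realPart_add_I_smul_imaginaryPart, hz, ← mul_assoc, hu.2, one_mul]

theorem gt_unital_aux (V : C →ₗ[ℂ] D →ₗ[ℂ] ℂ) (hV : ∀ x y, ‖V x y‖ ≤ ‖x‖ * ‖y‖) {n : ℕ}
    {x : Fin n → C} {y : Fin n → D}
    (h1 : ∑ s, star (x s) * x s ≤ 1) (h2 : ∑ s, x s * star (x s) ≤ 1)
    (k1 : ∑ s, star (y s) * y s ≤ 1) (k2 : ∑ s, y s * star (y s) ≤ 1) :
    ‖∑ s, V (x s) (y s)‖ ≤ 1609 := by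
  obtain ⟨K, hK0, hK⟩ := GTNear.sa_bound (C := C) (D := D) n
  obtain ⟨t, ht, ht1, htK⟩ : ∃ t : ℝ, 0 < t ∧ t ≤ 1 ∧ 4 * K * t ^ 2 ≤ 1 := by
    refine ⟨1 / (4 * K + 1), by positivity, by rw [div_le_one (by positivity)]; linarith, ?_⟩
    rw [div_pow, ← mul_div_assoc, div_le_one (by positivity)]
    nlinarith
  set S : Set ℝ := {r | ∃ p ∈ unitary C, ∃ q ∈ unitary D, r = (V p q).re} with hS
  have hun : ∀ {C : Type _} [CStarAlgebra C] {p : C}, p ∈ unitary C → ‖p‖ ≤ 1 := by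
    intro C _ p hp
    have h : ‖star p * p‖ = ‖p‖ * ‖p‖ := CStarRing.norm_star_mul_self
    rw [(Unitary.mem_iff.1 hp).1] at h
    have := gt_norm_one_le C
    nlinarith [norm_nonneg p]
  have hun' : ∀ {p : D}, p ∈ unitary D → ‖p‖ ≤ 1 := by
    intro p hp
    have h : ‖star p * p‖ = ‖p‖ * ‖p‖ := CStarRing.norm_star_mul_self
    rw [(Unitary.mem_iff.1 hp).1] at h
    have := gt_norm_one_le D
    nlinarith [norm_nonneg p]
  have hSb : BddAbove S := by
    refine ⟨1, ?_⟩
    rintro r ⟨p, hp, q, hq, rfl⟩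
    refine ((Complex.re_le_norm _).trans (hV p q)).trans ?_
    exact mul_le_one₀ (hun hp) (norm_nonneg _) (hun' hq)
  have hSn : S.Nonempty := ⟨_, 1, one_mem _, 1, one_mem _, rfl⟩
  obtain ⟨_, ⟨u, hu, v, hv, rfl⟩, huv⟩ := exists_lt_of_lt_csSup hSn
    (show sSup S - t ^ 4 < sSup S by have : 0 < t ^ 4 := by positivity
                                     linarith)
  let V' : C →ₗ[ℂ] D →ₗ[ℂ] ℂ := (V.compl₂ (LinearMap.mulLeft ℂ v)).comp (LinearMap.mulLeft ℂ u)
  have hV' : ∀ x y, V' x y = V (u * x) (v * y) := fun x y => rfl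
  have near : GTNear V' (sSup S) (t ^ 4) := by
    refine ⟨fun x y => ?_, fun p hp q hq => ?_, ?_⟩
    · rw [hV']
      refine (hV _ _).trans (mul_le_mul ((norm_mul_le _ _).trans ?_) ((norm_mul_le _ _).trans ?_)
        (norm_nonneg _) (norm_nonneg _))
      · exact mul_le_of_le_one_left (norm_nonneg _) (hun hu)
      · exact mul_le_of_le_one_left (norm_nonneg _) (hun' hv)
    · exact le_csSup hSb ⟨_, mul_mem hu hp, _, mul_mem hv hq, rfl⟩
    · rw [hV', mul_one, mul_one]; exact huv.le
  obtain ⟨h, k, hh, hk, hh1, hk1, hx⟩ := gt_parts h1 h2 hu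
  obtain ⟨h', k', hh', hk', hh1', hk1', hy⟩ := gt_parts k1 k2 hv
  have e1 := hK near ht ht1 le_rfl hh hh1 hh' hh1'
  have e2 := hK near ht ht1 le_rfl hh hh1 hk' hk1'
  have e3 := hK near ht ht1 le_rfl hk hk1 hh' hh1'
  have e4 := hK near ht ht1 le_rfl hk hk1 hk' hk1'
  have hexp : ∑ s, V (x s) (y s) = ∑ s, V' (h s) (h' s) + Complex.I * ∑ s, V' (h s) (k' s) +
      (Complex.I * ∑ s, V' (k s) (h' s) + Complex.I * (Complex.I * ∑ s, V' (k s) (k' s))) := by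
    simp only [Finset.mul_sum, ← Finset.sum_add_distrib]
    refine Finset.sum_congr rfl fun s _ => ?_
    rw [hx s, hy s, ← hV']
    simp only [map_add, map_smul, LinearMap.add_apply, LinearMap.smul_apply, smul_eq_mul, mul_add]
    ring
  rw [hexp]
  refine (norm_add_le _ _).trans ?_
  have g1 := norm_add_le (∑ s, V' (h s) (h' s)) (Complex.I * ∑ s, V' (h s) (k' s))
  have g2 := norm_add_le (Complex.I * ∑ s, V' (k s) (h' s)) (Complex.I * (Complex.I * ∑ s, V' (k s) (k' s)))
  simp only [norm_mul, Complex.norm_I, one_mul] at g1 g2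
  linarith
end NCGT

theorem gt_unital {C D : Type*} [CStarAlgebra C] [CStarAlgebra D]
    (V : C →ₗ[ℂ] D →ₗ[ℂ] ℂ) (hV : ∀ x y, ‖V x y‖ ≤ ‖x‖ * ‖y‖) {ι : Type*} [Fintype ι]
    {x : ι → C} {y : ι → D}
    (h1 : ‖∑ s, star (x s) * x s‖ ≤ 1) (h2 : ‖∑ s, x s * star (x s)‖ ≤ 1)
    (k1 : ‖∑ s, star (y s) * y s‖ ≤ 1) (k2 : ‖∑ s, y s * star (y s)‖ ≤ 1) :
    ‖∑ s, V (x s) (y s)‖ ≤ 1609 := by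
  letI := CStarAlgebra.spectralOrder C
  letI := CStarAlgebra.spectralOrder D
  haveI := CStarAlgebra.spectralOrderedRing C
  haveI := CStarAlgebra.spectralOrderedRing D
  let e := (Fintype.equivFin ι).symm
  have h := gt_unital_aux V hV (x := x ∘ e) (y := y ∘ e) ?_ ?_ ?_ ?_
  · rw [← e.sum_comp]; exact h
  · rw [← e.sum_comp] at h1
    exact (CStarAlgebra.norm_le_one_iff_of_nonneg _ (Finset.sum_nonneg fun s _ => star_mul_self_nonneg _)).1 h1
  · rw [← e.sum_comp] at h2
    exact (CStarAlgebra.norm_le_one_iff_of_nonneg _ (Finset.sum_nonneg fun s _ => mul_star_self_nonneg _)).1 h2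
  · rw [← e.sum_comp] at k1
    exact (CStarAlgebra.norm_le_one_iff_of_nonneg _ (Finset.sum_nonneg fun s _ => star_mul_self_nonneg _)).1 k1
  · rw [← e.sum_comp] at k2
    exact (CStarAlgebra.norm_le_one_iff_of_nonneg _ (Finset.sum_nonneg fun s _ => mul_star_self_nonneg _)).1 k2

end SecP4

section SecP5
section Nonunital
open Filter Topology

theorem apx_exists (A : Type*) [NonUnitalCStarAlgebra A] : ∃ l : Filter A, l.NeBot ∧
    (∀ᶠ e in l, IsSelfAdjoint e ∧ ‖e‖ ≤ 1) ∧
    (∀ m, Tendsto (fun e => m * e) l (𝓝 m)) ∧ (∀ m, Tendsto (fun e => e * m) l (𝓝 m)) := by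
  letI := CStarAlgebra.spectralOrder A
  haveI := CStarAlgebra.spectralOrderedRing A
  have h := CStarAlgebra.increasingApproximateUnit A
  refine ⟨CStarAlgebra.approximateUnit A, h.neBot, ?_, h.tendsto_mul_left, h.tendsto_mul_right⟩
  filter_upwards [h.eventually_isSelfAdjoint, h.eventually_norm] with e h1 h2
  exact ⟨h1, h2⟩

theorem apx_conj {A : Type*} [NonUnitalCStarAlgebra A] {l : Filter A}
    (h1 : ∀ᶠ e in l, IsSelfAdjoint e ∧ ‖e‖ ≤ 1)
    (h2 : ∀ m, Tendsto (fun e => m * e) l (𝓝 m)) (h3 : ∀ m, Tendsto (fun e => e * m) l (𝓝 m)) (x : A) :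
    Tendsto (fun e => e * x * e) l (𝓝 x) := by
  have e1 : Tendsto (fun e => e * (x * e - x)) l (𝓝 0) := by
    have h4 : Tendsto (fun e => ‖x * e - x‖) l (𝓝 0) := by
      have := ((h2 x).sub_const x).norm
      simpa using this
    refine squeeze_zero_norm' ?_ h4
    filter_upwards [h1] with e he
    exact (norm_mul_le _ _).trans (mul_le_of_le_one_left (norm_nonneg _) he.2)
  have e2 := e1.add (h3 x)
  rw [zero_add] at e2
  refine e2.congr fun e => ?_
  rw [mul_sub, mul_assoc]; abel

def gtCompress {C : Type*} [NonUnitalCStarAlgebra C] (e : C) : Unitization ℂ C →ₗ[ℂ] C :=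
  (Unitization.sndHom ℂ ℂ C).comp
    ((LinearMap.mulLeft ℂ (e : Unitization ℂ C)).comp (LinearMap.mulRight ℂ (e : Unitization ℂ C)))

theorem gtCompress_inr {C : Type*} [NonUnitalCStarAlgebra C] (e x : C) :
    gtCompress e (x : Unitization ℂ C) = e * x * e := by
  simp [gtCompress, mul_assoc]

theorem gtCompress_norm {C : Type*} [NonUnitalCStarAlgebra C] {e : C} (he : ‖e‖ ≤ 1) (x : Unitization ℂ C) :
    ‖gtCompress e x‖ ≤ ‖x‖ := by
  have h : ((gtCompress e x : C) : Unitization ℂ C) = (e : Unitization ℂ C) * (x * e) := by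
    ext
    · simp [gtCompress]
    · simp [gtCompress]
  rw [← Unitization.norm_inr (𝕜 := ℂ) (gtCompress e x), h]
  have h1 : ‖(e : Unitization ℂ C)‖ ≤ 1 := by rwa [Unitization.norm_inr]
  refine (norm_mul_le _ _).trans ?_
  have h2 := norm_mul_le x (e : Unitization ℂ C)
  have h3 : ‖x‖ * ‖(e : Unitization ℂ C)‖ ≤ ‖x‖ := mul_le_of_le_one_right (norm_nonneg _) h1
  exact (mul_le_of_le_one_left (norm_nonneg _) h1).trans (h2.trans h3)

theorem gt_nonunital {C D : Type*} [NonUnitalCStarAlgebra C] [NonUnitalCStarAlgebra D]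
    (V : C →ₗ[ℂ] D →ₗ[ℂ] ℂ) (hV : ∀ x y, ‖V x y‖ ≤ ‖x‖ * ‖y‖) {ι : Type*} [Fintype ι]
    {x : ι → C} {y : ι → D}
    (h1 : ‖∑ s, star (x s) * x s‖ ≤ 1) (h2 : ‖∑ s, x s * star (x s)‖ ≤ 1)
    (k1 : ‖∑ s, star (y s) * y s‖ ≤ 1) (k2 : ‖∑ s, y s * star (y s)‖ ≤ 1) :
    ‖∑ s, V (x s) (y s)‖ ≤ 1609 := by
  obtain ⟨l, hl, hl1, hl2, hl3⟩ := apx_exists C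
  obtain ⟨l', hl', hl1', hl2', hl3'⟩ := apx_exists D
  have cont : Continuous fun p : C × D => V p.1 p.2 := by
    let W : C →L[ℂ] D →L[ℂ] ℂ := LinearMap.mkContinuous₂ V 1 (by simpa using hV)
    have : (fun p : C × D => V p.1 p.2) = fun p : C × D => W p.1 p.2 := rfl
    rw [this]; fun_prop
  have lim : Tendsto (fun p : C × D => ‖∑ s, V (p.1 * x s * p.1) (p.2 * y s * p.2)‖) (l ×ˢ l')
      (𝓝 ‖∑ s, V (x s) (y s)‖) := by
    refine (tendsto_finset_sum _ fun s _ => ?_).norm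
    have e1 := (apx_conj hl1 hl2 hl3 (x s)).comp (tendsto_fst (f := l) (g := l'))
    have e2 := (apx_conj hl1' hl2' hl3' (y s)).comp (tendsto_snd (f := l) (g := l'))
    exact (cont.tendsto (x s, y s)).comp (e1.prodMk_nhds e2)
  refine le_of_tendsto lim ?_
  filter_upwards [hl1.prod_mk hl1'] with ⟨e, f⟩ ⟨he, hf⟩
  have key := gt_unital ((V.compl₂ (gtCompress f)).comp (gtCompress e)) (fun x y => ?_)
    (x := fun s => (x s : Unitization ℂ C)) (y := fun s => (y s : Unitization ℂ D)) ?_ ?_ ?_ ?_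
  · simpa [gtCompress_inr] using key
  · refine (hV _ _).trans (mul_le_mul (gtCompress_norm he.2 x) (gtCompress_norm hf.2 y) (norm_nonneg _) (norm_nonneg _))
  · have : ∑ s, star (x s : Unitization ℂ C) * (x s : Unitization ℂ C) = ((∑ s, star (x s) * x s : C) : Unitization ℂ C) := by
      rw [← Unitization.inrHom_apply ℂ ℂ C, map_sum]; simp
    rwa [this, Unitization.norm_inr]
  · have : ∑ s, (x s : Unitization ℂ C) * star (x s : Unitization ℂ C) = ((∑ s, x s * star (x s) : C) : Unitization ℂ C) := by
      rw [← Unitization.inrHom_apply ℂ ℂ C, map_sum]; simp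
    rwa [this, Unitization.norm_inr]
  · have : ∑ s, star (y s : Unitization ℂ D) * (y s : Unitization ℂ D) = ((∑ s, star (y s) * y s : D) : Unitization ℂ D) := by
      rw [← Unitization.inrHom_apply ℂ ℂ D, map_sum]; simp
    rwa [this, Unitization.norm_inr]
  · have : ∑ s, (y s : Unitization ℂ D) * star (y s : Unitization ℂ D) = ((∑ s, y s * star (y s) : D) : Unitization ℂ D) := by
      rw [← Unitization.inrHom_apply ℂ ℂ D, map_sum]; simp
    rwa [this, Unitization.norm_inr]

end Nonunital

end SecP5

section SecP6
section Lift

theorem lift_unital {C : Type*} [CStarAlgebra C] [PartialOrder C] [StarOrderedRing C] {ι : Type*} [Fintype ι]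
    (a : ι → C) (F R : C) (hF : IsSelfAdjoint F) (hF1 : F * F ≤ 1) (hR : ∑ j, a j * star (a j) ≤ R)
    {c : ℝ} (hc : ‖F * R * F‖ ≤ c) :
    ‖∑ j, (F * a j * F) * star (F * a j * F)‖ ≤ c := by
  refine le_trans (CStarAlgebra.norm_le_norm_of_nonneg_of_le
    (Finset.sum_nonneg fun j _ => mul_star_self_nonneg _) ?_) hc
  have h1 : ∑ j, (F * a j * F) * star (F * a j * F) ≤ ∑ j, F * (a j * star (a j)) * F := by
    refine Finset.sum_le_sum fun j _ => ?_
    have h2 := star_right_conjugate_le_conjugate hF1 (F * a j)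
    rw [star_mul, hF.star_eq] at h2
    rw [star_mul, star_mul, hF.star_eq]
    simpa [mul_assoc] using h2
  refine h1.trans ?_
  rw [← Finset.sum_mul, ← Finset.mul_sum]
  have := star_right_conjugate_le_conjugate hR F
  rwa [hF.star_eq] at this

def liftG (s : ℝ) : ℝ := 1 - √(2 / max 2 s)

theorem liftG_cont : Continuous liftG := by
  unfold liftG
  refine continuous_const.sub (Real.continuous_sqrt.comp ?_)
  refine continuous_const.div (continuous_const.max continuous_id) fun s => ?_
  have : (2:ℝ) ≤ max 2 s := le_max_left _ _
  positivity

theorem liftG_zero {s : ℝ} (h : s ≤ 2) : liftG s = 0 := by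
  unfold liftG; rw [max_eq_left h]; simp

theorem liftG_nonneg (s : ℝ) : 0 ≤ liftG s := by
  unfold liftG
  have : √(2 / max 2 s) ≤ 1 := by
    rw [Real.sqrt_le_one]
    rw [div_le_one (by positivity)]; exact le_max_left _ _
  linarith

theorem liftG_le (s : ℝ) : liftG s ≤ 1 := by
  unfold liftG; have := Real.sqrt_nonneg (2 / max 2 s); linarith

theorem liftG_mul {s : ℝ} (hs : 0 ≤ s) : s * (1 - liftG s) * (1 - liftG s) ≤ 2 := by
  have h : (1 - liftG s) * (1 - liftG s) = 2 / max 2 s := by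
    unfold liftG; ring_nf; rw [Real.sq_sqrt]; positivity
  rw [mul_assoc, h, mul_div_assoc', div_le_iff₀ (by positivity)]
  nlinarith [le_max_right 2 s]

theorem lift_cfc {A : Type*} [NonUnitalCStarAlgebra A] [PartialOrder A] [StarOrderedRing A] (r : A) (hr0 : 0 ≤ r) :
    (0 : A) ≤ cfcₙ liftG r + cfcₙ liftG r - cfcₙ liftG r * cfcₙ liftG r ∧
    ‖r - cfcₙ liftG r * r - r * cfcₙ liftG r + cfcₙ liftG r * r * cfcₙ liftG r‖ ≤ 2 := by
  have hG0 : liftG 0 = 0 := liftG_zero (by norm_num)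
  have hGc := liftG_cont
  have hrs : IsSelfAdjoint r := IsSelfAdjoint.of_nonneg hr0
  have c1 : ContinuousOn liftG (quasispectrum ℝ r) := hGc.continuousOn
  have c0 : ContinuousOn (fun s : ℝ => s) (quasispectrum ℝ r) := continuous_id.continuousOn
  constructor
  · have : cfcₙ liftG r + cfcₙ liftG r - cfcₙ liftG r * cfcₙ liftG r = cfcₙ (fun s => liftG s + liftG s - liftG s * liftG s) r := by
      rw [cfcₙ_sub (fun s => liftG s + liftG s) (fun s => liftG s * liftG s) r (c1.add c1) (by simp [hG0]) (c1.mul c1) (by simp [hG0]),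
        cfcₙ_add liftG liftG r c1 hG0 c1 hG0, cfcₙ_mul liftG liftG r c1 hG0 c1 hG0]
    rw [this]
    refine cfcₙ_nonneg fun s _ => ?_
    nlinarith [liftG_nonneg s, liftG_le s]
  · have e1 : cfcₙ (fun s => liftG s * s) r = cfcₙ liftG r * r := by
      rw [cfcₙ_mul liftG (fun s => s) r c1 hG0 c0 rfl, cfcₙ_id' ℝ r]
    have e2 : cfcₙ (fun s => s * liftG s) r = r * cfcₙ liftG r := by
      rw [cfcₙ_mul (fun s => s) liftG r c0 rfl c1 hG0, cfcₙ_id' ℝ r]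
    have e3 : cfcₙ (fun s => liftG s * s * liftG s) r = cfcₙ liftG r * r * cfcₙ liftG r := by
      rw [cfcₙ_mul (fun s => liftG s * s) liftG r (c1.mul c0) (by simp) c1 hG0, e1]
    have e4 : r - cfcₙ liftG r * r - r * cfcₙ liftG r + cfcₙ liftG r * r * cfcₙ liftG r = cfcₙ (fun s => s * (1 - liftG s) * (1 - liftG s)) r := by
      have h7 : (fun s => s * (1 - liftG s) * (1 - liftG s)) = fun s => s - liftG s * s - s * liftG s + liftG s * s * liftG s := by
        ext s; ring
      rw [h7, cfcₙ_add (fun s => s - liftG s * s - s * liftG s) (fun s => liftG s * s * liftG s) r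
        ((c0.sub (c1.mul c0)).sub (c0.mul c1)) (by simp) ((c1.mul c0).mul c1) (by simp),
        cfcₙ_sub (fun s => s - liftG s * s) (fun s => s * liftG s) r (c0.sub (c1.mul c0)) (by simp) (c0.mul c1) (by simp),
        cfcₙ_sub (fun s => s) (fun s => liftG s * s) r c0 rfl (c1.mul c0) (by simp), e1, e2, e3, cfcₙ_id' ℝ r]
    rw [e4]
    refine norm_cfcₙ_le fun s hs => ?_
    have hs0 : 0 ≤ s := quasispectrum_nonneg_of_nonneg r hr0 s hs
    have h8 := liftG_mul hs0
    rw [Real.norm_eq_abs, abs_of_nonneg]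
    · exact h8
    · rw [mul_assoc]; exact mul_nonneg hs0 (mul_self_nonneg _)

theorem lift_fam {A : Type*} [NonUnitalCStarAlgebra A] {D : Type*} [NonUnitalCStarAlgebra D]
    (π : A →⋆ₙₐ[ℂ] D) {ι : Type*} [Fintype ι] (a : ι → A) (t : ι → ℝ) (ht : ∀ j, 0 ≤ t j)
    (h1 : ‖∑ j, π (a j) * star (π (a j))‖ ≤ 1)
    (h2 : ‖∑ j, (t j : ℂ) • (star (π (a j)) * π (a j))‖ ≤ 1) :
    ∃ a' : ι → A, (∀ j, π (a' j) = π (a j)) ∧ ‖∑ j, a' j * star (a' j)‖ ≤ 2 ∧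
      ‖∑ j, (t j : ℂ) • (star (a' j) * a' j)‖ ≤ 2 := by
  letI := CStarAlgebra.spectralOrder A
  haveI := CStarAlgebra.spectralOrderedRing A
  letI := CStarAlgebra.spectralOrder (Unitization ℂ A)
  haveI := CStarAlgebra.spectralOrderedRing (Unitization ℂ A)
  set b : ι → A := fun j => ((√(t j) : ℝ) : ℂ) • star (a j) with hb
  have hbb : ∀ x : A, ∀ j, (((√(t j) : ℝ) : ℂ) • star x) * star (((√(t j) : ℝ) : ℂ) • star x) = (t j : ℂ) • (star x * x) := by
    intro x j
    rw [star_smul, star_star, smul_mul_smul_comm]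
    congr 1
    rw [RCLike.star_def, Complex.conj_ofReal, ← Complex.ofReal_mul, Real.mul_self_sqrt (ht j)]
  set r : A := ∑ j, a j * star (a j) + ∑ j, b j * star (b j) with hr
  have hr0 : 0 ≤ r := add_nonneg (Finset.sum_nonneg fun j _ => mul_star_self_nonneg _)
    (Finset.sum_nonneg fun j _ => mul_star_self_nonneg _)
  have hrs : IsSelfAdjoint r := IsSelfAdjoint.of_nonneg hr0
  set g : A := cfcₙ liftG r with hg
  have hgs : IsSelfAdjoint g := cfcₙ_predicate _ _
  have hG0 : liftG 0 = 0 := liftG_zero (by norm_num)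
  have hGc := liftG_cont
  have hπr : ‖π r‖ ≤ 2 := by
    have : π r = ∑ j, π (a j) * star (π (a j)) + ∑ j, (t j : ℂ) • (star (π (a j)) * π (a j)) := by
      simp only [hr, hb, hbb]
      simp only [map_add, map_sum, map_smul, map_mul, map_star]
    rw [this]
    exact (norm_add_le _ _).trans (by linarith)
  have hπg : π g = 0 := by
    have hπs : IsSelfAdjoint (π r) := hrs.map π
    have h3 : π g = cfcₙ liftG (π r) :=
      NonUnitalStarAlgHom.map_cfcₙ (S := ℂ) π liftG r (hGc.continuousOn) hG0
        (AddMonoidHomClass.continuous_of_bound π 1 (by simpa only [one_mul] using NonUnitalStarAlgHom.norm_apply_le π)) hrs hπs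
    rw [h3, cfcₙ_congr (g := fun _ => (0:ℝ)), cfcₙ_const_zero]
    intro s hs
    have : ‖s‖ ≤ ‖π r‖ :=
      NonUnitalIsometricContinuousFunctionalCalculus.norm_quasispectrum_le (𝕜 := ℝ) (π r) hs hπs
    exact liftG_zero ((le_abs_self s).trans (this.trans hπr))
  have key : ∀ x y : A, π (x - g * x - x * g + g * x * g) = π x := by
    intro x _; simp [map_add, map_sub, map_mul, hπg]
  set F : Unitization ℂ A := 1 - (g : Unitization ℂ A) with hF
  have hFs : IsSelfAdjoint F := by
    refine (IsSelfAdjoint.one _).sub ?_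
    exact hgs.map (Unitization.inrNonUnitalStarAlgHom ℂ A)
  have hFx : ∀ x : A, ((x - g * x - x * g + g * x * g : A) : Unitization ℂ A) = F * (x : Unitization ℂ A) * F := by
    intro x
    simp only [Unitization.inr_add, Unitization.inr_sub, Unitization.inr_mul, hF]
    noncomm_ring
  have hF1 : F * F ≤ 1 := by
    have h4 : (0 : A) ≤ g + g - g * g := (lift_cfc r hr0).1
    have h5 : (0 : Unitization ℂ A) ≤ ((g + g - g * g : A) : Unitization ℂ A) := by
      have := map_nonneg (Unitization.inrNonUnitalStarAlgHom ℂ A) h4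
      simpa using this
    have h6 : (1 : Unitization ℂ A) - F * F = ((g + g - g * g : A) : Unitization ℂ A) := by
      simp only [Unitization.inr_add, Unitization.inr_sub, Unitization.inr_mul, hF]
      noncomm_ring
    rw [← sub_nonneg, h6]; exact h5
  have hFR : ‖F * (r : Unitization ℂ A) * F‖ ≤ 2 := by
    rw [← hFx, Unitization.norm_inr]
    exact (lift_cfc r hr0).2
  have hmain : ∀ c : ι → A, ∑ j, c j * star (c j) ≤ r →
      ‖∑ j, (c j - g * c j - c j * g + g * c j * g) * star (c j - g * c j - c j * g + g * c j * g)‖ ≤ 2 := by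
    intro c hc
    have hc' : ∑ j, (c j : Unitization ℂ A) * star (c j : Unitization ℂ A) ≤ (r : Unitization ℂ A) := by
      have h9 := map_nonneg (Unitization.inrNonUnitalStarAlgHom ℂ A) (sub_nonneg.2 hc)
      rw [← sub_nonneg]
      simpa [map_sub, map_sum] using h9
    have h10 := lift_unital (fun j => (c j : Unitization ℂ A)) F r hFs hF1 hc' hFR
    simp only [← hFx] at h10
    rw [← Unitization.norm_inr (𝕜 := ℂ)]
    have h11 : ((∑ j, (c j - g * c j - c j * g + g * c j * g) * star (c j - g * c j - c j * g + g * c j * g) : A) : Unitization ℂ A)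
      = ∑ j, ((c j - g * c j - c j * g + g * c j * g : A) : Unitization ℂ A) * star ((c j - g * c j - c j * g + g * c j * g : A) : Unitization ℂ A) := by
      refine (map_sum (Unitization.inrNonUnitalStarAlgHom ℂ A) (fun j => (c j - g * c j - c j * g + g * c j * g) * star (c j - g * c j - c j * g + g * c j * g)) Finset.univ).trans ?_
      refine Finset.sum_congr rfl fun j _ => ?_
      rw [map_mul, map_star]; rfl
    rw [h11]; exact h10
  refine ⟨fun j => a j - g * a j - a j * g + g * a j * g, fun j => key _ 0, hmain a ?_, ?_⟩
  · exact le_add_of_nonneg_right (Finset.sum_nonneg fun j _ => mul_star_self_nonneg _)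
  · have h12 := hmain b (le_add_of_nonneg_left (Finset.sum_nonneg fun j _ => mul_star_self_nonneg _))
    have h13 : ∀ j, b j - g * b j - b j * g + g * b j * g = ((√(t j) : ℝ) : ℂ) • star (a j - g * a j - a j * g + g * a j * g) := by
      intro j
      simp only [hb, star_add, star_sub, star_mul, hgs.star_eq, smul_add, smul_sub, mul_smul_comm, smul_mul_assoc, mul_assoc]
      abel
    simp only [h13, hbb] at h12
    exact h12

end Lift

end SecP6

section SecP7
section UniqueNorm
open Filter Topology

variable {C : Type*} [NonUnitalCStarAlgebra C] {M : Type*} [NonUnitalRing M] [StarRing M] [Module ℂ M]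
  [IsScalarTower ℂ M M] [SMulCommClass ℂ M M]

theorem IsCStarNorm.zero {N : M → ℝ} (hN : IsCStarNorm N) : N 0 = 0 := by
  have := hN.smul_eq 0 0; simpa using this

theorem IsCStarNorm.neg {N : M → ℝ} (hN : IsCStarNorm N) (x : M) : N (-x) = N x := by
  have := hN.smul_eq (-1) x; simpa using this

theorem IsCStarNorm.nonneg {N : M → ℝ} (hN : IsCStarNorm N) (x : M) : 0 ≤ N x := by
  have := hN.add_le x (-x); rw [add_neg_cancel, hN.zero, hN.neg] at this; linarith

theorem IsCStarNorm.star {N : M → ℝ} (hN : IsCStarNorm N) (x : M) : N (star x) = N x := by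
  have key : ∀ y, N y ≤ N (Star.star y) := by
    intro y
    rcases (hN.nonneg y).eq_or_lt with h | h
    · rw [← h]; exact hN.nonneg _
    · have h1 := hN.star_mul_self y
      have h2 := hN.mul_le (Star.star y) y
      exact le_of_mul_le_mul_right (h1 ▸ h2) h
  refine le_antisymm ?_ (key x)
  simpa using key (Star.star x)

/-- norm structure given by a C⋆-norm -/
abbrev cstarNormedRing {N : M → ℝ} (hN : IsCStarNorm N) : NonUnitalNormedRing M :=
  { (inferInstance : NonUnitalRing M),
    (AddGroupNorm.toNormedAddCommGroup
      { toFun := N, map_zero' := hN.zero, add_le' := hN.add_le, neg' := hN.neg,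
        eq_zero_of_map_eq_zero' := hN.eq_zero_of } : NormedAddCommGroup M) with
    norm_mul_le := hN.mul_le }

/-- Regular representation on the dual. -/
theorem regrep_dual (Y : Type*) [NonUnitalNormedRing Y] [NormedSpace ℂ Y] [IsScalarTower ℂ Y Y] [SMulCommClass ℂ Y Y] :
    ∃ L : Y →ₙₐ[ℂ] ((Y →L[ℂ] ℂ) →L[ℂ] (Y →L[ℂ] ℂ)), ∀ x f y, L x f y = f (y * x) := by
  refine ⟨
    { toFun := fun x => (ContinuousLinearMap.compL ℂ Y Y ℂ).flip ((ContinuousLinearMap.mul ℂ Y).flip x)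
      map_smul' := fun c x => by ext f y; simp
      map_zero' := by ext f y; simp
      map_add' := fun x x' => by ext f y; simp [mul_add]
      map_mul' := fun x x' => by ext f y; simp [mul_assoc] }, fun x f y => ?_⟩
  rfl

theorem cstarnorm_le_sa_aux {Y : Type*} [NonUnitalNormedRing Y] [StarRing Y] [NormedSpace ℂ Y] [IsScalarTower ℂ Y Y] [SMulCommClass ℂ Y Y]
    {N : Y → ℝ} (hN : IsCStarNorm N) (φ : C →⋆ₙₐ[ℂ] Y) {Z : Type*} [NormedRing Z] [NormedAlgebra ℂ Z] [CompleteSpace Z]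
    (L : Y →ₙₐ[ℂ] Z) (hlow : ∀ x : Y, N x ≤ ‖L x‖) (h : C) (hh : IsSelfAdjoint h) :
    N (φ h) ≤ ‖h‖ := by
  set ψ : Unitization ℂ C →ₐ[ℂ] Z :=
    Unitization.lift (L.comp (φ : C →ₙₐ[ℂ] Y)) with hψ
  have hψh : ψ h = L (φ h) := by simp [hψ]; rfl
  have h1 : spectralRadius ℂ (ψ h) ≤ ‖h‖₊ := by
    refine (iSup_le_iSup_of_subset (AlgHom.spectrum_apply_subset ψ (h : Unitization ℂ C))).trans ?_
    rw [← Unitization.nnnorm_inr (𝕜 := ℂ) h]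
    exact spectrum.spectralRadius_le_nnnorm _
  have hsa : Star.star (φ h) = φ h := by rw [← map_star, hh.star_eq]
  -- powers
  have hpow : ∀ k : ℕ, N (φ h) ^ (2 ^ k) ≤ ‖(L (φ h)) ^ (2 ^ k)‖ := by
    have aux : ∀ k : ℕ, ∃ y : Y, Star.star y = y ∧ N y = N (φ h) ^ (2 ^ k) ∧ L y = (L (φ h)) ^ (2 ^ k) := by
      intro k
      induction k with
      | zero => exact ⟨φ h, hsa, by simp, by simp⟩
      | succ k ih =>
        obtain ⟨y, hy1, hy2, hy3⟩ := ih
        refine ⟨y * y, by rw [star_mul, hy1], ?_, ?_⟩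
        · have := hN.star_mul_self y
          rw [hy1] at this
          rw [this, hy2, ← pow_add]; congr 1; ring
        · rw [map_mul, hy3, ← pow_add]; congr 1; ring
    intro k
    obtain ⟨y, hy1, hy2, hy3⟩ := aux k
    rw [← hy2, ← hy3]; exact hlow y
  have hlim := (spectrum.pow_nnnorm_pow_one_div_tendsto_nhds_spectralRadius (L (φ h))).comp
    (tendsto_pow_atTop_atTop_of_one_lt (r := 2) (by norm_num))
  have hge : (Real.toNNReal (N (φ h)) : ENNReal) ≤ spectralRadius ℂ (L (φ h)) := by
    refine ge_of_tendsto' hlim fun k => ?_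
    simp only [Function.comp]
    have h8 : Real.toNNReal (N (φ h)) ^ (2 ^ k) ≤ ‖(L (φ h)) ^ (2 ^ k)‖₊ := by
      rw [← NNReal.coe_le_coe]; push_cast; rw [Real.coe_toNNReal _ (hN.nonneg _)]; exact hpow k
    have h9 : ((Real.toNNReal (N (φ h)) : ENNReal) ^ (2 ^ k)) ≤ (‖(L (φ h)) ^ (2 ^ k)‖₊ : ENNReal) := by
      exact_mod_cast h8
    calc (Real.toNNReal (N (φ h)) : ENNReal) = ((Real.toNNReal (N (φ h)) : ENNReal) ^ (2 ^ k)) ^ (1 / ((2 ^ k : ℕ) : ℝ)) := by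
          rw [← ENNReal.rpow_natCast, ← ENNReal.rpow_mul]; 
          rw [mul_one_div_cancel (by positivity), ENNReal.rpow_one]
      _ ≤ _ := ENNReal.rpow_le_rpow h9 (by positivity)
  rw [← hψh] at hge
  have h10 := hge.trans h1
  have h11 : Real.toNNReal (N (φ h)) ≤ ‖h‖₊ := by exact_mod_cast h10
  exact (Real.le_coe_toNNReal _).trans (by exact_mod_cast h11)

theorem regrep_low {Y : Type*} [NonUnitalNormedRing Y] [StarRing Y] [NormedSpace ℂ Y] [IsScalarTower ℂ Y Y] [SMulCommClass ℂ Y Y]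
    {N : Y → ℝ} (hNn : ∀ y, ‖y‖ = N y) (hN : IsCStarNorm N) (L : Y → ((Y →L[ℂ] ℂ) →L[ℂ] (Y →L[ℂ] ℂ))) (hL : ∀ x f y, L x f y = f (y * x)) :
    ∀ x : Y, N x ≤ ‖L x‖ := by
    intro x
    rcases (hN.nonneg x).eq_or_lt with h0 | h0
    · rw [← h0]; exact ContinuousLinearMap.opNorm_nonneg _
    obtain ⟨f, hf1, hf2⟩ := exists_dual_vector'' ℂ (Star.star x * x)
    have h3 : ‖L x f (Star.star x)‖ ≤ ‖L x‖ * N x := by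
      refine ((L x f).le_opNorm _).trans ?_
      have h4 : ‖L x f‖ ≤ ‖L x‖ := ((L x).le_opNorm f).trans (mul_le_of_le_one_right (ContinuousLinearMap.opNorm_nonneg _) hf1)
      have h5 : ‖Star.star x‖ = N x := (hNn _).trans (hN.star x)
      rw [h5]
      exact mul_le_mul_of_nonneg_right h4 h0.le
    rw [hL, hf2] at h3
    have h6 : ‖Star.star x * x‖ = N x * N x := (hNn _).trans (hN.star_mul_self x)
    rw [h6] at h3
    have h7 : N x * N x ≤ ‖L x‖ * N x := by
      refine le_trans ?_ h3
      simp [abs_of_nonneg (mul_self_nonneg (N x))]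
    exact le_of_mul_le_mul_right h7 h0
theorem cstarnorm_le_sa_aux2 {Y : Type*} [NonUnitalNormedRing Y] [StarRing Y] [NormedSpace ℂ Y] [IsScalarTower ℂ Y Y] [SMulCommClass ℂ Y Y]
    {N : Y → ℝ} (hNn : ∀ y, ‖y‖ = N y) (hN : IsCStarNorm N) (φ : C →⋆ₙₐ[ℂ] Y) (h : C) (hh : IsSelfAdjoint h) :
    N (φ h) ≤ ‖h‖ := by
  obtain ⟨L, hL⟩ := regrep_dual Y
  have := regrep_low hNn hN L hL
  exact cstarnorm_le_sa_aux (Z := (Y →L[ℂ] ℂ) →L[ℂ] (Y →L[ℂ] ℂ)) hN φ L this h hh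

theorem cstarnorm_le_sa {N : M → ℝ} (hN : IsCStarNorm N) (φ : C →⋆ₙₐ[ℂ] M) (h : C) (hh : IsSelfAdjoint h) :
    N (φ h) ≤ ‖h‖ := by
  letI := cstarNormedRing hN
  letI : NormedSpace ℂ M := { (inferInstance : Module ℂ M) with norm_smul_le := fun c x => (hN.smul_eq c x).le }
  exact cstarnorm_le_sa_aux2 (fun _ => rfl) hN φ h hh

theorem cstarnorm_le {N : M → ℝ} (hN : IsCStarNorm N) (φ : C →⋆ₙₐ[ℂ] M) (x : C) :
    N (φ x) ≤ ‖x‖ := by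
  have h1 := cstarnorm_le_sa hN φ (star x * x) (IsSelfAdjoint.star_mul_self x)
  rw [map_mul, map_star, hN.star_mul_self, CStarRing.norm_star_mul_self] at h1
  exact le_of_not_gt fun h => absurd h1 (not_le.2 (mul_self_lt_mul_self (norm_nonneg _) h))


def hatF (c : ℝ) (s : ℝ) : ℝ := max 0 (s - c)

theorem cstarnorm_ge_pos {N : M → ℝ} (hN : IsCStarNorm N) (φ : C →⋆ₙₐ[ℂ] M) (hφ : Function.Injective φ)
    [PartialOrder C] [StarOrderedRing C] (h : C) (hh : 0 ≤ h) :
    ‖h‖ ≤ N (φ h) := by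
  by_contra hlt
  push Not at hlt
  have hsa := IsSelfAdjoint.of_nonneg hh
  obtain ⟨c, hc1, hc2⟩ := exists_between hlt
  have hc0 : 0 < c := (hN.nonneg _).trans_lt hc1
  have hc' : 0 < c / 1 := by simpa
  -- f = max 0 (s-c), f(h) ≠ 0
  have fc : Continuous (hatF c) := by unfold hatF; fun_prop
  have f0 : hatF c 0 = 0 := by unfold hatF; simp [hc0.le]
  have hne : cfcₙ (hatF c) h ≠ 0 := by
    intro h0
    have h1 : ‖h‖ ≤ c := by
      have h2 : ‖cfcₙ (fun s : ℝ => s) h‖ ≤ c := by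
        refine norm_cfcₙ_le fun s hs => ?_
        have hs0 : 0 ≤ s := quasispectrum_nonneg_of_nonneg h hh s hs
        have h3 : ‖hatF c s‖ ≤ 0 := by
          have := norm_apply_le_norm_cfcₙ (hatF c) h hs fc.continuousOn f0 hsa
          rwa [h0, norm_zero] at this
        have h4 : hatF c s = 0 := by simpa using h3
        rw [Real.norm_eq_abs, abs_of_nonneg hs0]
        unfold hatF at h4
        have := le_max_right 0 (s - c)
        linarith
      rwa [cfcₙ_id' ℝ h] at h2
    linarith
  have hpow : ∀ n : ℕ, ∃ k w : C, k * w = cfcₙ (hatF c) h ∧ ‖k‖ ≤ (c⁻¹) ^ n ∧ N (φ w) ≤ N (φ h) ^ (n+1) ∧ w = cfcₙ (fun s : ℝ => s ^ (n + 1)) h := by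
    intro n
    refine ⟨cfcₙ (fun s => hatF c s * ((max c s)⁻¹) ^ (n + 1)) h, cfcₙ (fun s : ℝ => s ^ (n + 1)) h, ?_, ?_, ?_, rfl⟩
    · have g1 : Continuous fun s => hatF c s * ((max c s)⁻¹) ^ (n + 1) := by
        refine fc.mul ((Continuous.inv₀ (by fun_prop) fun s => ?_).pow _)
        have : c ≤ max c s := le_max_left _ _
        positivity
      rw [← cfcₙ_mul _ _ h g1.continuousOn (by simp [f0]) (by fun_prop) (by simp)]
      refine cfcₙ_congr fun s hs => ?_
      rcases le_total s c with h5 | h5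
      · have : hatF c s = 0 := by unfold hatF; simp [h5]
        simp [this]
      · rw [max_eq_right h5]
        have : s ≠ 0 := by linarith
        rw [mul_assoc, ← mul_pow, inv_mul_cancel₀ this, one_pow, mul_one]
    · refine norm_cfcₙ_le fun s hs => ?_
      have hs0 : 0 ≤ s := quasispectrum_nonneg_of_nonneg h hh s hs
      have hsn : s ≤ ‖h‖ := (le_abs_self s).trans
        (NonUnitalIsometricContinuousFunctionalCalculus.norm_quasispectrum_le (𝕜 := ℝ) h hs hsa)
      have hm : 0 < max c s := lt_of_lt_of_le hc0 (le_max_left _ _)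
      have h6 : hatF c s * (max c s)⁻¹ ≤ 1 := by
        rw [← div_eq_mul_inv, div_le_one hm]
        unfold hatF
        exact max_le hm.le ((by linarith : s - c ≤ s).trans (le_max_right _ _))
      have h7 : 0 ≤ hatF c s := le_max_left _ _
      have h8 : hatF c s ≤ ‖h‖ := max_le (norm_nonneg _) (by linarith)
      rw [Real.norm_eq_abs, abs_of_nonneg (by positivity)]
      have h9 : (max c s)⁻¹ ≤ c⁻¹ := inv_anti₀ hc0 (le_max_left _ _)
      have h10 : ((max c s)⁻¹) ^ n ≤ c⁻¹ ^ n := pow_le_pow_left₀ (by positivity) h9 n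
      calc hatF c s * (max c s)⁻¹ ^ (n + 1) = (hatF c s * (max c s)⁻¹) * (max c s)⁻¹ ^ n := by rw [pow_succ]; ring
        _ ≤ 1 * c⁻¹ ^ n := mul_le_mul h6 h10 (by positivity) zero_le_one
        _ = c⁻¹ ^ n := one_mul _
    · induction n with
      | zero => simp [cfcₙ_id' ℝ h]
      | succ n ih =>
        have : cfcₙ (fun s : ℝ => s ^ (n + 1 + 1)) h = cfcₙ (fun s : ℝ => s ^ (n + 1)) h * h := by
          have e := cfcₙ_mul (fun s : ℝ => s ^ (n + 1)) (fun s => s) h (by fun_prop) (by simp) (by fun_prop) rfl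
          rw [cfcₙ_id' ℝ h] at e
          rw [← e]; rfl
        rw [this, map_mul, pow_succ]
        exact (hN.mul_le _ _).trans (mul_le_mul_of_nonneg_right ih (hN.nonneg _))
  have hz : N (φ (cfcₙ (hatF c) h)) = 0 := by
    refine le_antisymm ?_ (hN.nonneg _)
    have hb : ∀ n : ℕ, N (φ (cfcₙ (hatF c) h)) ≤ N (φ h) * (c⁻¹ * N (φ h)) ^ n := by
      intro n
      obtain ⟨k, w, h1, h2, h3, -⟩ := hpow n
      rw [← h1, map_mul]
      refine (hN.mul_le _ _).trans ?_
      refine (mul_le_mul ((cstarnorm_le hN φ k).trans h2) h3 (hN.nonneg _) (by positivity)).trans (le_of_eq ?_)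
      rw [mul_pow]; ring
    have ht : Tendsto (fun n : ℕ => N (φ h) * (c⁻¹ * N (φ h)) ^ n) atTop (𝓝 (N (φ h) * 0)) := by
      refine (tendsto_pow_atTop_nhds_zero_of_lt_one (mul_nonneg (by positivity) (hN.nonneg _)) ?_).const_mul _
      rw [inv_mul_lt_one₀ hc0]; exact hc1
    rw [mul_zero] at ht
    exact ge_of_tendsto' ht hb
  exact hne (hφ ((hN.eq_zero_of _ hz).trans (map_zero φ).symm))

theorem cstarnorm_eq {N : M → ℝ} (hN : IsCStarNorm N) (φ : C →⋆ₙₐ[ℂ] M) (hφ : Function.Injective φ) (x : C) :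
    N (φ x) = ‖x‖ := by
  letI := CStarAlgebra.spectralOrder C
  haveI := CStarAlgebra.spectralOrderedRing C
  refine le_antisymm (cstarnorm_le hN φ x) ?_
  have h1 := cstarnorm_ge_pos hN φ hφ (star x * x) (star_mul_self_nonneg x)
  rw [map_mul, map_star, hN.star_mul_self, CStarRing.norm_star_mul_self] at h1
  exact le_of_not_gt fun h => absurd h1 (not_le.2 (mul_self_lt_mul_self (hN.nonneg _) h))

end UniqueNorm

section MatNorm
variable {A : Type*} [NonUnitalCStarAlgebra A] [PartialOrder A] [StarOrderedRing A]

theorem matnorm_eq {p : ℕ} {N : Matrix (Fin p) (Fin p) A → ℝ} (hN : IsCStarNorm N) (v : Matrix (Fin p) (Fin p) A) :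
    N v = ‖CStarMatrix.ofMatrix v‖ := by
  let φ : CStarMatrix (Fin p) (Fin p) A →⋆ₙₐ[ℂ] Matrix (Fin p) (Fin p) A :=
    { toFun := fun x => CStarMatrix.ofMatrix.symm x
      map_smul' := fun _ _ => rfl
      map_zero' := rfl
      map_add' := fun _ _ => rfl
      map_mul' := fun _ _ => rfl
      map_star' := fun _ => rfl }
  exact cstarnorm_eq hN φ (CStarMatrix.ofMatrix.symm.injective) (CStarMatrix.ofMatrix v)

end MatNorm

end SecP7

section SecP8
section JCB

theorem osProj_nonempty_le {A B : Type u} [AddCommGroup A] [Module ℂ A] [AddCommGroup B] [Module ℂ B]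
    (NA : ∀ p : ℕ, Matrix (Fin p) (Fin p) A → ℝ)
    (NB : ∀ q : ℕ, Matrix (Fin q) (Fin q) B → ℝ) (h1 : ∀ p v, 0 ≤ NA p v) (h2 : ∀ p v, 0 ≤ NB p v)
    (p q : ℕ) (α : Fin p × Fin q → ℂ) (v : Matrix (Fin p) (Fin p) A)
      (w : Matrix (Fin q) (Fin q) B) (β : Fin p × Fin q → ℂ) :
    osProjNorm NA NB (∑ ik : Fin p × Fin q, ∑ jl : Fin p × Fin q,
            (α ik * β jl) • (v ik.1 jl.1 ⊗ₜ[ℂ] w ik.2 jl.2)) ≤ Real.sqrt (∑ ik, ‖α ik‖ ^ 2) * NA p v * NB q w *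
            Real.sqrt (∑ jl, ‖β jl‖ ^ 2) := by
  refine csInf_le ⟨0, ?_⟩ ⟨p, q, α, v, w, β, rfl, rfl⟩
  rintro r ⟨p, q, α, v, w, β, -, rfl⟩
  have := h1 p v
  have := h2 q w
  positivity

variable {A B : Type u} [NonUnitalCStarAlgebra A] [NonUnitalCStarAlgebra B] [PartialOrder A] [StarOrderedRing A]
  [PartialOrder B] [StarOrderedRing B]

def jcbV (V : A ⊗[ℂ] B →ₗ[ℂ] ℂ) {p : ℕ} (ρ : Fin p → ℝ) :
    CStarMatrix (Fin p) (Fin p) A →ₗ[ℂ] CStarMatrix (Fin p) (Fin p) B →ₗ[ℂ] ℂ :=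
  LinearMap.mk₂ ℂ (fun X W => ∑ i, ∑ j, ((√(ρ i) * √(ρ j) : ℝ) : ℂ) * V (X i j ⊗ₜ[ℂ] W i j))
    (by intro X X' W; simp [TensorProduct.add_tmul, mul_add, Finset.sum_add_distrib])
    (by intro c X W; simp only [CStarMatrix.smul_apply, ← TensorProduct.smul_tmul', map_smul, smul_eq_mul, Finset.mul_sum]
        refine Finset.sum_congr rfl fun i _ => Finset.sum_congr rfl fun j _ => by ring)
    (by intro X W W'; simp [TensorProduct.tmul_add, mul_add, Finset.sum_add_distrib])
    (by intro c X W; simp only [CStarMatrix.smul_apply, TensorProduct.tmul_smul, map_smul, smul_eq_mul, Finset.mul_sum]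
        refine Finset.sum_congr rfl fun i _ => Finset.sum_congr rfl fun j _ => by ring)

theorem jcbV_bound (NA : ∀ p : ℕ, Matrix (Fin p) (Fin p) A → ℝ)
    (NB : ∀ q : ℕ, Matrix (Fin q) (Fin q) B → ℝ)
    (hNA : ∀ p, IsCStarNorm (NA p)) (hNB : ∀ q, IsCStarNorm (NB q))
    (V : A ⊗[ℂ] B →ₗ[ℂ] ℂ) (hV : ∀ u, ‖V u‖ ≤ osProjNorm NA NB u) {p : ℕ} (ρ : Fin p → ℝ) (hρ : ∀ i, 0 ≤ ρ i)
    (hρ1 : ∑ i, ρ i ≤ 1) (X : CStarMatrix (Fin p) (Fin p) A) (W : CStarMatrix (Fin p) (Fin p) B) :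
    ‖jcbV V ρ X W‖ ≤ ‖X‖ * ‖W‖ := by
  set α : Fin p × Fin p → ℂ := fun ik => if ik.1 = ik.2 then ((√(ρ ik.1) : ℝ) : ℂ) else 0 with hα
  have h1 := osProj_nonempty_le NA NB (fun p v => (hNA p).nonneg v) (fun p v => (hNB p).nonneg v) p p α
    (CStarMatrix.ofMatrix.symm X) (CStarMatrix.ofMatrix.symm W) α
  rw [matnorm_eq (hNA p), matnorm_eq (hNB p)] at h1
  have h2 : √(∑ ik, ‖α ik‖ ^ 2) ≤ 1 := by
    rw [Real.sqrt_le_one]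
    refine le_trans (le_of_eq ?_) hρ1
    rw [Fintype.sum_prod_type]
    refine Finset.sum_congr rfl fun i _ => ?_
    rw [Finset.sum_eq_single i]
    · simp [hα, Real.sq_sqrt (hρ i)]
    · intro b _ hb; simp [hα, hb.symm]
    · simp
  have h3 : jcbV V ρ X W = V (∑ ik : Fin p × Fin p, ∑ jl : Fin p × Fin p,
            (α ik * α jl) • (CStarMatrix.ofMatrix.symm X ik.1 jl.1 ⊗ₜ[ℂ] CStarMatrix.ofMatrix.symm W ik.2 jl.2)) := by
    have hs : ∀ f : Fin p × Fin p → ℂ, ∑ ik, α ik * f ik = ∑ i, ((√(ρ i) : ℝ) : ℂ) * f (i, i) := by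
      intro f
      rw [Fintype.sum_prod_type]
      refine Finset.sum_congr rfl fun i _ => ?_
      rw [Finset.sum_eq_single i]
      · simp [hα]
      · intro b _ hb; simp [hα, hb.symm]
      · simp
    simp only [map_sum, map_smul, smul_eq_mul, mul_assoc, ← Finset.mul_sum]
    rw [hs]
    simp only [hs]
    simp only [jcbV, LinearMap.mk₂_apply, Complex.ofReal_mul, Finset.mul_sum, mul_assoc]
    rfl
  rw [h3]
  refine (hV _).trans (h1.trans ?_)
  simp only [Equiv.apply_symm_apply]
  calc √(∑ ik, ‖α ik‖ ^ 2) * ‖X‖ * ‖W‖ * √(∑ ik, ‖α ik‖ ^ 2) ≤ 1 * ‖X‖ * ‖W‖ * 1 := by gcongr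
    _ = _ := by ring

theorem diag_norm_le {p : ℕ} (y : Fin p → A) {c : ℝ} (hc : 0 ≤ c) (h : ∀ i, ‖y i‖ ≤ c) :
    ‖CStarMatrix.ofMatrix (Matrix.diagonal y)‖ ≤ c := by
  let φ : (Fin p → A) →⋆ₙₐ[ℂ] CStarMatrix (Fin p) (Fin p) A :=
    { toFun := fun y => CStarMatrix.ofMatrix (Matrix.diagonal y)
      map_smul' := fun c y => by
        show CStarMatrix.ofMatrix _ = CStarMatrix.ofMatrix _
        rw [Matrix.diagonal_smul]; rfl
      map_zero' := by
        show CStarMatrix.ofMatrix _ = CStarMatrix.ofMatrix _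
        congr 1; exact Matrix.diagonal_zero
      map_add' := fun x y => by
        show CStarMatrix.ofMatrix _ = CStarMatrix.ofMatrix _
        exact congrArg _ (Matrix.diagonal_add x y).symm
      map_mul' := fun x y => by
        show CStarMatrix.ofMatrix _ = CStarMatrix.ofMatrix _
        exact congrArg _ (Matrix.diagonal_mul_diagonal x y).symm
      map_star' := fun x => by
        show CStarMatrix.ofMatrix _ = CStarMatrix.ofMatrix _
        exact congrArg _ (Matrix.diagonal_conjTranspose x).symm }
  refine (NonUnitalStarAlgHom.norm_apply_le φ y).trans ?_
  exact (pi_norm_le_iff_of_nonneg hc).2 h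

def jE {p : ℕ} (i j : Fin p) (a : A) : CStarMatrix (Fin p) (Fin p) A := CStarMatrix.ofMatrix (Matrix.single i j a)

theorem jE_star {p : ℕ} (i j : Fin p) (a : A) : star (jE i j a) = jE j i (star a) :=
  congrArg CStarMatrix.ofMatrix (Matrix.conjTranspose_single i j a)

theorem jE_mul {p : ℕ} (i j : Fin p) (a b : A) : jE i j a * jE j i b = jE i i (a * b) :=
  congrArg CStarMatrix.ofMatrix (Matrix.single_mul_single_same a i j i b)

theorem csm_sum_apply {κ : Type*} {p : ℕ} (S : Finset κ) (f : κ → CStarMatrix (Fin p) (Fin p) A) (i k : Fin p) :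
    (∑ s ∈ S, f s) i k = ∑ s ∈ S, f s i k := by
  classical
  induction S using Finset.induction_on with
  | empty => simp
  | insert a S ha ih => rw [Finset.sum_insert ha, Finset.sum_insert ha, CStarMatrix.add_apply, ih]

theorem fam_norm {J : Type*} [Fintype J] {p : ℕ} (a : J → A) (x : J → Fin p → Fin p → ℝ) (T : J → ℝ) (hT : ∀ j, 0 ≤ T j)
    (h : ∀ j i, ∑ k, x j i k ^ 2 ≤ T j) {c : ℝ} (hc : ‖∑ j, (T j : ℂ) • (a j * star (a j))‖ ≤ c) :
    ‖∑ s : J × (Fin p × Fin p), jE s.2.1 s.2.2 ((x s.1 s.2.1 s.2.2 : ℂ) • a s.1) *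
      star (jE s.2.1 s.2.2 ((x s.1 s.2.1 s.2.2 : ℂ) • a s.1))‖ ≤ c := by
  have e1 : ∑ s : J × (Fin p × Fin p), jE s.2.1 s.2.2 ((x s.1 s.2.1 s.2.2 : ℂ) • a s.1) *
      star (jE s.2.1 s.2.2 ((x s.1 s.2.1 s.2.2 : ℂ) • a s.1)) =
      CStarMatrix.ofMatrix (Matrix.diagonal fun i => ∑ j, ((∑ k, x j i k ^ 2 : ℝ) : ℂ) • (a j * star (a j))) := by
    simp only [jE_star, jE_mul, star_smul, smul_mul_smul_comm, RCLike.star_def, Complex.conj_ofReal]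
    ext i k
    rw [Fintype.sum_prod_type]
    simp only [Fintype.sum_prod_type]
    have e2 : ∀ f : CStarMatrix (Fin p) (Fin p) A, f i k = CStarMatrix.ofMatrix.symm f i k := fun _ => rfl
    rw [csm_sum_apply]
    have e4 : ∀ j, (∑ i', ∑ k', jE i' i' (((x j i' k' : ℂ) * (x j i' k' : ℂ)) • (a j * star (a j)))) i k =
        if i = k then ((∑ k, x j i k ^ 2 : ℝ) : ℂ) • (a j * star (a j)) else 0 := by
      intro j
      rw [csm_sum_apply]
      simp only [csm_sum_apply]
      have e5 : ∀ i' (b : A), (jE i' i' b : CStarMatrix (Fin p) (Fin p) A) i k = if i' = i then (if i = k then b else 0) else 0 := by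
        intro i' b
        show Matrix.single i' i' b i k = _
        rw [Matrix.single_apply]
        by_cases h1 : i' = i <;> by_cases h2 : i = k <;> simp_all
      simp only [e5]
      rw [Finset.sum_eq_single i]
      · by_cases h2 : i = k
        · simp [h2, Finset.sum_smul, sq]
        · simp [h2]
      · intro b _ hb; simp [hb]
      · simp
    simp only [e4]
    show _ = Matrix.diagonal _ i k
    rw [Matrix.diagonal_apply]
    by_cases h2 : i = k <;> simp [h2]
  rw [e1]
  refine diag_norm_le _ ((norm_nonneg _).trans hc) fun i => le_trans ?_ hc
  have hsm : ∀ (t : ℝ) (ht : 0 ≤ t) (y : A), 0 ≤ (t : ℂ) • (y * star y) := by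
    intro t ht y
    have : (t : ℂ) • (y * star y) = (((√t : ℝ) : ℂ) • y) * star (((√t : ℝ) : ℂ) • y) := by
      rw [star_smul, smul_mul_smul_comm, RCLike.star_def, Complex.conj_ofReal, ← Complex.ofReal_mul, Real.mul_self_sqrt ht]
    rw [this]; exact mul_star_self_nonneg _
  refine CStarAlgebra.norm_le_norm_of_nonneg_of_le (Finset.sum_nonneg fun j _ => hsm _ (Finset.sum_nonneg fun k _ => sq_nonneg _) _) ?_
  refine Finset.sum_le_sum fun j _ => ?_
  rw [← sub_nonneg, ← sub_smul, ← Complex.ofReal_sub]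
  exact hsm _ (sub_nonneg.2 (h j i)) _

theorem fam_norm' {J : Type*} [Fintype J] {p : ℕ} (a : J → A) (x : J → Fin p → Fin p → ℝ) (T : J → ℝ) (hT : ∀ j, 0 ≤ T j)
    (h : ∀ j k, ∑ i, x j i k ^ 2 ≤ T j) {c : ℝ} (hc : ‖∑ j, (T j : ℂ) • (star (a j) * a j)‖ ≤ c) :
    ‖∑ s : J × (Fin p × Fin p), star (jE s.2.1 s.2.2 ((x s.1 s.2.1 s.2.2 : ℂ) • a s.1)) *
      jE s.2.1 s.2.2 ((x s.1 s.2.1 s.2.2 : ℂ) • a s.1)‖ ≤ c := by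
  have h1 := fam_norm (fun j => star (a j)) (fun j i k => x j k i) T hT h (c := c) (by simpa using hc)
  have h2 : ∑ s : J × (Fin p × Fin p), star (jE s.2.1 s.2.2 ((x s.1 s.2.1 s.2.2 : ℂ) • a s.1)) *
      jE s.2.1 s.2.2 ((x s.1 s.2.1 s.2.2 : ℂ) • a s.1) = ∑ s : J × (Fin p × Fin p), jE s.2.1 s.2.2 ((x s.1 s.2.2 s.2.1 : ℂ) • star (a s.1)) *
      star (jE s.2.1 s.2.2 ((x s.1 s.2.2 s.2.1 : ℂ) • star (a s.1))) := by
    refine Fintype.sum_equiv ((Equiv.refl J).prodCongr (Equiv.prodComm _ _)) _ _ fun s => ?_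
    simp [jE_star]
  rw [h2]; exact h1

theorem jcb1 (NA : ∀ p : ℕ, Matrix (Fin p) (Fin p) A → ℝ)
    (NB : ∀ q : ℕ, Matrix (Fin q) (Fin q) B → ℝ)
    (hNA : ∀ p, IsCStarNorm (NA p)) (hNB : ∀ q, IsCStarNorm (NB q))
    (V : A ⊗[ℂ] B →ₗ[ℂ] ℂ) (hV : ∀ u, ‖V u‖ ≤ osProjNorm NA NB u) {p : ℕ} (ρ : Fin p → ℝ) (hρ : ∀ i, 0 ≤ ρ i)
    (hρ1 : ∑ i, ρ i ≤ 1) {J : Type*} [Fintype J] (a : J → A) (b : J → B) (t : J → ℝ) (ht : ∀ j, 0 < t j)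
    (h1 : ‖∑ j, a j * star (a j)‖ ≤ 1) (h2 : ‖∑ j, (t j : ℂ) • (star (a j) * a j)‖ ≤ 1)
    (h3 : ‖∑ j, star (b j) * b j‖ ≤ 1) (h4 : ‖∑ j, ((t j)⁻¹ : ℂ) • (b j * star (b j))‖ ≤ 1)
    (x : J → Fin p → Fin p → ℝ) (hx1 : ∀ j i, ∑ k, x j i k ^ 2 ≤ 1) (hx2 : ∀ j k, ∑ i, x j i k ^ 2 ≤ t j)
    (y : J → Fin p → Fin p → ℝ) (hy1 : ∀ j k, ∑ i, y j i k ^ 2 ≤ 1) (hy2 : ∀ j i, ∑ k, y j i k ^ 2 ≤ (t j)⁻¹) :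
    ‖∑ j, ((∑ i, ∑ k, √(ρ i) * √(ρ k) * x j i k * y j i k : ℝ) : ℂ) * V (a j ⊗ₜ[ℂ] b j)‖ ≤ 1609 := by
  have g := gt_nonunital (jcbV V ρ) (jcbV_bound NA NB hNA hNB V hV ρ hρ hρ1)
    (fam_norm' a x t (fun j => (ht j).le) hx2 h2)
    (fam_norm a x (fun _ => 1) (fun j => zero_le_one) hx1 (by simpa using h1))
    (y := fun s : J × (Fin p × Fin p) => jE s.2.1 s.2.2 ((y s.1 s.2.1 s.2.2 : ℂ) • b s.1))
    (fam_norm' b y (fun _ => 1) (fun j => zero_le_one) hy1 (by simpa using h3))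
    (fam_norm b y (fun j => (t j)⁻¹) (fun j => (inv_pos.2 (ht j)).le) hy2 (by simpa using h4))
  refine le_trans (le_of_eq ?_) g
  congr 1
  rw [Fintype.sum_prod_type]
  refine Finset.sum_congr rfl fun j _ => ?_
  rw [Fintype.sum_prod_type]
  push_cast
  rw [Finset.sum_mul]
  refine Finset.sum_congr rfl fun i _ => ?_
  rw [Finset.sum_mul]
  refine Finset.sum_congr rfl fun k _ => ?_
  simp only [jcbV, LinearMap.mk₂_apply]
  have e5 : ∀ {D : Type u} [NonUnitalCStarAlgebra D] (b : D) i' k', (jE i k b : CStarMatrix (Fin p) (Fin p) D) i' k' = if i = i' ∧ k = k' then b else 0 := by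
    intro D _ b i' k'
    show Matrix.single i k b i' k' = _
    rw [Matrix.single_apply]
  rw [Finset.sum_eq_single i, Finset.sum_eq_single k]
  · simp only [e5, and_self, if_true, TensorProduct.tmul_smul, ← TensorProduct.smul_tmul', map_smul, smul_eq_mul]
    push_cast; ring
  · intro k' _ hk; simp [e5, hk.symm]
  · simp
  · intro i' _ hi; simp [e5, hi.symm]
  · simp

end JCB

end SecP8

section SecP9
section Embezzle
open Filter Topology

/-- number of pairs of levels differing by `m` -/
def levCount (L : ℕ) (m : ℤ) : ℝ := ∑ k : Fin (L + 1), ∑ k' : Fin (L + 1), if (k : ℤ) = (k' : ℤ) + m then (1:ℝ) else 0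

theorem lev_le_one (L : ℕ) (m : ℤ) (k : Fin (L + 1)) : (∑ k' : Fin (L + 1), if (k : ℤ) = (k' : ℤ) + m then (1:ℝ) else 0) ≤ 1 := by
  rw [Finset.sum_boole]
  have : (Finset.univ.filter fun k' : Fin (L+1) => (k : ℤ) = (k' : ℤ) + m).card ≤ 1 := by
    rw [Finset.card_le_one]
    intro a ha b hb
    simp only [Finset.mem_filter, Finset.mem_univ, true_and] at ha hb
    apply Fin.ext; omega
  exact_mod_cast this

theorem lev_le_one' (L : ℕ) (m : ℤ) (k' : Fin (L + 1)) : (∑ k : Fin (L + 1), if (k : ℤ) = (k' : ℤ) + m then (1:ℝ) else 0) ≤ 1 := by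
  rw [Finset.sum_boole]
  have : (Finset.univ.filter fun k : Fin (L+1) => (k : ℤ) = (k' : ℤ) + m).card ≤ 1 := by
    rw [Finset.card_le_one]
    intro a ha b hb
    simp only [Finset.mem_filter, Finset.mem_univ, true_and] at ha hb
    apply Fin.ext; omega
  exact_mod_cast this

theorem levCount_le (L : ℕ) (m : ℤ) : levCount L m ≤ L + 1 := by
  unfold levCount
  refine (Finset.sum_le_sum fun k _ => lev_le_one L m k).trans ?_
  simp

theorem levCount_ge (L : ℕ) (m : ℤ) : (L : ℝ) + 1 - |(m:ℝ)| ≤ levCount L m := by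
  unfold levCount
  rw [← Fintype.sum_prod_type' (f := fun (k k' : Fin (L+1)) => if (k : ℤ) = (k' : ℤ) + m then (1:ℝ) else 0), Finset.sum_boole]
  have h1 : (Finset.Icc (max 0 m) (min (L:ℤ) (L + m))).card ≤
      (Finset.univ.filter fun z : Fin (L+1) × Fin (L+1) => (z.1 : ℤ) = (z.2 : ℤ) + m).card := by
    refine Finset.card_le_card_of_injOn (fun z => (Fin.ofNat (L+1) z.toNat, Fin.ofNat (L+1) (z - m).toNat)) ?_ ?_
    · intro z hz
      simp only [Finset.coe_Icc, Set.mem_Icc, max_le_iff, le_min_iff] at hz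
      simp only [Finset.coe_filter, Finset.mem_univ, true_and, Set.mem_setOf_eq, Fin.val_ofNat]
      rw [Nat.mod_eq_of_lt (by omega), Nat.mod_eq_of_lt (by omega)]
      omega
    · intro z hz w hw h
      simp only [Finset.coe_Icc, Set.mem_Icc, max_le_iff, le_min_iff] at hz hw
      have h2 := congrArg (fun q : Fin (L+1) × Fin (L+1) => (q.1 : ℕ)) h
      simp only [Fin.val_ofNat] at h2
      rw [Nat.mod_eq_of_lt (by omega), Nat.mod_eq_of_lt (by omega)] at h2
      omega
  rw [Int.card_Icc] at h1
  have h3 : (L : ℤ) + 1 - |m| ≤ ((Finset.univ.filter fun z : Fin (L+1) × Fin (L+1) => (z.1 : ℤ) = (z.2 : ℤ) + m).card : ℤ) := by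
    rcases abs_cases m with h | h <;> omega
  exact_mod_cast h3

theorem levCount_tendsto (m : ℤ) : Tendsto (fun L : ℕ => levCount L m / (L + 1)) atTop (𝓝 1) := by
  have h1 : Tendsto (fun L : ℕ => 1 - |(m:ℝ)| * (1 / ((L:ℝ) + 1))) atTop (𝓝 (1 - |(m:ℝ)| * 0)) :=
    tendsto_const_nhds.sub (tendsto_one_div_add_atTop_nhds_zero_nat.const_mul _)
  rw [mul_zero, sub_zero] at h1
  refine tendsto_of_tendsto_of_tendsto_of_le_of_le h1 tendsto_const_nhds (fun L => ?_) (fun L => ?_)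
  · have := levCount_ge L m
    simp only
    rw [le_div_iff₀ (by positivity)]
    have hL : (0:ℝ) < L + 1 := by positivity
    field_simp
    linarith
  · simp only
    rw [div_le_one (by positivity)]; exact levCount_le L m

theorem lev_exists (L : ℕ) : ∃ (p : ℕ) (lev : Fin p → Fin (L + 1)), ∀ f : Fin (L + 1) → ℝ, ∑ i, f (lev i) = ∑ k : Fin (L + 1), 2 ^ (k : ℕ) * f k := by
  let Ω := Σ k : Fin (L + 1), Fin (2 ^ (k : ℕ))
  refine ⟨Fintype.card Ω, fun i => ((Fintype.equivFin Ω).symm i).1, fun f => ?_⟩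
  rw [Fintype.sum_equiv (Fintype.equivFin Ω).symm _ (fun z : Ω => f z.1) (fun _ => rfl)]
  rw [Fintype.sum_sigma]
  simp

variable {A B : Type u} [NonUnitalCStarAlgebra A] [NonUnitalCStarAlgebra B] [PartialOrder A] [StarOrderedRing A]
  [PartialOrder B] [StarOrderedRing B]

theorem jcb2 (NA : ∀ p : ℕ, Matrix (Fin p) (Fin p) A → ℝ)
    (NB : ∀ q : ℕ, Matrix (Fin q) (Fin q) B → ℝ)
    (hNA : ∀ p, IsCStarNorm (NA p)) (hNB : ∀ q, IsCStarNorm (NB q))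
    (V : A ⊗[ℂ] B →ₗ[ℂ] ℂ) (hV : ∀ u, ‖V u‖ ≤ osProjNorm NA NB u)
    {J : Type*} [Fintype J] (a : J → A) (b : J → B) (m : J → ℤ) (t : J → ℝ) (htm : ∀ j, t j = 2 ^ (m j))
    (h1 : ‖∑ j, a j * star (a j)‖ ≤ 1) (h2 : ‖∑ j, (t j : ℂ) • (star (a j) * a j)‖ ≤ 1)
    (h3 : ‖∑ j, star (b j) * b j‖ ≤ 1) (h4 : ‖∑ j, ((t j)⁻¹ : ℂ) • (b j * star (b j))‖ ≤ 1) :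
    ‖∑ j, V (a j ⊗ₜ[ℂ] b j)‖ ≤ 1609 := by
  have ht : ∀ j, 0 < t j := fun j => by rw [htm]; positivity
  have hL : ∀ L : ℕ, ‖∑ j, ((levCount L (m j) / (L + 1) : ℝ) : ℂ) * V (a j ⊗ₜ[ℂ] b j)‖ ≤ 1609 := by
    intro L
    obtain ⟨p, lev, hlev⟩ := lev_exists L
    have hL0 : (0:ℝ) < L + 1 := by positivity
    have hpw : ∀ n : ℕ, (2:ℝ) ^ n * ((2:ℝ) ^ n)⁻¹ = 1 := fun n => mul_inv_cancel₀ (by positivity)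
    set x : J → Fin p → Fin p → ℝ := fun j i k =>
      if ((lev i : ℕ) : ℤ) = ((lev k : ℕ) : ℤ) + m j then √(((2:ℝ) ^ (lev k : ℕ))⁻¹) else 0 with hx
    set y : J → Fin p → Fin p → ℝ := fun j i k =>
      if ((lev i : ℕ) : ℤ) = ((lev k : ℕ) : ℤ) + m j then √(((2:ℝ) ^ (lev i : ℕ))⁻¹) else 0 with hy
    have hx2 : ∀ j i k, x j i k ^ 2 = (if ((lev i : ℕ) : ℤ) = ((lev k : ℕ) : ℤ) + m j then (1:ℝ) else 0) * ((2:ℝ) ^ (lev k : ℕ))⁻¹ := by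
      intro j i k
      simp only [hx]; split_ifs
      · rw [Real.sq_sqrt (by positivity), one_mul]
      · simp
    have hy2 : ∀ j i k, y j i k ^ 2 = (if ((lev i : ℕ) : ℤ) = ((lev k : ℕ) : ℤ) + m j then (1:ℝ) else 0) * ((2:ℝ) ^ (lev i : ℕ))⁻¹ := by
      intro j i k
      simp only [hy]; split_ifs
      · rw [Real.sq_sqrt (by positivity), one_mul]
      · simp
    have htk : ∀ j (k k' : Fin (L+1)), ((k:ℕ):ℤ) = ((k':ℕ):ℤ) + m j → (2:ℝ)^(k:ℕ) * ((2:ℝ)^(k':ℕ))⁻¹ = t j := by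
      intro j k k' h
      rw [htm, ← zpow_natCast, ← zpow_natCast, h, zpow_add₀ (by norm_num)]
      rw [mul_right_comm, mul_inv_cancel₀ (by positivity), one_mul]
    have hg := jcb1 NA NB hNA hNB V hV (p := p) (fun i => ((2:ℝ) ^ (lev i : ℕ))⁻¹ / (L + 1)) (fun i => by positivity)
      (le_of_eq (by
        rw [hlev (fun k => ((2:ℝ) ^ (k : ℕ))⁻¹ / (L + 1))]
        simp only [mul_div_assoc', hpw]
        simp; field_simp)) a b t ht h1 h2 h3 h4 x ?_ ?_ y ?_ ?_
    · refine le_trans (le_of_eq ?_) hg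
      congr 1
      refine Finset.sum_congr rfl fun j _ => ?_
      congr 2
      have e1 : ∀ i k, √(((2:ℝ) ^ (lev i : ℕ))⁻¹ / (L + 1)) * √(((2:ℝ) ^ (lev k : ℕ))⁻¹ / (L + 1)) * x j i k * y j i k
          = (if ((lev i : ℕ) : ℤ) = ((lev k : ℕ) : ℤ) + m j then (1:ℝ) else 0) * ((2:ℝ) ^ (lev i : ℕ))⁻¹ * ((2:ℝ) ^ (lev k : ℕ))⁻¹ / (L + 1) := by
        intro i k
        simp only [hx, hy]
        split_ifs
        · rw [Real.sqrt_div (by positivity), Real.sqrt_div (by positivity)]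
          have r1 : √(((2:ℝ) ^ (lev i : ℕ))⁻¹) * √(((2:ℝ) ^ (lev i : ℕ))⁻¹) = ((2:ℝ) ^ (lev i : ℕ))⁻¹ := Real.mul_self_sqrt (by positivity)
          have r2 : √(((2:ℝ) ^ (lev k : ℕ))⁻¹) * √(((2:ℝ) ^ (lev k : ℕ))⁻¹) = ((2:ℝ) ^ (lev k : ℕ))⁻¹ := Real.mul_self_sqrt (by positivity)
          have r3 : √((L:ℝ) + 1) * √((L:ℝ) + 1) = L + 1 := Real.mul_self_sqrt (by positivity)
          rw [one_mul]
          have key : ∀ s s' w P Q R : ℝ, s * s = P → s' * s' = Q → w * w = R →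
              s / w * (s' / w) * s' * s = P * Q / R := by
            intro s s' w P Q R h1 h2 h3
            rw [← h1, ← h2, ← h3, div_mul_div_comm]
            ring
          exact key _ _ _ _ _ _ r1 r2 r3
        · simp
      simp only [e1]
      have e2 : ∀ i, ∑ k, (if ((lev i : ℕ) : ℤ) = ((lev k : ℕ) : ℤ) + m j then (1:ℝ) else 0) * ((2:ℝ) ^ (lev i : ℕ))⁻¹ * ((2:ℝ) ^ (lev k : ℕ))⁻¹ / (L + 1)
         = ((2:ℝ) ^ (lev i : ℕ))⁻¹ * (∑ k' : Fin (L+1), if ((lev i : ℕ) : ℤ) = ((k' : ℕ) : ℤ) + m j then (1:ℝ) else 0) / (L + 1) := by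
        intro i
        rw [hlev (fun k' => (if ((lev i : ℕ) : ℤ) = ((k' : ℕ) : ℤ) + m j then (1:ℝ) else 0) * ((2:ℝ) ^ (lev i : ℕ))⁻¹ * ((2:ℝ) ^ (k' : ℕ))⁻¹ / (L + 1))]
        rw [Finset.mul_sum, Finset.sum_div]
        refine Finset.sum_congr rfl fun k' _ => ?_
        have := hpw k'
        rw [mul_div_assoc', ← mul_assoc, mul_comm ((2:ℝ) ^ (k':ℕ)), mul_assoc _ ((2:ℝ) ^ (k':ℕ)), this]
        ring
      simp only [e2]
      rw [hlev (fun k => ((2:ℝ) ^ (k : ℕ))⁻¹ * (∑ k' : Fin (L+1), if ((k : ℕ) : ℤ) = ((k' : ℕ) : ℤ) + m j then (1:ℝ) else 0) / (L + 1))]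
      unfold levCount
      rw [Finset.sum_div]
      refine Finset.sum_congr rfl fun k _ => ?_
      rw [mul_div_assoc', ← mul_assoc, hpw, one_mul]
    · intro j i
      simp only [hx2]
      rw [hlev (fun k => (if ((lev i : ℕ) : ℤ) = ((k : ℕ) : ℤ) + m j then (1:ℝ) else 0) * ((2:ℝ) ^ (k : ℕ))⁻¹)]
      refine le_trans (le_of_eq ?_) (lev_le_one L (m j) (lev i))
      refine Finset.sum_congr rfl fun k _ => ?_
      rw [mul_comm _ (((2:ℝ) ^ (k : ℕ))⁻¹), ← mul_assoc, hpw, one_mul]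
    · intro j k
      simp only [hx2]
      rw [hlev (fun i => (if ((i : ℕ) : ℤ) = ((lev k : ℕ) : ℤ) + m j then (1:ℝ) else 0) * ((2:ℝ) ^ (lev k : ℕ))⁻¹)]
      have : ∑ i : Fin (L+1), (2:ℝ) ^ (i : ℕ) * ((if ((i : ℕ) : ℤ) = ((lev k : ℕ) : ℤ) + m j then (1:ℝ) else 0) * ((2:ℝ) ^ (lev k : ℕ))⁻¹)
        = t j * ∑ i : Fin (L+1), (if ((i : ℕ) : ℤ) = ((lev k : ℕ) : ℤ) + m j then (1:ℝ) else 0) := by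
        rw [Finset.mul_sum]
        refine Finset.sum_congr rfl fun i _ => ?_
        split_ifs with h
        · rw [one_mul, mul_one, htk j i (lev k) h]
        · simp
      rw [this]
      exact mul_le_of_le_one_right (ht j).le (lev_le_one' L (m j) (lev k))
    · intro j k
      simp only [hy2]
      rw [hlev (fun i => (if ((i : ℕ) : ℤ) = ((lev k : ℕ) : ℤ) + m j then (1:ℝ) else 0) * ((2:ℝ) ^ (i : ℕ))⁻¹)]
      refine le_trans (le_of_eq ?_) (lev_le_one' L (m j) (lev k))
      refine Finset.sum_congr rfl fun k _ => ?_
      rw [mul_comm _ (((2:ℝ) ^ (k : ℕ))⁻¹), ← mul_assoc, hpw, one_mul]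
    · intro j i
      simp only [hy2]
      rw [hlev (fun k => (if ((lev i : ℕ) : ℤ) = ((k : ℕ) : ℤ) + m j then (1:ℝ) else 0) * ((2:ℝ) ^ (lev i : ℕ))⁻¹)]
      have : ∑ k : Fin (L+1), (2:ℝ) ^ (k : ℕ) * ((if ((lev i : ℕ) : ℤ) = ((k : ℕ) : ℤ) + m j then (1:ℝ) else 0) * ((2:ℝ) ^ (lev i : ℕ))⁻¹)
        = (t j)⁻¹ * ∑ k : Fin (L+1), (if ((lev i : ℕ) : ℤ) = ((k : ℕ) : ℤ) + m j then (1:ℝ) else 0) := by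
        rw [Finset.mul_sum]
        refine Finset.sum_congr rfl fun k _ => ?_
        split_ifs with h
        · rw [one_mul, mul_one, ← htk j (lev i) k h, mul_inv, inv_inv, mul_comm]
        · simp
      rw [this]
      exact mul_le_of_le_one_right (inv_pos.2 (ht j)).le (lev_le_one L (m j) (lev i))
  have hlim : Tendsto (fun L : ℕ => ‖∑ j, ((levCount L (m j) / (L + 1) : ℝ) : ℂ) * V (a j ⊗ₜ[ℂ] b j)‖) atTop
      (𝓝 ‖∑ j, ((1 : ℝ) : ℂ) * V (a j ⊗ₜ[ℂ] b j)‖) := by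
    refine Tendsto.norm (tendsto_finsetSum _ fun j _ => Tendsto.mul_const _ ?_)
    exact (Complex.continuous_ofReal.tendsto _).comp (levCount_tendsto (m j))
  have := le_of_tendsto' hlim hL
  simpa using this

end Embezzle

end SecP9

section SecP10
lemma norm_wsum_mono {D J : Type*} [NonUnitalCStarAlgebra D] [Fintype J] (x : J → D) (s t : J → ℝ)
    (hs : ∀ j, 0 ≤ s j) (hst : ∀ j, s j ≤ t j) :
    ‖∑ j, (s j : ℂ) • (star (x j) * x j)‖ ≤ ‖∑ j, (t j : ℂ) • (star (x j) * x j)‖ := by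
  letI : PartialOrder D := CStarAlgebra.spectralOrder D
  haveI : StarOrderedRing D := CStarAlgebra.spectralOrderedRing D
  have hp : ∀ (r : ℝ) (j : J), 0 ≤ r → 0 ≤ (r : ℂ) • (star (x j) * x j) := by
    intro r j hr
    rw [Complex.coe_smul]
    exact smul_nonneg hr (star_mul_self_nonneg _)
  refine CStarAlgebra.norm_le_norm_of_nonneg_of_le (Finset.sum_nonneg fun j _ => hp _ j (hs j)) ?_
  refine Finset.sum_le_sum fun j _ => ?_
  rw [← sub_nonneg, ← sub_smul, ← Complex.ofReal_sub]
  exact hp _ j (sub_nonneg.2 (hst j))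

lemma jcb_combine {A B : Type u} [NonUnitalCStarAlgebra A] [NonUnitalCStarAlgebra B]
    {D₁ D₂ : Type*} [NonUnitalCStarAlgebra D₁] [NonUnitalCStarAlgebra D₂]
    (NA : ∀ p : ℕ, Matrix (Fin p) (Fin p) A → ℝ)
    (NB : ∀ q : ℕ, Matrix (Fin q) (Fin q) B → ℝ)
    (hNA : ∀ p, IsCStarNorm (NA p)) (hNB : ∀ q, IsCStarNorm (NB q))
    (π₁ : A →⋆ₙₐ[ℂ] D₁) (π₂ : B →⋆ₙₐ[ℂ] D₂)
    (V : A ⊗[ℂ] B →ₗ[ℂ] ℂ) (hV : ∀ u, ‖V u‖ ≤ osProjNorm NA NB u)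
    (hV1 : ∀ a b, π₁ a = 0 → V (a ⊗ₜ b) = 0) (hV2 : ∀ a b, π₂ b = 0 → V (a ⊗ₜ b) = 0)
    {J : Type} [Fintype J] (c : J → A) (d : J → B) (t : J → ℝ) (ht : ∀ j, 0 < t j)
    (h1 : ‖∑ j, π₁ (c j) * star (π₁ (c j))‖ ≤ 1)
    (h2 : ‖∑ j, (t j : ℂ) • (star (π₁ (c j)) * π₁ (c j))‖ ≤ 1)
    (h3 : ‖∑ j, star (π₂ (d j)) * π₂ (d j)‖ ≤ 1)
    (h4 : ‖∑ j, (((t j)⁻¹ : ℝ) : ℂ) • (π₂ (d j) * star (π₂ (d j)))‖ ≤ 1) :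
    ‖∑ j, V (c j ⊗ₜ d j)‖ ≤ 12872 := by
  letI : PartialOrder A := CStarAlgebra.spectralOrder A
  haveI : StarOrderedRing A := CStarAlgebra.spectralOrderedRing A
  letI : PartialOrder B := CStarAlgebra.spectralOrder B
  haveI : StarOrderedRing B := CStarAlgebra.spectralOrderedRing B
  choose m hm using fun j => exists_mem_Ico_zpow (ht j) (one_lt_two)
  set s : J → ℝ := fun j => 2 ^ (m j) with hs
  have hs0 : ∀ j, 0 < s j := fun j => by simp only [hs]; positivity
  have hst : ∀ j, s j ≤ t j := fun j => (hm j).1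
  have hst' : ∀ j, (s j)⁻¹ ≤ 2 * (t j)⁻¹ := fun j => by
    have := (hm j).2
    rw [zpow_add_one₀ (by norm_num)] at this
    rw [← div_eq_mul_inv, inv_eq_one_div, div_le_div_iff₀ (hs0 j) (ht j)]
    simp only [hs]; linarith
  obtain ⟨a', ha, ha1, ha2⟩ := lift_fam π₁ c s (fun j => (hs0 j).le) h1
    ((norm_wsum_mono _ _ _ (fun j => (hs0 j).le) hst).trans h2)
  obtain ⟨b', hb, hb1, hb2⟩ := lift_fam π₂ (fun j => (2⁻¹ : ℂ) • star (d j)) (fun j => (s j)⁻¹) (fun j => (inv_pos.2 (hs0 j)).le)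
    (by
      simp only [map_smul, map_star, star_smul, star_star, smul_mul_smul_comm, ← Finset.smul_sum, norm_smul]
      norm_num
      linarith) (by
      simp only [map_smul, map_star, star_smul, star_star, smul_mul_smul_comm, smul_comm _ (_ * _ : ℂ), ← Finset.smul_sum]
      rw [norm_smul]
      have := norm_wsum_mono (fun j => star (π₂ (d j))) (fun j => (s j)⁻¹) (fun j => 2 * (t j)⁻¹) (fun j => (inv_pos.2 (hs0 j)).le) hst'
      simp only [star_star] at this
      have e : ‖∑ j, ((2 * (t j)⁻¹ : ℝ) : ℂ) • (π₂ (d j) * star (π₂ (d j)))‖ ≤ 2 := by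
        simp only [Complex.ofReal_mul, mul_smul, ← Finset.smul_sum]
        rw [norm_smul]
        have : ‖((2:ℝ):ℂ)‖ = 2 := by simp
        rw [this]; linarith
      have e2 := this.trans e
      have : ‖(star (2⁻¹:ℂ) * 2⁻¹ : ℂ)‖ = 1/4 := by norm_num
      rw [this]
      linarith)
  have key := jcb2 NA NB hNA hNB V hV (fun j => (2⁻¹:ℂ) • a' j) (fun j => (2⁻¹ : ℂ) • star (b' j)) m s (fun j => rfl)
    (by
      simp only [star_smul, smul_mul_smul_comm, ← Finset.smul_sum, norm_smul]
      norm_num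
      linarith)
    (by
      simp only [star_smul, smul_mul_smul_comm, smul_comm _ (_ * _ : ℂ), ← Finset.smul_sum]
      rw [norm_smul]
      have : ‖(star (2⁻¹:ℂ) * 2⁻¹ : ℂ)‖ = 1/4 := by norm_num
      rw [this]
      linarith)
    (by
      simp only [star_smul, star_star, smul_mul_smul_comm, ← Finset.smul_sum, norm_smul]
      norm_num
      linarith)
    (by
      simp only [star_smul, star_star, smul_mul_smul_comm, smul_comm _ (_ * _ : ℂ), ← Finset.smul_sum]
      rw [norm_smul]
      have : ‖(2⁻¹ * star (2⁻¹:ℂ) : ℂ)‖ = 1/4 := by norm_num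
      rw [this]
      simp only [Complex.ofReal_inv] at hb2 ⊢
      linarith)
  have hVs : ∀ j, V (c j ⊗ₜ d j) = 8 * V (((2⁻¹:ℂ) • a' j) ⊗ₜ ((2⁻¹ : ℂ) • star (b' j))) := by
    intro j
    have e1 : V (c j ⊗ₜ d j) = V (a' j ⊗ₜ d j) := by
      rw [← sub_eq_zero, ← map_sub, ← TensorProduct.sub_tmul]
      exact hV1 _ _ (by rw [map_sub, ha, sub_self])
    have e2 : V (a' j ⊗ₜ d j) = 2 * V (a' j ⊗ₜ star (b' j)) := by
      rw [← smul_eq_mul, ← map_smul, ← TensorProduct.tmul_smul, ← sub_eq_zero, ← map_sub, ← TensorProduct.tmul_sub]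
      refine hV2 _ _ ?_
      rw [map_sub, map_smul, map_star, hb, map_smul, map_star, star_smul, star_star, smul_smul]
      norm_num
    rw [e1, e2, TensorProduct.smul_tmul_smul, map_smul, smul_eq_mul]
    ring
  simp only [hVs, ← Finset.mul_sum]
  rw [norm_mul]
  have h8 : ‖(8:ℂ)‖ = 8 := by norm_num
  rw [h8]
  linarith

end SecP10

section SecP11
section Diag
open Submodule

lemma diag_L1 {L : Type*} [NormedAddCommGroup L] [InnerProductSpace ℂ L] [CompleteSpace L]
    {𝓕 𝓖 : Type*} {r : ℕ} (C : 𝓕 → L) (D : 𝓖 → L) (φ : 𝓕 → Fin r → ℂ) (ψ : 𝓖 → Fin r → ℂ)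
    (h : ∀ f g, inner ℂ (C f) (D g) = ∑ j, φ f j * ψ g j)
    (hφ : span ℂ (Set.range φ) = ⊤) (hψ : span ℂ (Set.range ψ) = ⊤) :
    ∃ x : Fin r → L, LinearIndependent ℂ x ∧ (∀ f j, inner ℂ (C f) (x j) = φ f j) ∧
      ∀ g, ∀ v ∈ span ℂ (Set.range x), inner ℂ v (D g) = ∑ j, ψ g j * inner ℂ v (x j) := by
  set Q : Submodule ℂ L := (span ℂ (Set.range C)).topologicalClosure with hQ
  haveI : CompleteSpace Q := by
    rw [hQ]; exact (isClosed_topologicalClosure _).completeSpace_coe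
  have hCQ : ∀ f, C f ∈ Q := fun f => le_topologicalClosure _ (subset_span ⟨f, rfl⟩)
  have hP : ∀ v ∈ Q, ∀ w, inner ℂ v (Q.starProjection w) = inner ℂ v w := by
    intro v hv w
    rw [← inner_starProjection_left_eq_right, starProjection_eq_self_iff.2 hv]
  have hsep : ∀ v ∈ Q, (∀ f, inner ℂ (C f) v = 0) → v = 0 := by
    intro v hv hf
    have h1 : ∀ w ∈ Q, inner ℂ w v = 0 := by
      have hcl : IsClosed {w : L | inner ℂ w v = 0} :=
        isClosed_eq (by fun_prop) continuous_const
      have hs : ((span ℂ (Set.range C) : Submodule ℂ L) : Set L) ⊆ {w : L | inner ℂ w v = 0} := by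
        intro w hw
        induction hw using span_induction with
        | mem w hw => obtain ⟨f, rfl⟩ := hw; exact hf f
        | zero => simp
        | add a b _ _ ha hb => simp only [Set.mem_setOf_eq] at *; rw [inner_add_left, ha, hb, add_zero]
        | smul c a _ ha => simp only [Set.mem_setOf_eq] at *; rw [inner_smul_left, ha, mul_zero]
      intro w hw
      exact closure_minimal hs hcl hw
    exact inner_self_eq_zero.1 (h1 v hv)
  have hex : ∀ y : Fin r → ℂ, ∃ x ∈ Q, ∀ f, inner ℂ (C f) x = ∑ j, φ f j * y j := by
    intro y
    have hy : y ∈ span ℂ (Set.range ψ) := hψ ▸ mem_top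
    induction hy using span_induction with
    | mem w hw =>
      obtain ⟨g, rfl⟩ := hw
      exact ⟨Q.starProjection (D g), starProjection_apply_mem _ _, fun f => by rw [hP _ (hCQ f), h]⟩
    | zero => exact ⟨0, zero_mem _, fun f => by simp⟩
    | add a b _ _ ha hb =>
      obtain ⟨x, hx, h1⟩ := ha
      obtain ⟨x', hx', h1'⟩ := hb
      exact ⟨x + x', add_mem hx hx', fun f => by
        rw [inner_add_right, h1, h1', ← Finset.sum_add_distrib]; simp [mul_add]⟩
    | smul c a _ ha =>
      obtain ⟨x, hx, h1⟩ := ha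
      exact ⟨c • x, smul_mem _ _ hx, fun f => by
        rw [inner_smul_right, h1, Finset.mul_sum]; simp [mul_left_comm]⟩
  choose x hxQ hx using fun j => hex (Pi.single j 1)
  have hx' : ∀ f j, inner ℂ (C f) (x j) = φ f j := by
    intro f j; rw [hx]; simp [Pi.single_apply]
  refine ⟨x, ?_, hx', ?_⟩
  · rw [Fintype.linearIndependent_iff]
    intro μ hμ
    have h0 : ∀ y : Fin r → ℂ, ∑ j, y j * μ j = 0 := by
      intro y
      have hy : y ∈ span ℂ (Set.range φ) := hφ ▸ mem_top
      induction hy using span_induction with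
      | mem w hw =>
        obtain ⟨f, rfl⟩ := hw
        have := congrArg (fun v => inner ℂ (C f) v) hμ
        simp only [inner_sum, inner_smul_right, hx', inner_zero_right] at this
        simpa [mul_comm] using this
      | zero => simp
      | add a b _ _ ha hb => simp [add_mul, Finset.sum_add_distrib, ha, hb]
      | smul c a _ ha => simp [mul_assoc, ← Finset.mul_sum, ha]
    intro i
    simpa [Pi.single_apply] using h0 (Pi.single i 1)
  · intro g v hv
    have hvQ : v ∈ Q := (span_le.2 (by rintro _ ⟨j, rfl⟩; exact hxQ j)) hv
    have : Q.starProjection (D g) - ∑ j, ψ g j • x j = 0 := by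
      refine hsep _ (sub_mem (starProjection_apply_mem _ _) (sum_mem fun j _ => smul_mem _ _ (hxQ j))) ?_
      intro f
      rw [inner_sub_right, hP _ (hCQ f), h, inner_sum]
      simp [inner_smul_right, hx', mul_comm]
    rw [← hP v hvQ, sub_eq_zero.1 this, inner_sum]
    simp [inner_smul_right]

lemma diag_basis {L L' : Type*} [NormedAddCommGroup L] [InnerProductSpace ℂ L]
    [NormedAddCommGroup L'] [InnerProductSpace ℂ L'] {r : ℕ} (x : Fin r → L) (x' : Fin r → L')
    (hx : LinearIndependent ℂ x) (hx' : LinearIndependent ℂ x') :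
    ∃ (lam : Fin r → Fin r → ℂ) (τ : Fin r → ℝ), (∀ s, 0 < τ s) ∧
      Orthonormal ℂ (fun s => ∑ j, lam s j • x j) ∧
      Orthonormal ℂ (fun s => ((τ s)⁻¹ : ℂ) • ∑ j, lam s j • x' j) ∧
      (∀ i j, ∑ s, lam s i * inner ℂ (∑ k, lam s k • x k) (x j) = if i = j then 1 else 0) := by
  set bx := Module.Basis.span hx with hbx
  set bx' := Module.Basis.span hx' with hbx'
  set T := bx.equiv bx' (Equiv.refl _) with hT
  have hfr : Module.finrank ℂ (span ℂ (Set.range x)) = r := by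
    rw [Module.finrank_eq_card_basis bx, Fintype.card_fin]
  haveI : FiniteDimensional ℂ (span ℂ (Set.range x)) := bx.finiteDimensional_of_finite
  haveI : FiniteDimensional ℂ (span ℂ (Set.range x')) := bx'.finiteDimensional_of_finite
  have hS := LinearMap.isSymmetric_adjoint_comp_self T.toLinearMap
  set e := hS.eigenvectorBasis hfr with he
  have hE : ∀ s, (∑ j, bx.repr (e s) j • x j) = (e s : L) := by
    intro s
    have := congrArg (Subtype.val) (bx.sum_repr (e s))
    rw [← this]
    simp [hbx, Module.Basis.span_apply]
  have hE' : ∀ s, (∑ j, bx.repr (e s) j • x' j) = (T (e s) : L') := by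
    intro s
    have := congrArg (fun v => ((T v : span ℂ (Set.range x')) : L')) (bx.sum_repr (e s))
    rw [← this]
    have hTb : ∀ i, ((T (bx i) : span ℂ (Set.range x')) : L') = x' i := by
      intro i
      rw [hT, Module.Basis.equiv_apply, Equiv.refl_apply, hbx', Module.Basis.span_apply]
    simp only [map_sum, map_smul, coe_sum, coe_smul, hTb]
  have hpos : ∀ s, 0 < ‖T (e s)‖ := by
    intro s
    rw [norm_pos_iff]
    intro h0
    have := (LinearEquiv.map_eq_zero_iff T).1 h0
    exact e.toBasis.ne_zero s (by simpa using this)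
  have hTT : ∀ s s', inner ℂ (T (e s)) (T (e s')) = (hS.eigenvalues hfr s' : ℂ) * inner ℂ (e s) (e s') := by
    intro s s'
    have := hS.apply_eigenvectorBasis hfr s'
    have h2 : inner ℂ (e s) ((LinearMap.adjoint T.toLinearMap ∘ₗ T.toLinearMap) (e s')) = inner ℂ (T (e s)) (T (e s')) := by
      rw [LinearMap.comp_apply, LinearMap.adjoint_inner_right]; rfl
    rw [← h2, he, this, inner_smul_right]; rfl
  refine ⟨fun s j => bx.repr (e s) j, fun s => ‖T (e s)‖, hpos, ?_, ?_, ?_⟩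
  · simp only [hE]
    exact e.orthonormal.comp_linearIsometry (subtypeₗᵢ _)
  · simp only [hE']
    rw [orthonormal_iff_ite]
    intro s s'
    rw [inner_smul_left, inner_smul_right, ← coe_inner]
    split_ifs with hss
    · subst hss
      rw [inner_self_eq_norm_sq_to_K]
      have := (hpos s).ne'
      have h3 : ((‖T (e s)‖:ℝ):ℂ) ≠ 0 := by exact_mod_cast this
      simp only [map_inv₀, Complex.conj_ofReal]
      simp only [Complex.coe_algebraMap]
      field_simp
    · rw [hTT, e.inner_eq_ite, if_neg hss]; simp
  · intro i j
    simp only [hE]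
    have h1 : bx j = ∑ s, inner ℂ (e s) (bx j) • e s := (e.sum_repr' (bx j)).symm
    have h2 := congrArg (fun v => bx.repr v i) h1
    simp only [Module.Basis.repr_self, map_sum, map_smul, Finsupp.coe_finset_sum, Finset.sum_apply, Finsupp.smul_apply, smul_eq_mul] at h2
    rw [Finsupp.single_apply] at h2
    have h3 : (bx j : L) = x j := by simp [hbx, Module.Basis.span_apply]
    simp only [coe_inner, h3] at h2
    simp only [mul_comm (bx.repr _ _), ← h2, eq_comm]

end Diag

end SecP11

section SecP12
section Diag2
open Submodule

lemma diag_L2 {L L' : Type*} [NormedAddCommGroup L] [InnerProductSpace ℂ L] [CompleteSpace L]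
    [NormedAddCommGroup L'] [InnerProductSpace ℂ L'] [CompleteSpace L']
    {𝓕 𝓖 : Type*} {r : ℕ} (C : 𝓕 → L) (D : 𝓖 → L) (C' : 𝓕 → L') (D' : 𝓖 → L')
    (φ : 𝓕 → Fin r → ℂ) (ψ : 𝓖 → Fin r → ℂ)
    (h : ∀ f g, inner ℂ (C f) (D g) = ∑ j, φ f j * ψ g j)
    (h' : ∀ f g, inner ℂ (C' f) (D' g) = ∑ j, φ f j * ψ g j)
    (hφ : span ℂ (Set.range φ) = ⊤) (hψ : span ℂ (Set.range ψ) = ⊤) :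
    ∃ (lam gam : Fin r → Fin r → ℂ) (t : Fin r → ℝ), (∀ s, 0 < t s) ∧
      (∀ i j, ∑ s, lam s i * gam s j = if i = j then 1 else 0) ∧
      (∀ f, ∑ s, ‖∑ j, lam s j * φ f j‖ ^ 2 ≤ ‖C f‖ ^ 2) ∧
      (∀ f, ∑ s, t s * ‖∑ j, lam s j * φ f j‖ ^ 2 ≤ ‖C' f‖ ^ 2) ∧
      (∀ g, ∑ s, ‖∑ j, gam s j * ψ g j‖ ^ 2 ≤ ‖D g‖ ^ 2) ∧
      (∀ g, ∑ s, (t s)⁻¹ * ‖∑ j, gam s j * ψ g j‖ ^ 2 ≤ ‖D' g‖ ^ 2) := by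
  obtain ⟨x, hx, hx1, hx2⟩ := diag_L1 C D φ ψ h hφ hψ
  obtain ⟨x', hx', hx1', hx2'⟩ := diag_L1 C' D' φ ψ h' hφ hψ
  obtain ⟨lam, τ, hτ, ho, ho', hlam⟩ := diag_basis x x' hx hx'
  set gam : Fin r → Fin r → ℂ := fun s j => inner ℂ (∑ k, lam s k • x k) (x j) with hgam
  set o : Fin r → L' := fun s => ((τ s)⁻¹ : ℂ) • ∑ j, lam s j • x' j with hodef
  have hτ0 : ∀ s, ((τ s : ℝ) : ℂ) ≠ 0 := fun s => by exact_mod_cast (hτ s).ne'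
  have hxo : ∀ j, x' j = ∑ s, (gam s j * τ s) • o s := by
    intro j
    have h1 : ∀ s, (gam s j * τ s) • o s = ∑ i, (lam s i * gam s j) • x' i := by
      intro s
      rw [hodef]
      simp only [smul_smul, Finset.smul_sum]
      refine Finset.sum_congr rfl fun i _ => ?_
      congr 1
      have := hτ0 s
      field_simp
    simp only [h1]
    rw [Finset.sum_comm]
    simp only [← Finset.sum_smul]
    have : ∀ i, ∑ s, lam s i * gam s j = if i = j then 1 else 0 := fun i => hlam i j
    simp [this]
  have hox : ∀ s j, inner ℂ (o s) (x' j) = gam s j * τ s := by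
    intro s j
    rw [hxo j]
    exact ho'.inner_right_fintype _ s
  have hmem : ∀ s, (∑ j, lam s j • x j) ∈ span ℂ (Set.range x) := fun s =>
    sum_mem fun j _ => smul_mem _ _ (subset_span ⟨j, rfl⟩)
  have hmem' : ∀ s, o s ∈ span ℂ (Set.range x') := fun s =>
    smul_mem _ _ (sum_mem fun j _ => smul_mem _ _ (subset_span ⟨j, rfl⟩))
  refine ⟨lam, gam, fun s => (τ s ^ 2)⁻¹, fun s => by have := hτ s; positivity, hlam, ?_, ?_, ?_, ?_⟩
  · intro f
    refine le_trans (le_of_eq ?_) (ho.sum_inner_products_le (C f) (s := Finset.univ))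
    refine Finset.sum_congr rfl fun s _ => ?_
    rw [norm_inner_symm, inner_sum]
    simp only [inner_smul_right, hx1]
  · intro f
    refine le_trans (le_of_eq ?_) (ho'.sum_inner_products_le (C' f) (s := Finset.univ))
    refine Finset.sum_congr rfl fun s _ => ?_
    rw [norm_inner_symm, inner_smul_right, inner_sum]
    simp only [inner_smul_right, hx1']
    rw [norm_mul, mul_pow, norm_inv, Complex.norm_real, Real.norm_of_nonneg (hτ s).le, inv_pow]
  · intro g
    refine le_trans (le_of_eq ?_) (ho.sum_inner_products_le (D g) (s := Finset.univ))
    refine Finset.sum_congr rfl fun s _ => ?_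
    rw [hx2 g _ (hmem s)]
    simp only [mul_comm (ψ g _), hgam]
  · intro g
    refine le_trans (le_of_eq ?_) (ho'.sum_inner_products_le (D' g) (s := Finset.univ))
    refine Finset.sum_congr rfl fun s _ => ?_
    have : inner ℂ (o s) (D' g) = (τ s) * ∑ j, gam s j * ψ g j := by
      rw [hx2' g _ (hmem' s), Finset.mul_sum]
      refine Finset.sum_congr rfl fun j _ => ?_
      rw [hox]; ring
    change _ = ‖inner ℂ (o s) (D' g)‖ ^ 2
    rw [this, norm_mul, mul_pow, Complex.norm_real, Real.norm_of_nonneg (hτ s).le, inv_inv]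

/-- upgrade from weak to strong square sums -/
lemma sq_upgrade {H : Type*} [NormedAddCommGroup H] [InnerProductSpace ℂ H] {r : ℕ} {I : Type*}
    (w : Fin r → ℝ) (y : Fin r → H) (z : I → H) (M : ℝ)
    (hz : ∀ F : Finset I, ∑ i ∈ F, ‖z i‖ ^ 2 ≤ M)
    (h : ∀ v : H, ∑ s, w s * ‖inner ℂ v (y s)‖ ^ 2 ≤ ∑' i, ‖inner ℂ v (z i)‖ ^ 2) :
    ∑ s, w s * ‖y s‖ ^ 2 ≤ M := by
  haveI : FiniteDimensional ℂ (span ℂ (Set.range y)) := FiniteDimensional.span_of_finite ℂ (Set.finite_range y)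
  set b := stdOrthonormalBasis ℂ (span ℂ (Set.range y)) with hb
  have hbo : Orthonormal ℂ (fun k => (b k : H)) := b.orthonormal.comp_linearIsometry (subtypeₗᵢ _)
  have hy : ∀ s, ‖y s‖ ^ 2 = ∑ k, ‖inner ℂ (b k : H) (y s)‖ ^ 2 := by
    intro s
    have := b.sum_sq_norm_inner_right ⟨y s, subset_span ⟨s, rfl⟩⟩
    simpa [coe_inner] using this.symm
  have hsum : Summable fun i => ‖z i‖ ^ 2 :=
    summable_of_sum_le (fun _ => by positivity) hz
  have hsk : ∀ v : H, Summable fun i => ‖inner ℂ v (z i)‖ ^ 2 := by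
    intro v
    refine Summable.of_nonneg_of_le (fun _ => by positivity) (fun i => ?_) (hsum.mul_left (‖v‖ ^ 2))
    rw [← mul_pow]
    exact pow_le_pow_left₀ (norm_nonneg _) (norm_inner_le_norm _ _) 2
  calc ∑ s, w s * ‖y s‖ ^ 2 = ∑ k, ∑ s, w s * ‖inner ℂ (b k : H) (y s)‖ ^ 2 := by
        rw [Finset.sum_comm]
        simp only [hy, Finset.mul_sum]
    _ ≤ ∑ k, ∑' i, ‖inner ℂ (b k : H) (z i)‖ ^ 2 := Finset.sum_le_sum fun k _ => h _
    _ = ∑' i, ∑ k, ‖inner ℂ (b k : H) (z i)‖ ^ 2 := (Summable.tsum_finsetSum fun k _ => hsk _).symm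
    _ ≤ ∑' i, ‖z i‖ ^ 2 := by
        refine Summable.tsum_le_tsum (fun i => hbo.sum_inner_products_le (z i)) (summable_sum fun k _ => hsk _) hsum
    _ ≤ M := hsum.tsum_le_of_sum_le hz

lemma opsum_norm_le {H : Type*} [NormedAddCommGroup H] [InnerProductSpace ℂ H] [CompleteSpace H]
    {J : Type*} [Fintype J] (w : J → ℝ) (hw : ∀ j, 0 ≤ w j) (T : J → H →L[ℂ] H) (M : ℝ) (hM : 0 ≤ M)
    (h : ∀ v, ∑ j, w j * ‖T j v‖ ^ 2 ≤ M * ‖v‖ ^ 2) :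
    ‖∑ j, (w j : ℂ) • (star (T j) * T j)‖ ≤ M := by
  have hinn : ∀ v, inner ℂ ((∑ j, (w j : ℂ) • (star (T j) * T j)) v) v = ((∑ j, w j * ‖T j v‖ ^ 2 : ℝ) : ℂ) := by
    intro v
    simp only [ContinuousLinearMap.sum_apply, sum_inner, Complex.ofReal_sum]
    refine Finset.sum_congr rfl fun j _ => ?_
    rw [ContinuousLinearMap.smul_apply, inner_smul_left, ContinuousLinearMap.mul_apply,
      ContinuousLinearMap.star_eq_adjoint, ContinuousLinearMap.adjoint_inner_left, inner_self_eq_norm_sq_to_K]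
    simp
  have h0 : ∀ j (r : ℝ), 0 ≤ r → 0 ≤ (r : ℂ) • (star (T j) * T j) := by
    intro j r hr
    rw [Complex.coe_smul]
    exact smul_nonneg hr (star_mul_self_nonneg _)
  have hS : 0 ≤ ∑ j, (w j : ℂ) • (star (T j) * T j) := Finset.sum_nonneg fun j _ => h0 j _ (hw j)
  have hle : ∑ j, (w j : ℂ) • (star (T j) * T j) ≤ (M : ℂ) • (1 : H →L[ℂ] H) := by
    rw [ContinuousLinearMap.le_def]
    rw [ContinuousLinearMap.isPositive_iff_complex]
    intro v
    have : inner ℂ (((M:ℂ) • (1 : H →L[ℂ] H) - ∑ j, (w j : ℂ) • (star (T j) * T j)) v) v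
       = ((M * ‖v‖ ^ 2 - ∑ j, w j * ‖T j v‖ ^ 2 : ℝ) : ℂ) := by
      rw [ContinuousLinearMap.sub_apply, inner_sub_left, hinn, ContinuousLinearMap.smul_apply, inner_smul_left,
        ContinuousLinearMap.one_apply, inner_self_eq_norm_sq_to_K]
      push_cast
      simp
    rw [this]
    exact ⟨by rw [RCLike.re_eq_complex_re, Complex.ofReal_re], by rw [RCLike.re_eq_complex_re, Complex.ofReal_re]; exact sub_nonneg.2 (h v)⟩
  refine (CStarAlgebra.norm_le_norm_of_nonneg_of_le hS hle).trans ?_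
  rw [norm_smul, Complex.norm_real, Real.norm_of_nonneg hM]
  exact mul_le_of_le_one_right hM (ContinuousLinearMap.norm_id_le)

end Diag2

end SecP12

section SecP13
section Core
open Submodule

variable {A B : Type u} [NonUnitalCStarAlgebra A] [NonUnitalCStarAlgebra B]
    {H₁ H₂ : Type*} [NormedAddCommGroup H₁] [InnerProductSpace ℂ H₁] [CompleteSpace H₁]
    [NormedAddCommGroup H₂] [InnerProductSpace ℂ H₂] [CompleteSpace H₂]

lemma jcb_vec
    (NA : ∀ p : ℕ, Matrix (Fin p) (Fin p) A → ℝ)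
    (NB : ∀ q : ℕ, Matrix (Fin q) (Fin q) B → ℝ)
    (hNA : ∀ p, IsCStarNorm (NA p)) (hNB : ∀ q, IsCStarNorm (NB q))
    (π₁ : A →⋆ₙₐ[ℂ] (H₁ →L[ℂ] H₁)) (π₂ : B →⋆ₙₐ[ℂ] (H₂ →L[ℂ] H₂))
    (V : A ⊗[ℂ] B →ₗ[ℂ] ℂ) (hV : ∀ u, ‖V u‖ ≤ osProjNorm NA NB u)
    (hV1 : ∀ a b, π₁ a = 0 → V (a ⊗ₜ b) = 0) (hV2 : ∀ a b, π₂ b = 0 → V (a ⊗ₜ b) = 0)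
    {J : Type} [Fintype J] (c : J → A) (d : J → B) (t : J → ℝ) (ht : ∀ j, 0 < t j)
    (M : ℝ) (hM : 0 < M)
    (h1 : ∀ v, ∑ j, ‖star (π₁ (c j)) v‖ ^ 2 ≤ M * ‖v‖ ^ 2)
    (h2 : ∀ v, ∑ j, t j * ‖π₁ (c j) v‖ ^ 2 ≤ M * ‖v‖ ^ 2)
    (h3 : ∀ v, ∑ j, ‖π₂ (d j) v‖ ^ 2 ≤ M * ‖v‖ ^ 2)
    (h4 : ∀ v, ∑ j, (t j)⁻¹ * ‖star (π₂ (d j)) v‖ ^ 2 ≤ M * ‖v‖ ^ 2) :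
    ‖∑ j, V (c j ⊗ₜ d j)‖ ≤ 12872 * M := by
  set k : ℂ := (((√M)⁻¹ : ℝ) : ℂ) with hk
  have hkM : ‖k‖ ^ 2 * M = 1 := by
    rw [hk, Complex.norm_real, Real.norm_of_nonneg (by positivity), inv_pow, Real.sq_sqrt hM.le]
    field_simp
  have hkk : star k * k = ((M⁻¹:ℝ):ℂ) := by
    rw [hk, Complex.star_def, Complex.conj_ofReal, ← Complex.ofReal_mul, ← mul_inv, Real.mul_self_sqrt hM.le]
  have hkk' : k * k = ((M⁻¹:ℝ):ℂ) := by
    rw [hk, ← Complex.ofReal_mul, ← mul_inv, Real.mul_self_sqrt hM.le]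
  have hs : ∀ x : ℝ, x ^ 2 ≤ M → True := fun _ _ => trivial
  have hbd : ∀ {y : ℝ} {z : ℝ}, y ≤ M * z → ‖k‖ ^ 2 * y ≤ 1 * z := by
    intro y z h
    have := mul_le_mul_of_nonneg_left h (sq_nonneg ‖k‖)
    rwa [← mul_assoc, hkM] at this
  have key := jcb_combine NA NB hNA hNB π₁ π₂ V hV hV1 hV2 (fun j => k • c j) (fun j => k • d j) t ht
    (by
      have := opsum_norm_le (fun _ : J => (1:ℝ)) (fun _ => zero_le_one) (fun j => star (π₁ (k • c j))) 1 zero_le_one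
        (fun v => by
          refine le_trans (le_of_eq ?_) (hbd (h1 v))
          rw [Finset.mul_sum]
          refine Finset.sum_congr rfl fun j _ => ?_
          rw [map_smul, star_smul, ContinuousLinearMap.smul_apply, norm_smul, norm_star, one_mul, mul_pow])
      simpa only [star_star, Complex.ofReal_one, one_smul] using this)
    (by
      exact opsum_norm_le t (fun j => (ht j).le) (fun j => (π₁ (k • c j))) 1 zero_le_one
        (fun v => by
          refine le_trans (le_of_eq ?_) (hbd (h2 v))
          rw [Finset.mul_sum]
          refine Finset.sum_congr rfl fun j _ => ?_
          rw [map_smul, ContinuousLinearMap.smul_apply, norm_smul, mul_pow]; ring))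
    (by
      have := opsum_norm_le (fun _ : J => (1:ℝ)) (fun _ => zero_le_one) (fun j => (π₂ (k • d j))) 1 zero_le_one
        (fun v => by
          refine le_trans (le_of_eq ?_) (hbd (h3 v))
          rw [Finset.mul_sum]
          refine Finset.sum_congr rfl fun j _ => ?_
          rw [map_smul, ContinuousLinearMap.smul_apply, norm_smul, one_mul, mul_pow])
      simpa only [star_star, Complex.ofReal_one, one_smul] using this)
    (by
      have := opsum_norm_le (fun j => (t j)⁻¹) (fun j => (inv_pos.2 (ht j)).le) (fun j => star (π₂ (k • d j))) 1 zero_le_one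
        (fun v => by
          refine le_trans (le_of_eq ?_) (hbd (h4 v))
          rw [Finset.mul_sum]
          refine Finset.sum_congr rfl fun j _ => ?_
          rw [map_smul, star_smul, ContinuousLinearMap.smul_apply, norm_smul, norm_star, mul_pow]; ring)
      simpa only [star_star] using this)
  have : ∀ j, V ((k • c j) ⊗ₜ (k • d j)) = ((M⁻¹:ℝ):ℂ) * V (c j ⊗ₜ d j) := by
    intro j
    rw [TensorProduct.smul_tmul_smul, map_smul, hkk', smul_eq_mul]
  simp only [this, ← Finset.mul_sum] at key
  rw [norm_mul, Complex.norm_real, Real.norm_of_nonneg (by positivity), inv_mul_le_iff₀ hM] at key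
  linarith

lemma mkl2 {I : Type*} (z : I → ℂ) (hz : Summable fun i => ‖z i‖ ^ 2) :
    ∃ y : lp (fun _ : I => ℂ) 2, (∀ i, y i = z i) ∧ ‖y‖ ^ 2 = ∑' i, ‖z i‖ ^ 2 := by
  have hm : Memℓp z 2 := by
    rw [memℓp_gen_iff (by norm_num)]
    simpa using hz
  refine ⟨⟨z, hm⟩, fun i => rfl, ?_⟩
  have := lp.norm_rpow_eq_tsum (p := 2) (by norm_num) (⟨z, hm⟩ : lp (fun _ : I => ℂ) 2)
  simpa using this

lemma opspan_top {H : Type*} [NormedAddCommGroup H] [InnerProductSpace ℂ H] {r : ℕ} (a : Fin r → (H →L[ℂ] H))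
    (ha : LinearIndependent ℂ a) :
    span ℂ (Set.range (fun f : H × H => fun j => inner ℂ f.2 (a j f.1))) = ⊤ := by
  by_contra hne
  obtain ⟨g, hg, hle⟩ := exists_le_ker_of_lt_top _ (lt_top_iff_ne_top.2 hne)
  apply hg
  have hgf : ∀ y, g y = ∑ j, y j * g (Pi.single j 1) := by
    intro y
    have e : y = ∑ j, y j • (Pi.single j (1:ℂ) : Fin r → ℂ) := by
      ext i; simp [Finset.sum_apply, Pi.single_apply]
    conv_lhs => rw [e]
    simp only [map_sum, map_smul, smul_eq_mul]
  have h0 : ∑ j, g (Pi.single j 1) • a j = 0 := by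
    ext θ
    refine ext_inner_left ℂ fun θ' => ?_
    have := hle (subset_span ⟨(θ, θ'), rfl⟩)
    rw [LinearMap.mem_ker, hgf] at this
    simp only [ContinuousLinearMap.sum_apply, ContinuousLinearMap.smul_apply, inner_sum, inner_smul_right,
      ContinuousLinearMap.zero_apply, inner_zero_right]
    simpa [mul_comm] using this
  have h1 := Fintype.linearIndependent_iff.1 ha _ h0
  ext j
  simp [h1]

lemma sumb {H : Type*} [NormedAddCommGroup H] [InnerProductSpace ℂ H] {K : Type*} (z : K → H) (N : ℝ)
      (hz : ∀ F : Finset K, ∑ i ∈ F, ‖z i‖ ^ 2 ≤ N) (v : H) : Summable fun i => ‖inner ℂ v (z i)‖ ^ 2 := by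
  have hsum : Summable fun i => ‖z i‖ ^ 2 :=
    summable_of_sum_le (fun _ => by positivity) hz
  refine Summable.of_nonneg_of_le (fun _ => by positivity) (fun i => ?_) (hsum.mul_left (‖v‖ ^ 2))
  rw [← mul_pow]
  exact pow_le_pow_left₀ (norm_nonneg _) (norm_inner_le_norm _ _) 2

lemma inj_core
    (NA : ∀ p : ℕ, Matrix (Fin p) (Fin p) A → ℝ)
    (NB : ∀ q : ℕ, Matrix (Fin q) (Fin q) B → ℝ)
    (hNA : ∀ p, IsCStarNorm (NA p)) (hNB : ∀ q, IsCStarNorm (NB q))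
    (π₁ : A →⋆ₙₐ[ℂ] (H₁ →L[ℂ] H₁)) (π₂ : B →⋆ₙₐ[ℂ] (H₂ →L[ℂ] H₂))
    (V : A ⊗[ℂ] B →ₗ[ℂ] ℂ) (hV : ∀ u, ‖V u‖ ≤ osProjNorm NA NB u)
    (hV1 : ∀ a b, π₁ a = 0 → V (a ⊗ₜ b) = 0) (hV2 : ∀ a b, π₂ b = 0 → V (a ⊗ₜ b) = 0)
    {I I' : Type*} (c : I → (H₁ →L[ℂ] H₁)) (d : I → (H₂ →L[ℂ] H₂))
    (c' : I' → (H₁ →L[ℂ] H₁)) (d' : I' → (H₂ →L[ℂ] H₂)) (M : ℝ) (hM : 0 < M)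
    (hc : ∀ v, ∀ F : Finset I, ∑ i ∈ F, ‖star (c i) v‖ ^ 2 ≤ M * ‖v‖ ^ 2)
    (hd : ∀ v, ∀ F : Finset I, ∑ i ∈ F, ‖d i v‖ ^ 2 ≤ M * ‖v‖ ^ 2)
    (hc' : ∀ v, ∀ F : Finset I', ∑ i ∈ F, ‖c' i v‖ ^ 2 ≤ M * ‖v‖ ^ 2)
    (hd' : ∀ v, ∀ F : Finset I', ∑ i ∈ F, ‖star (d' i) v‖ ^ 2 ≤ M * ‖v‖ ^ 2)
    {r : ℕ} (a : Fin r → A) (b : Fin r → B)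
    (ha : LinearIndependent ℂ (fun j => π₁ (a j))) (hb : LinearIndependent ℂ (fun j => π₂ (b j)))
    (hs : ∀ θ θ' ζ ζ', ∑' i, inner ℂ θ' (c i θ) * inner ℂ ζ' (d i ζ) = ∑ j, inner ℂ θ' (π₁ (a j) θ) * inner ℂ ζ' (π₂ (b j) ζ))
    (hs' : ∀ θ θ' ζ ζ', ∑' i, inner ℂ θ' (c' i θ) * inner ℂ ζ' (d' i ζ) = ∑ j, inner ℂ θ' (π₁ (a j) θ) * inner ℂ ζ' (π₂ (b j) ζ)) :
    ‖∑ j, V (a j ⊗ₜ b j)‖ ≤ 12872 * M := by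
  have s1 : ∀ f : H₁ × H₁, Summable fun i => ‖inner ℂ (c i f.1) f.2‖ ^ 2 := fun f => by
    have := sumb (fun i => star (c i) f.2) _ (hc f.2) f.1
    simpa only [ContinuousLinearMap.star_eq_adjoint, ContinuousLinearMap.adjoint_inner_right] using this
  have s2 : ∀ f : H₁ × H₁, Summable fun i => ‖inner ℂ (c' i f.1) f.2‖ ^ 2 := fun f => by
    have := sumb (fun i => c' i f.1) _ (hc' f.1) f.2
    simpa only [norm_inner_symm] using this
  have s3 : ∀ f : H₂ × H₂, Summable fun i => ‖inner ℂ f.2 (d i f.1)‖ ^ 2 := fun f => sumb (fun i => d i f.1) _ (hd f.1) f.2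
  have s4 : ∀ f : H₂ × H₂, Summable fun i => ‖inner ℂ f.2 (d' i f.1)‖ ^ 2 := fun f => by
    have := sumb (fun i => star (d' i) f.2) _ (hd' f.2) f.1
    simp only [ContinuousLinearMap.star_eq_adjoint, ContinuousLinearMap.adjoint_inner_right] at this
    refine this.congr fun i => ?_
    rw [norm_inner_symm]
  choose C hC hCn using fun f => mkl2 _ (s1 f)
  choose C' hC' hCn' using fun f => mkl2 _ (s2 f)
  choose D hD hDn using fun f => mkl2 _ (s3 f)
  choose D' hD' hDn' using fun f => mkl2 _ (s4 f)
  obtain ⟨lam, gam, t, ht, hlg, b1, b2, b3, b4⟩ := diag_L2 C D C' D'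
    (fun f : H₁ × H₁ => fun j => inner ℂ f.2 (π₁ (a j) f.1)) (fun f : H₂ × H₂ => fun j => inner ℂ f.2 (π₂ (b j) f.1))
    (fun f g => by
      rw [← hs, lp.inner_eq_tsum]
      refine tsum_congr fun i => ?_
      rw [hC, hD, RCLike.inner_apply, inner_conj_symm, mul_comm])
    (fun f g => by
      rw [← hs', lp.inner_eq_tsum]
      refine tsum_congr fun i => ?_
      rw [hC', hD', RCLike.inner_apply, inner_conj_symm, mul_comm])
    (opspan_top _ ha) (opspan_top _ hb)
  simp only [hCn, hDn, hCn', hDn'] at b1 b2 b3 b4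
  set p : Fin r → A := fun s => ∑ j, lam s j • a j with hp
  set q : Fin r → B := fun s => ∑ j, gam s j • b j with hq
  have ep : ∀ (f : H₁ × H₁) s, ∑ j, lam s j * inner ℂ f.2 (π₁ (a j) f.1) = inner ℂ f.2 (π₁ (p s) f.1) := by
    intro f s
    simp only [hp, map_sum, map_smul, ContinuousLinearMap.sum_apply, ContinuousLinearMap.smul_apply, inner_sum, inner_smul_right]
  have eq : ∀ (f : H₂ × H₂) s, ∑ j, gam s j * inner ℂ f.2 (π₂ (b j) f.1) = inner ℂ f.2 (π₂ (q s) f.1) := by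
    intro f s
    simp only [hq, map_sum, map_smul, ContinuousLinearMap.sum_apply, ContinuousLinearMap.smul_apply, inner_sum, inner_smul_right]
  simp only [ep] at b1 b2
  simp only [eq] at b3 b4
  have key := jcb_vec NA NB hNA hNB π₁ π₂ V hV hV1 hV2 p q t ht M hM
    (fun v => by
      have := sq_upgrade (fun _ => 1) (fun s => star (π₁ (p s)) v) (fun i => star (c i) v) _ (hc v) (fun w => by
        refine le_trans (le_of_eq ?_) ((b1 (w, v)).trans (le_of_eq ?_))
        · refine Finset.sum_congr rfl fun s _ => ?_
          rw [one_mul, ContinuousLinearMap.star_eq_adjoint, ContinuousLinearMap.adjoint_inner_right, norm_inner_symm]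
        · refine tsum_congr fun i => ?_
          rw [ContinuousLinearMap.star_eq_adjoint, ContinuousLinearMap.adjoint_inner_right])
      simpa only [one_mul] using this)
    (fun v => sq_upgrade t (fun s => π₁ (p s) v) (fun i => c' i v) _ (hc' v) (fun w => by
        refine le_trans (le_of_eq ?_) ((b2 (v, w)).trans (le_of_eq ?_))
        · rfl
        · refine tsum_congr fun i => ?_
          rw [norm_inner_symm]))
    (fun v => by
      have := sq_upgrade (fun _ => 1) (fun s => π₂ (q s) v) (fun i => d i v) _ (hd v) (fun w => by
        refine le_trans (le_of_eq ?_) ((b3 (v, w)))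
        simp only [one_mul])
      simpa only [one_mul] using this)
    (fun v => sq_upgrade (fun s => (t s)⁻¹) (fun s => star (π₂ (q s)) v) (fun i => star (d' i) v) _ (hd' v) (fun w => by
        refine le_trans (le_of_eq ?_) ((b4 (w, v)).trans (le_of_eq ?_))
        · refine Finset.sum_congr rfl fun s _ => ?_
          rw [ContinuousLinearMap.star_eq_adjoint, ContinuousLinearMap.adjoint_inner_right, norm_inner_symm]
        · refine tsum_congr fun i => ?_
          rw [ContinuousLinearMap.star_eq_adjoint, ContinuousLinearMap.adjoint_inner_right, norm_inner_symm]))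
  refine le_trans (le_of_eq ?_) key
  congr 1
  have e1 : ∀ s, V (p s ⊗ₜ q s) = ∑ i, ∑ j, (lam s i * gam s j) * V (a i ⊗ₜ b j) := by
    intro s
    simp only [hp, hq, TensorProduct.sum_tmul, TensorProduct.tmul_sum, map_sum, TensorProduct.smul_tmul_smul, map_smul, smul_eq_mul]
    exact Finset.sum_comm
  simp only [e1]
  rw [Finset.sum_comm]
  refine Finset.sum_congr rfl fun i _ => ?_
  rw [Finset.sum_comm]
  simp only [← Finset.sum_mul, hlg]
  simp

end Core

end SecP13

section SecP14
section Decomp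

/-- amplification of a representation to matrices -/
def opMat {A : Type*} [NonUnitalCStarAlgebra A] [PartialOrder A] [StarOrderedRing A]
    {H : Type*} [NormedAddCommGroup H] [InnerProductSpace ℂ H] [CompleteSpace H]
    (π : A →⋆ₙₐ[ℂ] (H →L[ℂ] H)) (p : ℕ) :
    CStarMatrix (Fin p) (Fin p) A →⋆ₙₐ[ℂ] (PiLp 2 (fun _ : Fin p => H) →L[ℂ] PiLp 2 (fun _ : Fin p => H)) where
  toFun v := (PiLp.continuousLinearEquiv 2 ℂ (fun _ : Fin p => H)).symm.toContinuousLinearMap ∘L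
    (ContinuousLinearMap.pi fun i => ∑ j, (π (v i j)) ∘L PiLp.proj 2 (fun _ : Fin p => H) j)
  map_smul' c v := by
    ext x i; simp [CStarMatrix.smul_apply, Finset.smul_sum]
  map_zero' := by ext x i; simp
  map_add' v w := by
    ext x i; simp [CStarMatrix.add_apply, Finset.sum_add_distrib]
  map_mul' v w := by
    ext x i
    simp [CStarMatrix.mul_apply, ContinuousLinearMap.sum_apply]
    rw [Finset.sum_comm]
  map_star' v := by
    rw [ContinuousLinearMap.star_eq_adjoint, ContinuousLinearMap.eq_adjoint_iff]
    intro x y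
    simp [PiLp.inner_apply, sum_inner, inner_sum, CStarMatrix.star_apply, ContinuousLinearMap.sum_apply, map_star,
      ContinuousLinearMap.star_eq_adjoint, ContinuousLinearMap.adjoint_inner_left]
    rw [Finset.sum_comm]

lemma opMat_bound {A : Type*} [NonUnitalCStarAlgebra A]
    {H : Type*} [NormedAddCommGroup H] [InnerProductSpace ℂ H] [CompleteSpace H]
    (π : A →⋆ₙₐ[ℂ] (H →L[ℂ] H)) {p : ℕ} {N : Matrix (Fin p) (Fin p) A → ℝ} (hN : IsCStarNorm N)
    (v : Matrix (Fin p) (Fin p) A) (x : Fin p → H) :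
    ∑ i, ‖∑ j, π (v i j) (x j)‖ ^ 2 ≤ N v ^ 2 * ∑ j, ‖x j‖ ^ 2 := by
  letI : PartialOrder A := CStarAlgebra.spectralOrder A
  haveI : StarOrderedRing A := CStarAlgebra.spectralOrderedRing A
  have h1 := NonUnitalStarAlgHom.norm_apply_le (opMat π p) (CStarMatrix.ofMatrix v)
  rw [← matnorm_eq hN] at h1
  have h2 := (opMat π p (CStarMatrix.ofMatrix v)).le_of_opNorm_le h1 (WithLp.toLp 2 x)
  have h3 := pow_le_pow_left₀ (norm_nonneg _) h2 2
  rw [mul_pow, PiLp.norm_sq_eq_of_L2, PiLp.norm_sq_eq_of_L2] at h3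
  refine le_trans (le_of_eq ?_) h3
  refine Finset.sum_congr rfl fun i _ => ?_
  simp [opMat, ContinuousLinearMap.sum_apply]

lemma opMat_bound' {A : Type*} [NonUnitalCStarAlgebra A]
    {H : Type*} [NormedAddCommGroup H] [InnerProductSpace ℂ H] [CompleteSpace H]
    (π : A →⋆ₙₐ[ℂ] (H →L[ℂ] H)) {p : ℕ} {N : Matrix (Fin p) (Fin p) A → ℝ} (hN : IsCStarNorm N)
    (v : Matrix (Fin p) (Fin p) A) (x : Fin p → H) :
    ∑ j, ‖∑ i, star (π (v i j)) (x i)‖ ^ 2 ≤ N v ^ 2 * ∑ j, ‖x j‖ ^ 2 := by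
  have := opMat_bound π hN (star v) x
  rw [hN.star] at this
  simpa only [Matrix.star_apply, map_star] using this

lemma scale_exists (P Q δ : ℝ) (hP : 0 ≤ P) (hQ : 0 ≤ Q) (hδ : 0 < δ) (h : P * Q ≤ δ ^ 2) :
    ∃ x : ℝ, 0 < x ∧ x⁻¹ ^ 2 * P ≤ δ ∧ x ^ 2 * Q ≤ δ := by
  rcases hP.eq_or_lt with h0 | h0
  · refine ⟨√(δ / (Q + 1)), by positivity, by rw [← h0]; simp [hδ.le], ?_⟩
    rw [Real.sq_sqrt (by positivity), div_mul_eq_mul_div, div_le_iff₀ (by positivity)]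
    nlinarith
  · refine ⟨√(P / δ), by positivity, ?_, ?_⟩
    · rw [inv_pow, Real.sq_sqrt (by positivity)]
      apply le_of_eq; field_simp
    · rw [Real.sq_sqrt (by positivity), div_mul_eq_mul_div, div_le_iff₀ (by positivity)]
      nlinarith

lemma osProj_rep {A B : Type u} [NonUnitalCStarAlgebra A] [NonUnitalCStarAlgebra B]
    (NA : ∀ p : ℕ, Matrix (Fin p) (Fin p) A → ℝ)
    (NB : ∀ q : ℕ, Matrix (Fin q) (Fin q) B → ℝ) (u : A ⊗[ℂ] B) (δ : ℝ) (h : osProjNorm NA NB u < δ) :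
    ∃ (p q : ℕ) (α : Fin p × Fin q → ℂ) (v : Matrix (Fin p) (Fin p) A)
      (w : Matrix (Fin q) (Fin q) B) (β : Fin p × Fin q → ℂ),
      u = ∑ ik : Fin p × Fin q, ∑ jl : Fin p × Fin q,
            (α ik * β jl) • (v ik.1 jl.1 ⊗ₜ[ℂ] w ik.2 jl.2) ∧
      Real.sqrt (∑ ik, ‖α ik‖ ^ 2) * NA p v * NB q w *
            Real.sqrt (∑ jl, ‖β jl‖ ^ 2) < δ := by
  obtain ⟨r, ⟨p, q, α, v, w, β, h1, h2⟩, hr⟩ := exists_lt_of_csInf_lt (by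
    obtain ⟨n, a, b, hu⟩ := TensorProduct.exists_sum_tmul_eq u
    refine ⟨_, n, n, fun ik => if ik.1 = ik.2 then 1 else 0, Matrix.diagonal a, Matrix.diagonal b,
      fun ik => if ik.1 = ik.2 then 1 else 0, ?_, rfl⟩
    rw [hu]
    simp only [Fintype.sum_prod_type]
    simp [Matrix.diagonal_apply, ite_and, Finset.sum_ite_eq]
    refine Finset.sum_congr rfl fun i _ => ?_
    rw [Finset.sum_eq_single i]
    · simp
    · intro k _ hk; simp [Ne.symm hk]
    · simp
    ) h
  exact ⟨p, q, α, v, w, β, h1, h2 ▸ hr⟩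


lemma row_sum_bound {E : Type*} [NormedAddCommGroup E] [NormedSpace ℂ E] {p q : ℕ} (α : Fin p × Fin q → ℂ) (x : E) :
    ∑ k, ∑ i, ‖α (i, k) • x‖ ^ 2 = (∑ ik, ‖α ik‖ ^ 2) * ‖x‖ ^ 2 := by
  rw [Finset.sum_comm, Fintype.sum_prod_type, Finset.sum_mul]
  refine Finset.sum_congr rfl fun i _ => ?_
  rw [Finset.sum_mul]
  simp [norm_smul, mul_pow]

lemma col_sum_bound {E : Type*} [NormedAddCommGroup E] [NormedSpace ℂ E] {p q : ℕ} (α : Fin p × Fin q → ℂ) (x : E) :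
    ∑ j, ∑ l, ‖α (j, l) • x‖ ^ 2 = (∑ ik, ‖α ik‖ ^ 2) * ‖x‖ ^ 2 := by
  rw [Finset.sum_comm, row_sum_bound]

lemma sum_rev3 {α β γ M : Type*} [Fintype α] [Fintype β] [Fintype γ] [AddCommMonoid M] (g : α → β → γ → M) :
    ∑ a, ∑ b, ∑ c, g a b c = ∑ c, ∑ b, ∑ a, g a b c := by
  calc ∑ a, ∑ b, ∑ c, g a b c = ∑ a, ∑ c, ∑ b, g a b c := Finset.sum_congr rfl fun a _ => Finset.sum_comm
    _ = ∑ c, ∑ a, ∑ b, g a b c := Finset.sum_comm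
    _ = ∑ c, ∑ b, ∑ a, g a b c := Finset.sum_congr rfl fun a _ => Finset.sum_comm

lemma osProj_decomp {A B : Type u} [NonUnitalCStarAlgebra A] [NonUnitalCStarAlgebra B]
    {H₁ H₂ : Type*} [NormedAddCommGroup H₁] [InnerProductSpace ℂ H₁] [CompleteSpace H₁]
    [NormedAddCommGroup H₂] [InnerProductSpace ℂ H₂] [CompleteSpace H₂]
    (NA : ∀ p : ℕ, Matrix (Fin p) (Fin p) A → ℝ)
    (NB : ∀ q : ℕ, Matrix (Fin q) (Fin q) B → ℝ)
    (hNA : ∀ p, IsCStarNorm (NA p)) (hNB : ∀ q, IsCStarNorm (NB q))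
    (π₁ : A →⋆ₙₐ[ℂ] (H₁ →L[ℂ] H₁)) (π₂ : B →⋆ₙₐ[ℂ] (H₂ →L[ℂ] H₂))
    (u : A ⊗[ℂ] B) (δ : ℝ) (hδ : 0 < δ) (h : osProjNorm NA NB u < δ) :
    ∃ (p q : ℕ) (c c' : Fin p × Fin q → A) (d d' : Fin p × Fin q → B),
      u = ∑ i, c i ⊗ₜ d i ∧ u = ∑ i, c' i ⊗ₜ d' i ∧
      (∀ v, ∑ i, ‖star (π₁ (c i)) v‖ ^ 2 ≤ δ * ‖v‖ ^ 2) ∧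
      (∀ v, ∑ i, ‖π₂ (d i) v‖ ^ 2 ≤ δ * ‖v‖ ^ 2) ∧
      (∀ v, ∑ i, ‖π₁ (c' i) v‖ ^ 2 ≤ δ * ‖v‖ ^ 2) ∧
      (∀ v, ∑ i, ‖star (π₂ (d' i)) v‖ ^ 2 ≤ δ * ‖v‖ ^ 2) := by
  obtain ⟨p, q, α, v, w, β, hu, hr⟩ := osProj_rep NA NB u δ h
  set a := ∑ ik, ‖α ik‖ ^ 2 with ha
  set b := ∑ ik, ‖β ik‖ ^ 2 with hb
  have ha0 : 0 ≤ a := Finset.sum_nonneg fun _ _ => by positivity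
  have hb0 : 0 ≤ b := Finset.sum_nonneg fun _ _ => by positivity
  have hv0 := (hNA p).nonneg v
  have hw0 := (hNB q).nonneg w
  have hr2 : (√a * NA p v * NB q w * √b) ^ 2 ≤ δ ^ 2 := pow_le_pow_left₀ (by positivity) hr.le 2
  rw [mul_pow, mul_pow, mul_pow, Real.sq_sqrt ha0, Real.sq_sqrt hb0] at hr2
  obtain ⟨x, hx0, hx1, hx2⟩ := scale_exists (NA p v ^ 2 * a) (NB q w ^ 2 * b) δ (by positivity) (by positivity) hδ (by linarith)
  obtain ⟨y, hy0, hy1, hy2⟩ := scale_exists (NA p v ^ 2 * b) (NB q w ^ 2 * a) δ (by positivity) (by positivity) hδ (by linarith)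
  have hx0' : ((x:ℝ):ℂ) ≠ 0 := by exact_mod_cast hx0.ne'
  have hy0' : ((y:ℝ):ℂ) ≠ 0 := by exact_mod_cast hy0.ne'
  have hmul : ∀ {x P : ℝ} {z y : ℝ}, x ^ 2 * P ≤ δ → z ≤ P * y → 0 ≤ y → x ^ 2 * z ≤ δ * y := by
    intro x P z y h1 h2 h3
    calc x ^ 2 * z ≤ x ^ 2 * (P * y) := by gcongr
      _ = x ^ 2 * P * y := by ring
      _ ≤ δ * y := by gcongr
  refine ⟨p, q, fun jk => ((x⁻¹ : ℝ) : ℂ) • ∑ i, α (i, jk.2) • v i jk.1, fun il => ((y⁻¹ : ℝ) : ℂ) • ∑ j, β (j, il.2) • v il.1 j,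
    fun jk => (x : ℂ) • ∑ l, β (jk.1, l) • w jk.2 l, fun il => (y : ℂ) • ∑ k, α (il.1, k) • w k il.2, ?_, ?_, ?_, ?_, ?_, ?_⟩
  · rw [hu]
    simp only [TensorProduct.smul_tmul_smul, ← Complex.ofReal_mul, inv_mul_cancel₀ hx0.ne', Complex.ofReal_one, one_smul]
    simp only [TensorProduct.sum_tmul, TensorProduct.tmul_sum, TensorProduct.smul_tmul_smul, Fintype.sum_prod_type]
    rw [sum_rev3 (fun i k j => ∑ l, (α (i, k) * β (j, l)) • (v i j ⊗ₜ[ℂ] w k l))]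
    exact Finset.sum_congr rfl fun j _ => Finset.sum_congr rfl fun k _ => Finset.sum_comm
  · rw [hu]
    simp only [TensorProduct.smul_tmul_smul, ← Complex.ofReal_mul, inv_mul_cancel₀ hy0.ne', Complex.ofReal_one, one_smul]
    simp only [TensorProduct.sum_tmul, TensorProduct.tmul_sum, TensorProduct.smul_tmul_smul, Fintype.sum_prod_type]
    refine Finset.sum_congr rfl fun i _ => ?_
    rw [sum_rev3 (fun k j l => (α (i, k) * β (j, l)) • (v i j ⊗ₜ[ℂ] w k l))]
    refine Finset.sum_congr rfl fun l _ => ?_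
    rw [Finset.sum_comm]
    refine Finset.sum_congr rfl fun j _ => Finset.sum_congr rfl fun k _ => ?_
    rw [mul_comm]
  · intro z
    refine le_trans (le_of_eq ?_) (hmul hx1 (z := ∑ k, ∑ j, ‖∑ i, star (π₁ (v i j)) (star (α (i, k)) • z)‖ ^ 2) ?_ (sq_nonneg ‖z‖))
    · rw [Fintype.sum_prod_type, Finset.sum_comm, Finset.mul_sum]
      refine Finset.sum_congr rfl fun k _ => ?_
      rw [Finset.mul_sum]
      refine Finset.sum_congr rfl fun j _ => ?_
      simp only [map_smul, map_sum, star_smul, star_sum, ContinuousLinearMap.smul_apply, ContinuousLinearMap.sum_apply]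
      rw [norm_smul, mul_pow, norm_star, Complex.norm_real, Real.norm_of_nonneg (inv_pos.2 hx0).le]
    · refine (Finset.sum_le_sum fun k _ => opMat_bound' π₁ (hNA p) v _).trans ?_
      rw [← Finset.mul_sum, mul_assoc]
      have := row_sum_bound (fun ik => star (α ik)) z
      simp only [norm_star] at this
      rw [this]
  · intro z
    refine le_trans (le_of_eq ?_) (hmul hx2 (z := ∑ j, ∑ k, ‖∑ l, (π₂ (w k l)) ((β (j, l)) • z)‖ ^ 2) ?_ (sq_nonneg ‖z‖))
    · rw [Fintype.sum_prod_type, Finset.mul_sum]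
      refine Finset.sum_congr rfl fun k _ => ?_
      rw [Finset.mul_sum]
      refine Finset.sum_congr rfl fun j _ => ?_
      simp only [map_smul, map_sum, ContinuousLinearMap.smul_apply, ContinuousLinearMap.sum_apply]
      rw [norm_smul, mul_pow, Complex.norm_real, Real.norm_of_nonneg hx0.le]
    · refine (Finset.sum_le_sum fun k _ => opMat_bound π₂ (hNB q) w _).trans ?_
      rw [← Finset.mul_sum, mul_assoc, col_sum_bound]
  · intro z
    refine le_trans (le_of_eq ?_) (hmul hy1 (z := ∑ l, ∑ i, ‖∑ j, (π₁ (v i j)) ((β (j, l)) • z)‖ ^ 2) ?_ (sq_nonneg ‖z‖))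
    · rw [Fintype.sum_prod_type, Finset.sum_comm, Finset.mul_sum]
      refine Finset.sum_congr rfl fun k _ => ?_
      rw [Finset.mul_sum]
      refine Finset.sum_congr rfl fun j _ => ?_
      simp only [map_smul, map_sum, ContinuousLinearMap.smul_apply, ContinuousLinearMap.sum_apply]
      rw [norm_smul, mul_pow, Complex.norm_real, Real.norm_of_nonneg (inv_pos.2 hy0).le]
    · refine (Finset.sum_le_sum fun k _ => opMat_bound π₁ (hNA p) v _).trans ?_
      rw [← Finset.mul_sum, mul_assoc, row_sum_bound]
  · intro z
    refine le_trans (le_of_eq ?_) (hmul hy2 (z := ∑ i, ∑ l, ‖∑ k, star (π₂ (w k l)) (star (α (i, k)) • z)‖ ^ 2) ?_ (sq_nonneg ‖z‖))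
    · rw [Fintype.sum_prod_type, Finset.mul_sum]
      refine Finset.sum_congr rfl fun k _ => ?_
      rw [Finset.mul_sum]
      refine Finset.sum_congr rfl fun j _ => ?_
      simp only [map_smul, map_sum, star_smul, star_sum, ContinuousLinearMap.smul_apply, ContinuousLinearMap.sum_apply]
      rw [norm_smul, mul_pow, norm_star, Complex.norm_real, Real.norm_of_nonneg hy0.le]
    · refine (Finset.sum_le_sum fun k _ => opMat_bound' π₂ (hNB q) w _).trans ?_
      rw [← Finset.mul_sum, mul_assoc]
      have := col_sum_bound (fun ik => star (α ik)) z
      simp only [norm_star] at this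
      rw [this]

end Decomp

end SecP14

section SecP15
section MinRep
variable {A B W : Type*} [AddCommGroup A] [Module ℂ A] [AddCommGroup B] [Module ℂ B]
  [AddCommGroup W] [Module ℂ W]

lemma red_left (f : A →ₗ[ℂ] W) {s : ℕ} (a : Fin (s+1) → A) (b : Fin (s+1) → B)
    (h : ¬ LinearIndependent ℂ (fun j => f (a j))) :
    ∃ (a' : Fin s → A) (b' : Fin s → B) (e : A) (b0 : B), f e = 0 ∧
      ∑ j, a j ⊗ₜ[ℂ] b j = e ⊗ₜ[ℂ] b0 + ∑ j, a' j ⊗ₜ[ℂ] b' j := by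
  obtain ⟨g, hg, i, hi⟩ := Fintype.not_linearIndependent_iff.1 h
  refine ⟨fun j => a (i.succAbove j), fun j => b (i.succAbove j) - ((g i)⁻¹ * g (i.succAbove j)) • b i,
    (g i)⁻¹ • ∑ j, g j • a j, b i, ?_, ?_⟩
  · rw [map_smul, map_sum]; simp only [map_smul]; rw [hg, smul_zero]
  · rw [Fin.sum_univ_succAbove _ i, Fin.sum_univ_succAbove (fun j => g j • a j) i]
    simp only [smul_add, smul_smul, inv_mul_cancel₀ hi, one_smul, TensorProduct.add_tmul, TensorProduct.tmul_sub,
      Finset.smul_sum, TensorProduct.sum_tmul, Finset.sum_sub_distrib, TensorProduct.tmul_smul, TensorProduct.smul_tmul']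
    abel

lemma red_right (f : B →ₗ[ℂ] W) {s : ℕ} (a : Fin (s+1) → A) (b : Fin (s+1) → B)
    (h : ¬ LinearIndependent ℂ (fun j => f (b j))) :
    ∃ (a' : Fin s → A) (b' : Fin s → B) (e : B) (a0 : A), f e = 0 ∧
      ∑ j, a j ⊗ₜ[ℂ] b j = a0 ⊗ₜ[ℂ] e + ∑ j, a' j ⊗ₜ[ℂ] b' j := by
  obtain ⟨b', a', e, a0, he, h1⟩ := red_left (B := A) f b a h
  refine ⟨a', b', e, a0, he, ?_⟩
  have := congrArg (TensorProduct.comm ℂ B A) h1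
  simpa [map_sum] using this

lemma min_rep {W' : Type*} [AddCommGroup W'] [Module ℂ W'] (f : A →ₗ[ℂ] W) (f' : B →ₗ[ℂ] W') (Q : Submodule ℂ (A ⊗[ℂ] B))
    (h1 : ∀ a b, f a = 0 → a ⊗ₜ b ∈ Q) (h2 : ∀ a b, f' b = 0 → a ⊗ₜ b ∈ Q) (u : A ⊗[ℂ] B) :
    ∃ (r : ℕ) (a : Fin r → A) (b : Fin r → B), LinearIndependent ℂ (fun j => f (a j)) ∧
      LinearIndependent ℂ (fun j => f' (b j)) ∧ u - ∑ j, a j ⊗ₜ b j ∈ Q := by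
  classical
  have hex : ∃ r : ℕ, ∃ (a : Fin r → A) (b : Fin r → B), u - ∑ j, a j ⊗ₜ b j ∈ Q := by
    obtain ⟨n, a, b, h⟩ := TensorProduct.exists_sum_tmul_eq u
    exact ⟨n, a, b, by rw [h, sub_self]; exact Q.zero_mem⟩
  obtain ⟨a, b, hab⟩ := Nat.find_spec hex
  have hmin := fun m => Nat.find_min hex (m := m)
  generalize Nat.find hex = r at a b hab hmin
  rcases r with _ | s
  · exact ⟨0, a, b, linearIndependent_empty_type, linearIndependent_empty_type, hab⟩
  refine ⟨s+1, a, b, ?_, ?_, hab⟩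
  · by_contra hc
    obtain ⟨a', b', e, b0, he, h⟩ := red_left f a b hc
    refine hmin s (by omega) ⟨a', b', ?_⟩
    have := Q.add_mem hab (h1 e b0 he)
    rw [h] at this
    convert this using 1
    abel
  · by_contra hc
    obtain ⟨a', b', e, a0, he, h⟩ := red_right f' a b hc
    refine hmin s (by omega) ⟨a', b', ?_⟩
    have := Q.add_mem hab (h2 a0 e he)
    rw [h] at this
    convert this using 1
    abel
end MinRep

end SecP15

section SecP16
section Series
open Filter Topology

lemma sigma_tsum {J : ℕ → Type} [∀ m, Fintype (J m)] (f : (Σ m, J m) → ℂ) (hf : Summable f) (g : ℕ → ℂ)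
    (hg : ∀ m, ∑ i, f ⟨m, i⟩ = g (m+1) - g m) (hg0 : Tendsto g atTop (𝓝 0)) : ∑' i, f i = - g 0 := by
  have h1 := hf.hasSum.sigma (g := fun m => g (m+1) - g m) (fun m => by rw [← hg m]; exact hasSum_fintype _)
  have h2 := h1.tendsto_sum_nat
  simp only [Finset.sum_range_sub] at h2
  have h3 : Tendsto (fun n => g n - g 0) atTop (𝓝 (0 - g 0)) := hg0.sub_const _
  rw [tendsto_nhds_unique h2 h3, zero_sub]

lemma sigma_bound {J : ℕ → Type} [∀ m, Fintype (J m)] (f : (Σ m, J m) → ℝ) (hf : ∀ i, 0 ≤ f i) (δ : ℕ → ℝ) (hδ : Summable δ)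
    (K : ℝ) (h : ∀ m, ∑ i, f ⟨m, i⟩ ≤ δ m * K) (F : Finset (Σ m, J m)) : ∑ i ∈ F, f i ≤ (∑' m, δ m) * K := by
  have hs2 : Summable fun m => ∑' i, f ⟨m, i⟩ := by
    refine Summable.of_nonneg_of_le (fun m => tsum_nonneg fun _ => hf _) (fun m => ?_) (hδ.mul_right K)
    rw [tsum_fintype]; exact h m
  have hs : Summable f := (summable_sigma_of_nonneg hf).2 ⟨fun m => Summable.of_finite, hs2⟩
  refine (hs.sum_le_tsum F fun i _ => hf i).trans ?_
  rw [hs.tsum_sigma' (fun m => Summable.of_finite), ← tsum_mul_right]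
  refine hs2.tsum_le_tsum (fun m => ?_) (hδ.mul_right K)
  rw [tsum_fintype]; exact h m

variable {A B : Type u} [NonUnitalCStarAlgebra A] [NonUnitalCStarAlgebra B]
    {H₁ H₂ : Type*} [NormedAddCommGroup H₁] [InnerProductSpace ℂ H₁] [CompleteSpace H₁]
    [NormedAddCommGroup H₂] [InnerProductSpace ℂ H₂] [CompleteSpace H₂]

def vf1 (π₁ : A →⋆ₙₐ[ℂ] (H₁ →L[ℂ] H₁)) (θ θ' : H₁) : A →ₗ[ℂ] ℂ where
  toFun a := inner ℂ θ' (π₁ a θ)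
  map_add' a b := by simp [inner_add_right]
  map_smul' a b := by simp [inner_smul_right]

def vf (π₁ : A →⋆ₙₐ[ℂ] (H₁ →L[ℂ] H₁)) (π₂ : B →⋆ₙₐ[ℂ] (H₂ →L[ℂ] H₂)) (θ θ' : H₁) (ζ ζ' : H₂) : A ⊗[ℂ] B →ₗ[ℂ] ℂ :=
  LinearMap.mul' ℂ ℂ ∘ₗ TensorProduct.map (vf1 π₁ θ θ') (vf1 π₂ ζ ζ')

@[simp] lemma vf_tmul (π₁ : A →⋆ₙₐ[ℂ] (H₁ →L[ℂ] H₁)) (π₂ : B →⋆ₙₐ[ℂ] (H₂ →L[ℂ] H₂)) (θ θ' : H₁) (ζ ζ' : H₂) (a : A) (b : B) :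
    vf π₁ π₂ θ θ' ζ ζ' (a ⊗ₜ b) = inner ℂ θ' (π₁ a θ) * inner ℂ ζ' (π₂ b ζ) := by
  simp [vf, vf1]

lemma summ_prod {I : Type*} (x : I → H₁) (y : I → H₂) (θ : H₁) (ζ : H₂) (M N : ℝ)
    (hx : ∀ F : Finset I, ∑ i ∈ F, ‖x i‖ ^ 2 ≤ M) (hy : ∀ F : Finset I, ∑ i ∈ F, ‖y i‖ ^ 2 ≤ N)
    (f : I → ℂ) (hf : ∀ i, ‖f i‖ ≤ ‖x i‖ * ‖θ‖ * (‖y i‖ * ‖ζ‖)) : Summable f := by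
  have h1 : Summable fun i => ‖x i‖ ^ 2 := summable_of_sum_le (fun _ => by positivity) hx
  have h2 : Summable fun i => ‖y i‖ ^ 2 := summable_of_sum_le (fun _ => by positivity) hy
  refine Summable.of_norm_bounded ((h1.add h2).mul_left (‖θ‖ * ‖ζ‖)) fun i => (hf i).trans ?_
  have h3 := two_mul_le_add_sq ‖x i‖ ‖y i‖
  have h4 : ‖x i‖ * ‖y i‖ ≤ ‖x i‖ ^ 2 + ‖y i‖ ^ 2 := by nlinarith [norm_nonneg (x i), norm_nonneg (y i)]
  calc _ = ‖θ‖ * ‖ζ‖ * (‖x i‖ * ‖y i‖) := by ring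
    _ ≤ _ := by gcongr

lemma inj_series
    (NA : ∀ p : ℕ, Matrix (Fin p) (Fin p) A → ℝ)
    (NB : ∀ q : ℕ, Matrix (Fin q) (Fin q) B → ℝ)
    (hNA : ∀ p, IsCStarNorm (NA p)) (hNB : ∀ q, IsCStarNorm (NB q))
    (π₁ : A →⋆ₙₐ[ℂ] (H₁ →L[ℂ] H₁)) (π₂ : B →⋆ₙₐ[ℂ] (H₂ →L[ℂ] H₂))
    (V : A ⊗[ℂ] B →ₗ[ℂ] ℂ) (hV : ∀ u, ‖V u‖ ≤ osProjNorm NA NB u)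
    (hV1 : ∀ a b, π₁ a = 0 → V (a ⊗ₜ b) = 0) (hV2 : ∀ a b, π₂ b = 0 → V (a ⊗ₜ b) = 0)
    (u : ℕ → A ⊗[ℂ] B) (δ : ℕ → ℝ) (hδ0 : ∀ n, 0 < δ n) (hδ : Summable δ)
    (hu : ∀ n, osProjNorm NA NB (u (n+1) - u n) < δ n)
    (hlim : ∀ θ θ' ζ ζ', Tendsto (fun n => vf π₁ π₂ θ θ' ζ ζ' (u n)) atTop (𝓝 0)) :
    ‖V (u 0)‖ ≤ 12872 * ∑' n, δ n := by
  choose p q c c' d d' e1 e2 b1 b2 b3 b4 using fun m => osProj_decomp NA NB hNA hNB π₁ π₂ (u (m+1) - u m) (δ m) (hδ0 m) (hu m)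
  set Q : Submodule ℂ (A ⊗[ℂ] B) := LinearMap.ker V ⊓ ⨅ (x : (H₁ × H₁) × (H₂ × H₂)), LinearMap.ker (vf π₁ π₂ x.1.1 x.1.2 x.2.1 x.2.2) with hQ
  obtain ⟨r, a, b, ha, hb, hab⟩ := min_rep (π₁ : A →ₗ[ℂ] (H₁ →L[ℂ] H₁)) (π₂ : B →ₗ[ℂ] (H₂ →L[ℂ] H₂)) Q
    (by
      intro a b h
      have h : π₁ a = 0 := h
      simp [hQ, Submodule.mem_inf, Submodule.mem_iInf, hV1 a b h, h])
    (by
      intro a b h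
      have h : π₂ b = 0 := h
      simp [hQ, Submodule.mem_inf, Submodule.mem_iInf, hV2 a b h, h]) (- u 0)
  rw [hQ, Submodule.mem_inf, Submodule.mem_iInf] at hab
  obtain ⟨hab1, hab2⟩ := hab
  have hV0 : V (- u 0) = ∑ j, V (a j ⊗ₜ b j) := by
    rw [LinearMap.mem_ker, map_sub, sub_eq_zero, map_sum] at hab1
    exact hab1
  have hvf : ∀ θ θ' ζ ζ', - vf π₁ π₂ θ θ' ζ ζ' (u 0) = ∑ j, inner ℂ θ' (π₁ (a j) θ) * inner ℂ ζ' (π₂ (b j) ζ) := by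
    intro θ θ' ζ ζ'
    have := hab2 ((θ, θ'), (ζ, ζ'))
    rw [LinearMap.mem_ker, map_sub, sub_eq_zero, map_sum, map_neg] at this
    simpa only [vf_tmul] using this
  rw [← norm_neg, ← map_neg, hV0]
  have q1 := fun v => sigma_bound (J := fun m => Fin (p m) × Fin (q m)) (fun i => ‖star (π₁ (c i.1 i.2)) v‖ ^ 2) (fun _ => by positivity) δ hδ _ (fun m => b1 m v)
  have q2 := fun v => sigma_bound (J := fun m => Fin (p m) × Fin (q m)) (fun i => ‖(π₂ (d i.1 i.2)) v‖ ^ 2) (fun _ => by positivity) δ hδ _ (fun m => b2 m v)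
  have q3 := fun v => sigma_bound (J := fun m => Fin (p m) × Fin (q m)) (fun i => ‖(π₁ (c' i.1 i.2)) v‖ ^ 2) (fun _ => by positivity) δ hδ _ (fun m => b3 m v)
  have q4 := fun v => sigma_bound (J := fun m => Fin (p m) × Fin (q m)) (fun i => ‖star (π₂ (d' i.1 i.2)) v‖ ^ 2) (fun _ => by positivity) δ hδ _ (fun m => b4 m v)
  refine inj_core NA NB hNA hNB π₁ π₂ V hV hV1 hV2 (I := Σ m, Fin (p m) × Fin (q m)) (I' := Σ m, Fin (p m) × Fin (q m))
    (fun i => π₁ (c i.1 i.2)) (fun i => π₂ (d i.1 i.2)) (fun i => π₁ (c' i.1 i.2)) (fun i => π₂ (d' i.1 i.2)) _ (hδ.tsum_pos (fun n => (hδ0 n).le) 0 (hδ0 0))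
    q1 q2 q3 q4 a b ha hb ?_ ?_
  · intro θ θ' ζ ζ'
    rw [← hvf]
    refine sigma_tsum _ ?_ (fun n => vf π₁ π₂ θ θ' ζ ζ' (u n)) (fun m => ?_) (hlim _ _ _ _)
    · refine summ_prod _ _ θ ζ' _ _ (q1 θ') (q2 ζ) _ fun i => ?_
      rw [norm_mul]
      gcongr
      · rw [← ContinuousLinearMap.adjoint_inner_left]
        exact norm_inner_le_norm _ _
      · rw [mul_comm]; exact norm_inner_le_norm _ _
    · rw [← map_sub, e1, map_sum]; simp only [vf_tmul]
  · intro θ θ' ζ ζ'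
    rw [← hvf]
    refine sigma_tsum _ ?_ (fun n => vf π₁ π₂ θ θ' ζ ζ' (u n)) (fun m => ?_) (hlim _ _ _ _)
    · refine summ_prod _ _ θ' ζ _ _ (q3 θ) (q4 ζ') _ fun i => ?_
      rw [norm_mul]
      gcongr
      · rw [mul_comm]; exact norm_inner_le_norm _ _
      · rw [← ContinuousLinearMap.adjoint_inner_left]
        exact norm_inner_le_norm _ _
    · rw [← map_sub, e2, map_sum]; simp only [vf_tmul]

end Series

end SecP16

section SecP17
section InjX
open Filter Topology
variable {A B : Type u} [NonUnitalCStarAlgebra A] [NonUnitalCStarAlgebra B]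
    {H₁ H₂ : Type*} [NormedAddCommGroup H₁] [InnerProductSpace ℂ H₁] [CompleteSpace H₁]
    [NormedAddCommGroup H₂] [InnerProductSpace ℂ H₂] [CompleteSpace H₂]

lemma hb_mem {X : Type*} [NormedAddCommGroup X] [NormedSpace ℂ X] (S : Submodule ℂ X) (x : X)
    (h : ∀ f : X →L[ℂ] ℂ, (∀ s ∈ S, f s = 0) → f x = 0) : x ∈ closure (S : Set X) := by
  by_contra hx
  have hx' : x ∉ S.topologicalClosure := hx
  have : IsClosed (S.topologicalClosure : Set X) := S.isClosed_topologicalClosure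
  obtain ⟨f, hf⟩ := SeparatingDual.exists_ne_zero (R := ℂ) (x := (Submodule.Quotient.mk x : X ⧸ S.topologicalClosure))
    (by rwa [Ne, Submodule.Quotient.mk_eq_zero])
  let g : X →L[ℂ] ℂ := f.comp (S.topologicalClosure.mkQL)
  refine hf (h g fun s hs => ?_)
  show f (Submodule.Quotient.mk s) = 0
  rw [(Submodule.Quotient.mk_eq_zero _).2 (S.le_topologicalClosure hs), map_zero]

lemma inj_X {X : Type u} [NonUnitalNormedRing X] [StarRing X] [NormedSpace ℂ X] [CompleteSpace X]
    (NA : ∀ p : ℕ, Matrix (Fin p) (Fin p) A → ℝ)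
    (NB : ∀ q : ℕ, Matrix (Fin q) (Fin q) B → ℝ)
    (hNA : ∀ p, IsCStarNorm (NA p)) (hNB : ∀ q, IsCStarNorm (NB q))
    (ι : A ⊗[ℂ] B →ₗ[ℂ] X) (hX : IsTensorCompletion (osProjNorm NA NB) X ι)
    (π₁ : A →⋆ₙₐ[ℂ] (H₁ →L[ℂ] H₁)) (π₂ : B →⋆ₙₐ[ℂ] (H₂ →L[ℂ] H₂)) (x : X)
    (hx : ∀ u : ℕ → A ⊗[ℂ] B, Tendsto (fun n => ι (u n)) atTop (𝓝 x) →
      ∀ θ θ' ζ ζ', Tendsto (fun n => vf π₁ π₂ θ θ' ζ ζ' (u n)) atTop (𝓝 0))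
    (Q : Submodule ℂ (A ⊗[ℂ] B)) (hQ1 : ∀ a b, π₁ a = 0 → a ⊗ₜ b ∈ Q) (hQ2 : ∀ a b, π₂ b = 0 → a ⊗ₜ b ∈ Q) :
    x ∈ closure (ι '' (Q : Set (A ⊗[ℂ] B))) := by
  rw [← Submodule.map_coe]
  refine hb_mem _ x fun f hf => ?_
  have hc : 0 < ‖f‖ + 1 := by positivity
  have hap : ∀ n : ℕ, ∃ u, ‖x - ι u‖ < (1/2)^n / 4 := fun n => by
    obtain ⟨u, hu⟩ := hX.dense.exists_dist_lt x (ε := (1/2)^n/4) (by positivity)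
    exact ⟨u, by rwa [dist_eq_norm] at hu⟩
  choose u hu using hap
  have hp : Tendsto (fun n : ℕ => ((1:ℝ)/2)^n) atTop (𝓝 0) := tendsto_pow_atTop_nhds_zero_of_lt_one (by norm_num) (by norm_num)
  have hlim : Tendsto (fun n => ι (u n)) atTop (𝓝 x) := by
    rw [tendsto_iff_norm_sub_tendsto_zero]
    refine squeeze_zero (fun _ => norm_nonneg _) (fun n => ?_) hp
    rw [norm_sub_rev]
    have : (0:ℝ) < (1/2)^n := by positivity
    linarith [hu n]
  have hd : ∀ n, osProjNorm NA NB (u (n+1) - u n) < (1/2)^n := fun n => by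
    rw [← hX.norm_eq, map_sub]
    have h1 : ι (u (n+1)) - ι (u n) = (x - ι (u n)) - (x - ι (u (n+1))) := by abel
    rw [h1]
    refine (norm_sub_le _ _).trans_lt ?_
    have h2 := hu n
    have h3 := hu (n+1)
    rw [pow_succ] at h3
    have : (0:ℝ) < (1/2)^n := by positivity
    linarith
  let k : ℂ := (((‖f‖ + 1)⁻¹ : ℝ) : ℂ)
  have hk : k ≠ 0 := by
    simp only [k]; exact_mod_cast (inv_pos.2 hc).ne'
  let V : A ⊗[ℂ] B →ₗ[ℂ] ℂ := k • ((f : X →ₗ[ℂ] ℂ) ∘ₗ ι)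
  have hVd : ∀ w, V w = k * f (ι w) := fun w => rfl
  have hV : ∀ w, ‖V w‖ ≤ osProjNorm NA NB w := fun w => by
    rw [hVd, ← hX.norm_eq, norm_mul, Complex.norm_real, Real.norm_of_nonneg (inv_pos.2 hc).le]
    rw [inv_mul_le_iff₀ hc]
    refine (f.le_opNorm _).trans ?_
    gcongr; linarith
  have hfQ : ∀ w ∈ Q, f (ι w) = 0 := fun w hw => hf _ ⟨w, hw, rfl⟩
  have hb : ∀ n, ‖V (u n)‖ ≤ 12872 * 2 * (1/2)^n := fun n => by
    have := inj_series NA NB hNA hNB π₁ π₂ V hV (fun a b h => by rw [hVd, hfQ _ (hQ1 a b h), mul_zero])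
      (fun a b h => by rw [hVd, hfQ _ (hQ2 a b h), mul_zero]) (fun m => u (m + n)) (fun m => (1/2)^m * (1/2)^n)
      (fun m => by positivity) (Summable.mul_right _ (summable_geometric_of_lt_one (by norm_num) (by norm_num)))
      (fun m => by
        rw [← pow_add, show m + 1 + n = m + n + 1 by ring]; exact hd (m + n))
      (fun θ θ' ζ ζ' => hx _ ((tendsto_add_atTop_iff_nat n).2 hlim) θ θ' ζ ζ')
    rw [tsum_mul_right, tsum_geometric_two, zero_add] at this
    linarith
  have h0 : Tendsto (fun n => V (u n)) atTop (𝓝 0) := by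
    refine squeeze_zero_norm hb ?_
    simpa using hp.const_mul (12872 * 2)
  have h1 : Tendsto (fun n => V (u n)) atTop (𝓝 (k * f x)) :=
    ((f.continuous.tendsto x).comp hlim).const_mul k
  have := tendsto_nhds_unique h1 h0
  exact (mul_eq_zero.1 this).resolve_left hk
end InjX

end SecP17

section SecP18
section Schur

variable {A : Type*} [NonUnitalCStarAlgebra A]
    {H : Type*} [NormedAddCommGroup H] [InnerProductSpace ℂ H] [CompleteSpace H]

lemma schur_sa (π : A →⋆ₙₐ[ℂ] (H →L[ℂ] H))
    (hirr : ∀ S : Submodule ℂ H, IsClosed (S : Set H) → (∀ y : A, ∀ v ∈ S, π y v ∈ S) → S = ⊥ ∨ S = ⊤)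
    (R : H →L[ℂ] H) (hR : IsSelfAdjoint R) (hc : ∀ a, Commute R (π a)) : ∃ k : ℂ, R = k • 1 := by
  by_cases hsp : ∃ s ∈ spectrum ℝ R, ∃ t ∈ spectrum ℝ R, s ≠ t
  · exfalso
    obtain ⟨s, hs, t, ht, hst⟩ := hsp
    let d := |s - t| / 2
    have hd : 0 < d := half_pos (abs_pos.2 (sub_ne_zero.2 hst))
    let f : ℝ → ℝ := fun x => max 0 (d - |x - s|)
    let g : ℝ → ℝ := fun x => max 0 (d - |x - t|)
    have hf : Continuous f := by fun_prop
    have hg : Continuous g := by fun_prop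
    have hfg : ∀ x, f x * g x = 0 := by
      intro x
      rcases le_total d |x - s| with h | h
      · simp [f, h]
      · have : d ≤ |x - t| := by
          have h1 := abs_sub_abs_le_abs_sub (s - t) (s - x)
          have h2 : s - t - (s - x) = x - t := by ring
          rw [h2, abs_sub_comm s x] at h1
          have : |s - t| = 2 * d := by simp only [d]; ring
          linarith
        simp [g, this]
    have hne : ∀ (k : ℝ → ℝ), Continuous k → ∀ r ∈ spectrum ℝ R, k r ≠ 0 → cfc k R ≠ 0 := by
      intro k hk r hr hkr h0
      have h1 := cfc_map_spectrum k R hR hk.continuousOn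
      have : k r ∈ spectrum ℝ (cfc k R) := by rw [h1]; exact ⟨r, hr, rfl⟩
      rw [h0] at this
      have hnt : Nontrivial (H →L[ℂ] H) := by
        by_contra hn
        rw [not_nontrivial_iff_subsingleton] at hn
        rw [spectrum.of_subsingleton] at this
        exact this
      rw [spectrum.zero_eq] at this
      exact hkr this
    have hf0 := hne f hf s hs (by simp [f, hd, hd.ne'])
    have hg0 := hne g hg t ht (by simp [g, hd, hd.ne'])
    have hprod : cfc f R * cfc g R = 0 := by
      rw [← cfc_mul f g R hf.continuousOn hg.continuousOn]
      simp only [hfg]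
      exact cfc_const_zero ℝ R
    have hcf : ∀ a, Commute (cfc f R) (π a) := fun a => (hc a).cfc_real f
    have hS := hirr (LinearMap.ker (cfc f R : H →L[ℂ] H).toLinearMap) (cfc f R).isClosed_ker (by
      intro y v hv
      have hv' : (cfc f R) v = 0 := hv
      show (cfc f R) (π y v) = 0
      have := DFunLike.congr_fun (hcf y).eq v
      simp only [ContinuousLinearMap.mul_apply] at this
      rw [this, hv', map_zero])
    rcases hS with hS | hS
    · apply hg0
      ext v
      have : cfc g R v ∈ (LinearMap.ker (cfc f R : H →L[ℂ] H).toLinearMap) := by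
        show cfc f R (cfc g R v) = 0
        rw [← ContinuousLinearMap.mul_apply, hprod]; rfl
      rw [hS] at this
      exact this
    · apply hf0
      ext v
      have : v ∈ (LinearMap.ker (cfc f R : H →L[ℂ] H).toLinearMap) := by rw [hS]; trivial
      exact this
  · push Not at hsp
    have hex : ∃ s0 : ℝ, ∀ t ∈ spectrum ℝ R, t = s0 := by
      by_cases h : ∃ s, s ∈ spectrum ℝ R
      · obtain ⟨s, hs⟩ := h
        exact ⟨s, fun t ht => hsp t ht s hs⟩
      · push Not at h
        exact ⟨0, fun t ht => (h t ht).elim⟩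
    obtain ⟨s0, hs0⟩ := hex
    refine ⟨(s0 : ℂ), ?_⟩
    have h1 : cfc (fun x : ℝ => x) R = cfc (fun _ : ℝ => s0) R := cfc_congr fun x hx => hs0 x hx
    rw [cfc_id' ℝ R hR, cfc_const s0 R hR] at h1
    rw [h1, Algebra.algebraMap_eq_smul_one, Complex.coe_smul]

lemma schur (π : A →⋆ₙₐ[ℂ] (H →L[ℂ] H))
    (hirr : ∀ S : Submodule ℂ H, IsClosed (S : Set H) → (∀ y : A, ∀ v ∈ S, π y v ∈ S) → S = ⊥ ∨ S = ⊤)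
    (R : H →L[ℂ] H) (hc : ∀ a, Commute R (π a)) : ∃ k : ℂ, R = k • 1 := by
  have hc' : ∀ a, Commute (star R) (π a) := fun a => by
    have := (hc (star a)).star_star
    rwa [map_star, star_star] at this
  obtain ⟨k, hk⟩ := schur_sa π hirr (R + star R) (IsSelfAdjoint.add_star_self R) (fun a => (hc a).add_left (hc' a))
  obtain ⟨l, hl⟩ := schur_sa π hirr (Complex.I • (R - star R)) (by
    rw [isSelfAdjoint_iff, star_smul, star_sub, star_star]
    simp [smul_sub]; abel) (fun a => ((hc a).sub_left (hc' a)).smul_left _)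
  refine ⟨(1/2 : ℂ) * (k - Complex.I * l), ?_⟩
  have h1 : R = (1/2 : ℂ) • ((R + star R) - Complex.I • (Complex.I • (R - star R))) := by
    rw [smul_smul, Complex.I_mul_I, neg_one_smul, sub_neg_eq_add, add_add_sub_cancel, ← two_smul ℂ R, smul_smul]
    norm_num
  rw [hk, hl] at h1
  rw [h1, smul_smul, ← sub_smul, smul_smul]

end Schur

end SecP18

section SecP19
section TMap
variable {H₁ H₂ H : Type*} [NormedAddCommGroup H₁] [InnerProductSpace ℂ H₁] [CompleteSpace H₁]
    [NormedAddCommGroup H₂] [InnerProductSpace ℂ H₂] [CompleteSpace H₂]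
    [NormedAddCommGroup H] [InnerProductSpace ℂ H] [CompleteSpace H]

/-- the operator `f ⊗ g` on a completion of `H₁ ⊗ H₂` -/
def tmap (t : (H₁ ⊗[ℂ] H₂) →ₗᵢ[ℂ] H) (f : H₁ →L[ℂ] H₁) (g : H₂ →L[ℂ] H₂) : H →L[ℂ] H :=
  (t.toContinuousLinearMap ∘L TensorProduct.mapL f g).extend t.toContinuousLinearMap

variable (t : (H₁ ⊗[ℂ] H₂) →ₗᵢ[ℂ] H) (ht : DenseRange t)

lemma tmap_apply (ht : DenseRange t) (f : H₁ →L[ℂ] H₁) (g : H₂ →L[ℂ] H₂) (z : H₁ ⊗[ℂ] H₂) :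
    tmap t f g (t z) = t (TensorProduct.mapL f g z) :=
  ContinuousLinearMap.extend_eq (t.toContinuousLinearMap ∘L TensorProduct.mapL f g) (e := t.toContinuousLinearMap) ht t.isometry.isUniformInducing z

lemma dense_ext_op (ht : DenseRange t) {P Q : H →L[ℂ] H} (h : ∀ θ ζ, P (t (θ ⊗ₜ ζ)) = Q (t (θ ⊗ₜ ζ))) : P = Q := by
  have h1 : (P.toLinearMap ∘ₗ t.toLinearMap) = Q.toLinearMap ∘ₗ t.toLinearMap := TensorProduct.ext' h
  apply ContinuousLinearMap.coeFn_injective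
  refine ht.equalizer P.continuous Q.continuous ?_
  ext z
  exact DFunLike.congr_fun h1 z

lemma dense_ext_vec (ht : DenseRange t) {x y : H} (h : ∀ θ ζ, inner ℂ (t (θ ⊗ₜ ζ)) x = inner ℂ (t (θ ⊗ₜ ζ)) y) : x = y := by
  refine ht.eq_of_inner_right ℂ fun z => ?_
  induction z using TensorProduct.induction_on with
  | zero => simp
  | tmul a b => exact h a b
  | add a b ha hb => rw [map_add, inner_add_left, inner_add_left, ha, hb]

lemma tmap_tmul (ht : DenseRange t) (f : H₁ →L[ℂ] H₁) (g : H₂ →L[ℂ] H₂) (θ : H₁) (ζ : H₂) :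
    tmap t f g (t (θ ⊗ₜ ζ)) = t (f θ ⊗ₜ g ζ) := tmap_apply t ht f g _

lemma tmap_mul (ht : DenseRange t) (f f' : H₁ →L[ℂ] H₁) (g g' : H₂ →L[ℂ] H₂) :
    tmap t (f * f') (g * g') = tmap t f g * tmap t f' g' :=
  dense_ext_op t ht fun θ ζ => by simp [tmap_tmul t ht]

lemma tmap_add_left (ht : DenseRange t) (f f' : H₁ →L[ℂ] H₁) (g : H₂ →L[ℂ] H₂) :
    tmap t (f + f') g = tmap t f g + tmap t f' g :=
  dense_ext_op t ht fun θ ζ => by simp [tmap_tmul t ht, TensorProduct.add_tmul]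

lemma tmap_add_right (ht : DenseRange t) (f : H₁ →L[ℂ] H₁) (g g' : H₂ →L[ℂ] H₂) :
    tmap t f (g + g') = tmap t f g + tmap t f g' :=
  dense_ext_op t ht fun θ ζ => by simp [tmap_tmul t ht, TensorProduct.tmul_add]

lemma tmap_smul_left (ht : DenseRange t) (c : ℂ) (f : H₁ →L[ℂ] H₁) (g : H₂ →L[ℂ] H₂) :
    tmap t (c • f) g = c • tmap t f g :=
  dense_ext_op t ht fun θ ζ => by
    rw [tmap_tmul t ht, ContinuousLinearMap.smul_apply, ContinuousLinearMap.smul_apply, tmap_tmul t ht, ← TensorProduct.smul_tmul', map_smul]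

lemma tmap_smul_right (ht : DenseRange t) (c : ℂ) (f : H₁ →L[ℂ] H₁) (g : H₂ →L[ℂ] H₂) :
    tmap t f (c • g) = c • tmap t f g :=
  dense_ext_op t ht fun θ ζ => by simp [tmap_tmul t ht]

lemma tmap_star (ht : DenseRange t) (f : H₁ →L[ℂ] H₁) (g : H₂ →L[ℂ] H₂) :
    star (tmap t f g) = tmap t (star f) (star g) := by
  refine dense_ext_op t ht fun θ ζ => dense_ext_vec t ht fun θ' ζ' => ?_
  rw [ContinuousLinearMap.star_eq_adjoint, ContinuousLinearMap.adjoint_inner_right, tmap_tmul t ht, tmap_tmul t ht,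
    LinearIsometry.inner_map_map, LinearIsometry.inner_map_map, TensorProduct.inner_tmul, TensorProduct.inner_tmul,
    ContinuousLinearMap.star_eq_adjoint, ContinuousLinearMap.adjoint_inner_right,
    ContinuousLinearMap.star_eq_adjoint, ContinuousLinearMap.adjoint_inner_right]

lemma tmap_norm (ht : DenseRange t) (f : H₁ →L[ℂ] H₁) (g : H₂ →L[ℂ] H₂) : ‖tmap t f g‖ ≤ ‖f‖ * ‖g‖ := by
  refine ContinuousLinearMap.opNorm_le_bound _ (by positivity) fun x => ?_
  refine ht.induction_on x (isClosed_le (by fun_prop) (by fun_prop)) fun z => ?_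
  rw [tmap_apply t ht, t.norm_map, t.norm_map]
  exact ((TensorProduct.mapL f g).le_opNorm z).trans (by gcongr; exact TensorProduct.norm_mapL_le f g)

lemma tmap_one (ht : DenseRange t) : tmap t 1 1 = 1 := dense_ext_op t ht fun θ ζ => by simp [tmap_tmul t ht]

/-- tmap as a bilinear map -/
def tmapB (ht : DenseRange t) : (H₁ →L[ℂ] H₁) →ₗ[ℂ] (H₂ →L[ℂ] H₂) →ₗ[ℂ] (H →L[ℂ] H) :=
  LinearMap.mk₂ ℂ (tmap t) (tmap_add_left t ht) (tmap_smul_left t ht) (tmap_add_right t ht) (tmap_smul_right t ht)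

lemma tmap_col (ht : DenseRange t) {J : Type*} [Fintype J] (d : J → H₂ →L[ℂ] H₂) (M : ℝ) (hM : 0 ≤ M)
    (h : ∀ v, ∑ j, ‖d j v‖ ^ 2 ≤ M * ‖v‖ ^ 2) (y : H) : ∑ j, ‖tmap t 1 (d j) y‖ ^ 2 ≤ M * ‖y‖ ^ 2 := by
  have h1 := opsum_norm_le (fun _ => 1) (fun _ => zero_le_one) d M hM (by simpa using h)
  simp only [Complex.ofReal_one, one_smul] at h1
  have h2 : tmap t 1 (∑ j, star (d j) * d j) = ∑ j, star (tmap t 1 (d j)) * tmap t 1 (d j) := by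
    have := map_sum (tmapB t ht 1) (fun j => star (d j) * d j) Finset.univ
    simp only [tmapB, LinearMap.mk₂_apply] at this
    rw [this]
    refine Finset.sum_congr rfl fun j _ => ?_
    rw [tmap_star t ht, star_one, ← tmap_mul t ht, one_mul]
  have h3 : (((∑ j, ‖tmap t 1 (d j) y‖ ^ 2 : ℝ)) : ℂ) = inner ℂ y (tmap t 1 (∑ j, star (d j) * d j) y) := by
    rw [h2, ContinuousLinearMap.sum_apply, inner_sum, Complex.ofReal_sum]
    refine Finset.sum_congr rfl fun j _ => ?_
    rw [ContinuousLinearMap.mul_apply, ContinuousLinearMap.star_eq_adjoint, ContinuousLinearMap.adjoint_inner_right, inner_self_eq_norm_sq_to_K]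
    simp
  have h4 : ‖inner ℂ y (tmap t 1 (∑ j, star (d j) * d j) y)‖ ≤ M * ‖y‖ ^ 2 := by
    refine (norm_inner_le_norm _ _).trans ?_
    have h5 : ‖tmap t 1 (∑ j, star (d j) * d j) y‖ ≤ M * ‖y‖ := by
      refine (ContinuousLinearMap.le_opNorm _ _).trans ?_
      gcongr
      refine (tmap_norm t ht _ _).trans ?_
      have h6 : ‖(1 : H₁ →L[ℂ] H₁)‖ ≤ 1 := ContinuousLinearMap.norm_id_le
      calc _ ≤ 1 * M := by gcongr
        _ = M := one_mul M
    calc _ ≤ ‖y‖ * (M * ‖y‖) := by gcongr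
      _ = _ := by ring
  rw [← h3, Complex.norm_real] at h4
  exact (le_abs_self _).trans h4

lemma tmap_row (ht : DenseRange t) {J : Type*} [Fintype J] (c : J → H₁ →L[ℂ] H₁) (M : ℝ) (hM : 0 ≤ M)
    (h : ∀ v, ∑ j, ‖c j v‖ ^ 2 ≤ M * ‖v‖ ^ 2) (y : H) : ∑ j, ‖tmap t (c j) 1 y‖ ^ 2 ≤ M * ‖y‖ ^ 2 := by
  have h1 := opsum_norm_le (fun _ => 1) (fun _ => zero_le_one) c M hM (by simpa using h)
  simp only [Complex.ofReal_one, one_smul] at h1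
  have h2 : tmap t (∑ j, star (c j) * c j) 1 = ∑ j, star (tmap t (c j) 1) * tmap t (c j) 1 := by
    have := map_sum ((tmapB t ht).flip 1) (fun j => star (c j) * c j) Finset.univ
    simp only [tmapB, LinearMap.mk₂_apply, LinearMap.flip_apply] at this
    rw [this]
    refine Finset.sum_congr rfl fun j _ => ?_
    rw [tmap_star t ht, star_one, ← tmap_mul t ht, one_mul]
  have h3 : (((∑ j, ‖tmap t (c j) 1 y‖ ^ 2 : ℝ)) : ℂ) = inner ℂ y (tmap t (∑ j, star (c j) * c j) 1 y) := by
    rw [h2, ContinuousLinearMap.sum_apply, inner_sum, Complex.ofReal_sum]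
    refine Finset.sum_congr rfl fun j _ => ?_
    rw [ContinuousLinearMap.mul_apply, ContinuousLinearMap.star_eq_adjoint, ContinuousLinearMap.adjoint_inner_right, inner_self_eq_norm_sq_to_K]
    simp
  have h4 : ‖inner ℂ y (tmap t (∑ j, star (c j) * c j) 1 y)‖ ≤ M * ‖y‖ ^ 2 := by
    refine (norm_inner_le_norm _ _).trans ?_
    have h5 : ‖tmap t (∑ j, star (c j) * c j) 1 y‖ ≤ M * ‖y‖ := by
      refine (ContinuousLinearMap.le_opNorm _ _).trans ?_
      gcongr
      refine (tmap_norm t ht _ _).trans ?_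
      have h6 : ‖(1 : H₂ →L[ℂ] H₂)‖ ≤ 1 := ContinuousLinearMap.norm_id_le
      calc _ ≤ M * 1 := by gcongr
        _ = M := mul_one M
    calc _ ≤ ‖y‖ * (M * ‖y‖) := by gcongr
      _ = _ := by ring
  rw [← h3, Complex.norm_real] at h4
  exact (le_abs_self _).trans h4

end TMap

end SecP19

section SecP20
section Rep0
variable {A B : Type u} [NonUnitalCStarAlgebra A] [NonUnitalCStarAlgebra B]
    {H₁ H₂ H : Type*} [NormedAddCommGroup H₁] [InnerProductSpace ℂ H₁] [CompleteSpace H₁]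
    [NormedAddCommGroup H₂] [InnerProductSpace ℂ H₂] [CompleteSpace H₂]
    [NormedAddCommGroup H] [InnerProductSpace ℂ H] [CompleteSpace H]

def rep0 (t : (H₁ ⊗[ℂ] H₂) →ₗᵢ[ℂ] H) (ht : DenseRange t) (π₁ : A →⋆ₙₐ[ℂ] (H₁ →L[ℂ] H₁)) (π₂ : B →⋆ₙₐ[ℂ] (H₂ →L[ℂ] H₂)) :
    A ⊗[ℂ] B →ₗ[ℂ] (H →L[ℂ] H) :=
  TensorProduct.lift ((tmapB t ht).compl₁₂ (π₁ : A →ₗ[ℂ] (H₁ →L[ℂ] H₁)) (π₂ : B →ₗ[ℂ] (H₂ →L[ℂ] H₂)))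

lemma rep0_tmul (t : (H₁ ⊗[ℂ] H₂) →ₗᵢ[ℂ] H) (ht : DenseRange t) (π₁ : A →⋆ₙₐ[ℂ] (H₁ →L[ℂ] H₁)) (π₂ : B →⋆ₙₐ[ℂ] (H₂ →L[ℂ] H₂))
    (a : A) (b : B) : rep0 t ht π₁ π₂ (a ⊗ₜ b) = tmap t (π₁ a) (π₂ b) := by
  simp [rep0, tmapB]

lemma rep0_vf (t : (H₁ ⊗[ℂ] H₂) →ₗᵢ[ℂ] H) (ht : DenseRange t) (π₁ : A →⋆ₙₐ[ℂ] (H₁ →L[ℂ] H₁)) (π₂ : B →⋆ₙₐ[ℂ] (H₂ →L[ℂ] H₂))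
    (u : A ⊗[ℂ] B) (θ θ' : H₁) (ζ ζ' : H₂) :
    inner ℂ (t (θ' ⊗ₜ ζ')) (rep0 t ht π₁ π₂ u (t (θ ⊗ₜ ζ))) = vf π₁ π₂ θ θ' ζ ζ' u := by
  induction u using TensorProduct.induction_on with
  | zero => simp
  | tmul a b => rw [rep0_tmul, tmap_tmul t ht, t.inner_map_map, TensorProduct.inner_tmul, vf_tmul]
  | add a b ha hb => rw [map_add, ContinuousLinearMap.add_apply, inner_add_right, ha, hb, map_add]

lemma rep0_norm (NA : ∀ p : ℕ, Matrix (Fin p) (Fin p) A → ℝ)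
    (NB : ∀ q : ℕ, Matrix (Fin q) (Fin q) B → ℝ)
    (hNA : ∀ p, IsCStarNorm (NA p)) (hNB : ∀ q, IsCStarNorm (NB q))
    (t : (H₁ ⊗[ℂ] H₂) →ₗᵢ[ℂ] H) (ht : DenseRange t) (π₁ : A →⋆ₙₐ[ℂ] (H₁ →L[ℂ] H₁)) (π₂ : B →⋆ₙₐ[ℂ] (H₂ →L[ℂ] H₂))
    (u : A ⊗[ℂ] B) (hu0 : 0 ≤ osProjNorm NA NB u) : ‖rep0 t ht π₁ π₂ u‖ ≤ osProjNorm NA NB u := by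
  refine le_of_forall_gt_imp_ge_of_dense fun δ hδ => ?_
  have hδ0 : 0 < δ := hu0.trans_lt hδ
  obtain ⟨p, q, c, -, d, -, hu, -, h1, h2, -, -⟩ := osProj_decomp NA NB hNA hNB π₁ π₂ u δ hδ0 hδ
  refine ContinuousLinearMap.opNorm_le_of_re_inner_le hδ0.le fun x y hx hy => ?_
  have e1 : inner ℂ (rep0 t ht π₁ π₂ u x) y
      = ∑ i, inner ℂ (tmap t 1 (π₂ (d i)) x) (tmap t (star (π₁ (c i))) 1 y) := by
    rw [hu, map_sum, ContinuousLinearMap.sum_apply, sum_inner]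
    refine Finset.sum_congr rfl fun i _ => ?_
    rw [rep0_tmul]
    have e2 : tmap t (π₁ (c i)) (π₂ (d i)) = tmap t (π₁ (c i)) 1 * tmap t 1 (π₂ (d i)) := by
      rw [← tmap_mul t ht, mul_one, one_mul]
    have e3 : tmap t (star (π₁ (c i))) (1 : H₂ →L[ℂ] H₂) = star (tmap t (π₁ (c i)) 1) := by
      rw [tmap_star t ht, star_one]
    rw [e2, e3, ContinuousLinearMap.star_eq_adjoint, ContinuousLinearMap.adjoint_inner_right]
    rfl
  have h3 := tmap_row t ht (fun i => star (π₁ (c i))) δ hδ0.le h1 y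
  have h4 := tmap_col t ht (fun i => π₂ (d i)) δ hδ0.le h2 x
  rw [hy] at h3
  rw [hx] at h4
  rw [e1]
  calc _ ≤ ‖∑ i, inner ℂ (tmap t 1 (π₂ (d i)) x) (tmap t (star (π₁ (c i))) 1 y)‖ := Complex.re_le_norm _
    _ ≤ ∑ i, ‖tmap t 1 (π₂ (d i)) x‖ * ‖tmap t (star (π₁ (c i))) 1 y‖ :=
      (norm_sum_le _ _).trans (Finset.sum_le_sum fun i _ => norm_inner_le_norm _ _)
    _ ≤ ∑ i, (‖tmap t 1 (π₂ (d i)) x‖ ^ 2 / 2 + ‖tmap t (star (π₁ (c i))) 1 y‖ ^ 2 / 2) :=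
      Finset.sum_le_sum fun i _ => by
        nlinarith [sq_nonneg (‖tmap t 1 (π₂ (d i)) x‖ - ‖tmap t (star (π₁ (c i))) 1 y‖)]
    _ ≤ δ := by
      rw [Finset.sum_add_distrib, ← Finset.sum_div, ← Finset.sum_div]
      simp only [one_pow, mul_one] at h3 h4
      linarith
end Rep0

end SecP20

section SecP21
section Irr
variable {A B : Type u} [NonUnitalCStarAlgebra A] [NonUnitalCStarAlgebra B]
    {H₁ H₂ H : Type*} [NormedAddCommGroup H₁] [InnerProductSpace ℂ H₁] [CompleteSpace H₁]
    [NormedAddCommGroup H₂] [InnerProductSpace ℂ H₂] [CompleteSpace H₂]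
    [NormedAddCommGroup H] [InnerProductSpace ℂ H] [CompleteSpace H]

lemma rep_nondeg (π : A →⋆ₙₐ[ℂ] (H₁ →L[ℂ] H₁)) (hnz : ∃ a, π a ≠ 0)
    (hirr : ∀ S : Submodule ℂ H₁, IsClosed (S : Set H₁) → (∀ y : A, ∀ v ∈ S, π y v ∈ S) → S = ⊥ ∨ S = ⊤)
    (v : H₁) (hv : ∀ a θ, inner ℂ (π a θ) v = 0) : v = 0 := by
  have hv' : v ∈ (⨅ a, LinearMap.ker (π a).toLinearMap : Submodule ℂ H₁) := by
    simp only [Submodule.mem_iInf, LinearMap.mem_ker]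
    intro a
    refine ext_inner_left ℂ fun θ => ?_
    have := hv (star a) θ
    rw [map_star, ContinuousLinearMap.star_eq_adjoint, ContinuousLinearMap.adjoint_inner_left] at this
    rw [inner_zero_right]
    exact this
  have hcl : IsClosed ((⨅ a, LinearMap.ker (π a).toLinearMap : Submodule ℂ H₁) : Set H₁) := by
    rw [Submodule.coe_iInf]
    exact isClosed_iInter fun a => ContinuousLinearMap.isClosed_ker (π a)
  have hin : ∀ y : A, ∀ v ∈ (⨅ a, LinearMap.ker (π a).toLinearMap : Submodule ℂ H₁), π y v ∈ (⨅ a, LinearMap.ker (π a).toLinearMap : Submodule ℂ H₁) := by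
    intro y v hv
    simp only [Submodule.mem_iInf, LinearMap.mem_ker] at hv ⊢
    intro a
    have : (π y) v = 0 := hv y
    rw [this, map_zero]
  rcases hirr _ hcl hin with h | h
  · rw [h] at hv'
    simpa using hv'
  · exfalso
    obtain ⟨a, ha⟩ := hnz
    apply ha
    ext x
    have : x ∈ (⨅ a, LinearMap.ker (π a).toLinearMap : Submodule ℂ H₁) := by rw [h]; trivial
    simp only [Submodule.mem_iInf, LinearMap.mem_ker] at this
    exact this a

def jl (t : (H₁ ⊗[ℂ] H₂) →ₗᵢ[ℂ] H) (θ : H₁) : H₂ →L[ℂ] H :=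
  t.toContinuousLinearMap ∘L (TensorProduct.mkL ℂ H₁ H₂ θ)
def jr (t : (H₁ ⊗[ℂ] H₂) →ₗᵢ[ℂ] H) (ζ : H₂) : H₁ →L[ℂ] H :=
  t.toContinuousLinearMap ∘L ((TensorProduct.mkL ℂ H₁ H₂).flip ζ)
lemma jl_apply (t : (H₁ ⊗[ℂ] H₂) →ₗᵢ[ℂ] H) (θ : H₁) (ζ : H₂) : jl t θ ζ = t (θ ⊗ₜ ζ) := rfl
lemma jr_apply (t : (H₁ ⊗[ℂ] H₂) →ₗᵢ[ℂ] H) (θ : H₁) (ζ : H₂) : jr t ζ θ = t (θ ⊗ₜ ζ) := rfl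

section
variable (t : (H₁ ⊗[ℂ] H₂) →ₗᵢ[ℂ] H) (ht : DenseRange t)
  (π₁ : A →⋆ₙₐ[ℂ] (H₁ →L[ℂ] H₁)) (π₂ : B →⋆ₙₐ[ℂ] (H₂ →L[ℂ] H₂))
  (hnz₁ : ∃ a, π₁ a ≠ 0)
  (hirr₁ : ∀ S : Submodule ℂ H₁, IsClosed (S : Set H₁) → (∀ y : A, ∀ v ∈ S, π₁ y v ∈ S) → S = ⊥ ∨ S = ⊤)
  (hnz₂ : ∃ b, π₂ b ≠ 0)
  (hirr₂ : ∀ S : Submodule ℂ H₂, IsClosed (S : Set H₂) → (∀ y : B, ∀ v ∈ S, π₂ y v ∈ S) → S = ⊥ ∨ S = ⊤)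

lemma tensor_nondeg (ht : DenseRange t) (hnz₁ : ∃ a, π₁ a ≠ 0)
  (hirr₁ : ∀ S : Submodule ℂ H₁, IsClosed (S : Set H₁) → (∀ y : A, ∀ v ∈ S, π₁ y v ∈ S) → S = ⊥ ∨ S = ⊤)
  (hnz₂ : ∃ b, π₂ b ≠ 0)
  (hirr₂ : ∀ S : Submodule ℂ H₂, IsClosed (S : Set H₂) → (∀ y : B, ∀ v ∈ S, π₂ y v ∈ S) → S = ⊥ ∨ S = ⊤)
  (w : H) (hw : ∀ a b, tmap t (π₁ a) (π₂ b) w = 0) : w = 0 := by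
  have h0 : ∀ a b θ ζ, inner ℂ (t (π₁ a θ ⊗ₜ π₂ b ζ)) w = 0 := by
    intro a b θ ζ
    have h := congrArg (fun z => inner ℂ (t (θ ⊗ₜ ζ)) z) (hw (star a) (star b))
    simp only [map_star, inner_zero_right] at h
    rwa [← tmap_star t ht, ContinuousLinearMap.star_eq_adjoint, ContinuousLinearMap.adjoint_inner_right, tmap_tmul t ht] at h
  have h1 : ∀ a θ ζ, inner ℂ (t (π₁ a θ ⊗ₜ ζ)) w = 0 := by
    intro a θ ζ
    have := rep_nondeg π₂ hnz₂ hirr₂ (ContinuousLinearMap.adjoint (jl t (π₁ a θ)) w) (fun b ζ => by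
      rw [ContinuousLinearMap.adjoint_inner_right, jl_apply]; exact h0 a b θ ζ)
    rw [← jl_apply, ← ContinuousLinearMap.adjoint_inner_right, this, inner_zero_right]
  refine dense_ext_vec t ht fun θ ζ => ?_
  have := rep_nondeg π₁ hnz₁ hirr₁ (ContinuousLinearMap.adjoint (jr t ζ) w) (fun a θ => by
      rw [ContinuousLinearMap.adjoint_inner_right, jr_apply]; exact h1 a θ ζ)
  rw [← jr_apply, ← ContinuousLinearMap.adjoint_inner_right, this, inner_zero_right, inner_zero_right]

lemma tensor_comm (ht : DenseRange t) (hnz₁ : ∃ a, π₁ a ≠ 0)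
  (hirr₁ : ∀ S : Submodule ℂ H₁, IsClosed (S : Set H₁) → (∀ y : A, ∀ v ∈ S, π₁ y v ∈ S) → S = ⊥ ∨ S = ⊤)
  (hnz₂ : ∃ b, π₂ b ≠ 0)
  (hirr₂ : ∀ S : Submodule ℂ H₂, IsClosed (S : Set H₂) → (∀ y : B, ∀ v ∈ S, π₂ y v ∈ S) → S = ⊥ ∨ S = ⊤)
  (P : H →L[ℂ] H) (hP : ∀ a b, P * tmap t (π₁ a) (π₂ b) = tmap t (π₁ a) (π₂ b) * P) :
  (∀ a, P * tmap t (π₁ a) 1 = tmap t (π₁ a) 1 * P) ∧ (∀ b, P * tmap t 1 (π₂ b) = tmap t 1 (π₂ b) * P) := by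
  have key : ∀ Q : H →L[ℂ] H, (∀ a b, tmap t (π₁ a) (π₂ b) * (P * Q - Q * P) = 0) → P * Q = Q * P := by
    intro Q hQ
    refine sub_eq_zero.mp (ContinuousLinearMap.ext fun x => ?_)
    refine tensor_nondeg t π₁ π₂ ht hnz₁ hirr₁ hnz₂ hirr₂ _ fun a b => ?_
    exact congrArg (fun T : H →L[ℂ] H => T x) (hQ a b)
  constructor
  · intro a
    refine key _ fun a' b' => ?_
    have e : tmap t (π₁ a') (π₂ b') * tmap t (π₁ a) 1 = tmap t (π₁ (a' * a)) (π₂ b') := by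
      rw [← tmap_mul t ht, map_mul, mul_one]
    rw [mul_sub, ← mul_assoc, ← hP, ← mul_assoc, e, mul_assoc, e, hP, sub_self]
  · intro b
    refine key _ fun a' b' => ?_
    have e : tmap t (π₁ a') (π₂ b') * tmap t 1 (π₂ b) = tmap t (π₁ a') (π₂ (b' * b)) := by
      rw [← tmap_mul t ht, map_mul, mul_one]
    rw [mul_sub, ← mul_assoc, ← hP, ← mul_assoc, e, mul_assoc, e, hP, sub_self]

lemma tensor_schur (ht : DenseRange t) (hnz₁ : ∃ a, π₁ a ≠ 0)
  (hirr₁ : ∀ S : Submodule ℂ H₁, IsClosed (S : Set H₁) → (∀ y : A, ∀ v ∈ S, π₁ y v ∈ S) → S = ⊥ ∨ S = ⊤)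
  (hnz₂ : ∃ b, π₂ b ≠ 0)
  (hirr₂ : ∀ S : Submodule ℂ H₂, IsClosed (S : Set H₂) → (∀ y : B, ∀ v ∈ S, π₂ y v ∈ S) → S = ⊥ ∨ S = ⊤)
  (P : H →L[ℂ] H) (hP : ∀ a b, P * tmap t (π₁ a) (π₂ b) = tmap t (π₁ a) (π₂ b) * P) :
  ∃ k : ℂ, P = k • 1 := by
  obtain ⟨hP1, hP2⟩ := tensor_comm t π₁ π₂ ht hnz₁ hirr₁ hnz₂ hirr₂ P hP
  have c1 : ∀ a θ ζ, P (t (π₁ a θ ⊗ₜ ζ)) = tmap t (π₁ a) 1 (P (t (θ ⊗ₜ ζ))) := by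
    intro a θ ζ
    have := congrArg (fun T : H →L[ℂ] H => T (t (θ ⊗ₜ ζ))) (hP1 a)
    simpa [tmap_tmul t ht] using this
  have c2 : ∀ b θ ζ, P (t (θ ⊗ₜ π₂ b ζ)) = tmap t 1 (π₂ b) (P (t (θ ⊗ₜ ζ))) := by
    intro b θ ζ
    have := congrArg (fun T : H →L[ℂ] H => T (t (θ ⊗ₜ ζ))) (hP2 b)
    simpa [tmap_tmul t ht] using this
  have sl : ∀ ζ ζ', ∃ k : ℂ, ∀ θ θ', inner ℂ (t (θ' ⊗ₜ ζ')) (P (t (θ ⊗ₜ ζ))) = k * inner ℂ θ' θ := by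
    intro ζ ζ'
    obtain ⟨k, hk⟩ := schur π₁ hirr₁ ((ContinuousLinearMap.adjoint (jr t ζ')) ∘L P ∘L (jr t ζ)) (fun a => by
      refine ContinuousLinearMap.ext fun θ => ext_inner_left ℂ fun θ' => ?_
      simp only [ContinuousLinearMap.mul_apply, ContinuousLinearMap.comp_apply, jr_apply]
      rw [ContinuousLinearMap.adjoint_inner_right, jr_apply, c1, ← ContinuousLinearMap.adjoint_inner_left (π₁ a),
        ContinuousLinearMap.adjoint_inner_right, jr_apply, ← ContinuousLinearMap.adjoint_inner_left (tmap t (π₁ a) 1),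
        ← ContinuousLinearMap.star_eq_adjoint, tmap_star t ht, tmap_tmul t ht, star_one]
      rfl)
    refine ⟨k, fun θ θ' => ?_⟩
    have := congrArg (fun T : H₁ →L[ℂ] H₁ => inner ℂ θ' (T θ)) hk
    simp only [ContinuousLinearMap.comp_apply, ContinuousLinearMap.adjoint_inner_right, jr_apply] at this
    rw [this]
    simp [inner_smul_right]
  choose k hk using sl
  obtain ⟨θ₀, hθ₀⟩ : ∃ θ₀ : H₁, ‖θ₀‖ = 1 := by
    obtain ⟨a, ha⟩ := hnz₁
    obtain ⟨x, hx⟩ : ∃ x, π₁ a x ≠ 0 := by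
      by_contra h
      push Not at h
      exact ha (ContinuousLinearMap.ext h)
    refine ⟨((‖π₁ a x‖ : ℂ)⁻¹) • π₁ a x, ?_⟩
    rw [norm_smul, norm_inv, Complex.norm_real, norm_norm, inv_mul_cancel₀ (by simpa using hx)]
  have hθ₁ : inner ℂ θ₀ θ₀ = (1 : ℂ) := by rw [inner_self_eq_norm_sq_to_K, hθ₀]; simp
  let Q : H₂ →L[ℂ] H₂ := (ContinuousLinearMap.adjoint (jl t θ₀)) ∘L P ∘L (jl t θ₀)
  have hQ : ∀ ζ ζ', inner ℂ ζ' (Q ζ) = inner ℂ (t (θ₀ ⊗ₜ ζ')) (P (t (θ₀ ⊗ₜ ζ))) := by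
    intro ζ ζ'
    simp only [Q, ContinuousLinearMap.comp_apply, ContinuousLinearMap.adjoint_inner_right, jl_apply]
  obtain ⟨c, hc⟩ := schur π₂ hirr₂ Q (fun b => by
      refine ContinuousLinearMap.ext fun θ => ext_inner_left ℂ fun θ' => ?_
      simp only [ContinuousLinearMap.mul_apply]
      rw [hQ, c2, ← ContinuousLinearMap.adjoint_inner_left (π₂ b), hQ, ← ContinuousLinearMap.adjoint_inner_left (tmap t 1 (π₂ b)),
        ← ContinuousLinearMap.star_eq_adjoint, tmap_star t ht, tmap_tmul t ht, star_one]
      rfl)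
  refine ⟨c, dense_ext_op t ht fun θ ζ => dense_ext_vec t ht fun θ' ζ' => ?_⟩
  have h1 := hQ ζ ζ'
  rw [hk, hθ₁, mul_one, hc] at h1
  rw [hk, ← h1]
  simp [inner_smul_right, t.inner_map_map, TensorProduct.inner_tmul]
  ring

lemma tensor_irr (ht : DenseRange t) (hnz₁ : ∃ a, π₁ a ≠ 0)
  (hirr₁ : ∀ S : Submodule ℂ H₁, IsClosed (S : Set H₁) → (∀ y : A, ∀ v ∈ S, π₁ y v ∈ S) → S = ⊥ ∨ S = ⊤)
  (hnz₂ : ∃ b, π₂ b ≠ 0)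
  (hirr₂ : ∀ S : Submodule ℂ H₂, IsClosed (S : Set H₂) → (∀ y : B, ∀ v ∈ S, π₂ y v ∈ S) → S = ⊥ ∨ S = ⊤)
  (S : Submodule ℂ H) (hS : IsClosed (S : Set H)) (hinv : ∀ a b, ∀ v ∈ S, tmap t (π₁ a) (π₂ b) v ∈ S) :
  S = ⊥ ∨ S = ⊤ := by
  haveI : CompleteSpace S := hS.completeSpace_coe
  have hinv' : ∀ a b, ∀ v ∈ Sᗮ, tmap t (π₁ a) (π₂ b) v ∈ Sᗮ := by
    intro a b v hv
    rw [Submodule.mem_orthogonal] at hv ⊢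
    intro u hu
    rw [← ContinuousLinearMap.adjoint_inner_left, ← ContinuousLinearMap.star_eq_adjoint, tmap_star t ht, ← map_star, ← map_star]
    exact hv _ (hinv _ _ u hu)
  obtain ⟨k, hk⟩ := tensor_schur t π₁ π₂ ht hnz₁ hirr₁ hnz₂ hirr₂ S.starProjection (fun a b => by
    ext x
    simp only [ContinuousLinearMap.mul_apply]
    have hx : x = S.starProjection x + (x - S.starProjection x) := by abel
    have h1 : x - S.starProjection x ∈ Sᗮ := Submodule.sub_starProjection_mem_orthogonal x
    conv_lhs => rw [hx, map_add, map_add]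
    rw [Submodule.starProjection_eq_self_iff.mpr (hinv a b _ (Submodule.starProjection_apply_mem S x)),
      (Submodule.starProjection_apply_eq_zero_iff S).mpr (hinv' a b _ h1), add_zero])
  by_cases h0 : k = 0
  · left
    rw [Submodule.eq_bot_iff]
    intro x hx
    rw [← Submodule.starProjection_eq_self_iff.mpr hx, hk, h0]
    simp
  · right
    rw [Submodule.eq_top_iff']
    intro x
    have := Submodule.starProjection_apply_mem S (k⁻¹ • x)
    rw [hk] at this
    simpa [smul_smul, h0] using this
end
end Irr

end SecP21

section SecP22
section RepX
open Filter Topology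
variable {A B X : Type u} [NonUnitalCStarAlgebra A] [NonUnitalCStarAlgebra B]
    [NonUnitalNormedRing X] [StarRing X] [NormedSpace ℂ X] [CompleteSpace X]
    {H₁ H₂ H : Type*} [NormedAddCommGroup H₁] [InnerProductSpace ℂ H₁] [CompleteSpace H₁]
    [NormedAddCommGroup H₂] [InnerProductSpace ℂ H₂] [CompleteSpace H₂]
    [NormedAddCommGroup H] [InnerProductSpace ℂ H] [CompleteSpace H]

/-- two continuous bilinear maps agreeing on elementary tensors agree -/
lemma dense_lin {V : Type*} [NormedAddCommGroup V] [NormedSpace ℂ V] (ι : A ⊗[ℂ] B →ₗ[ℂ] X) (hd : DenseRange ι)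
    (F G : X →L[ℂ] V) (h : ∀ a b, F (ι (a ⊗ₜ b)) = G (ι (a ⊗ₜ b))) : F = G := by
  have h1 : (F.toLinearMap ∘ₗ ι) = G.toLinearMap ∘ₗ ι := TensorProduct.ext' h
  apply ContinuousLinearMap.coeFn_injective
  refine hd.equalizer F.continuous G.continuous ?_
  ext z
  exact LinearMap.congr_fun h1 z

lemma dense_bilin {V : Type*} [NormedAddCommGroup V] [NormedSpace ℂ V] (ι : A ⊗[ℂ] B →ₗ[ℂ] X) (hd : DenseRange ι)
    (F G : X →L[ℂ] X →L[ℂ] V) (h : ∀ a b c d, F (ι (a ⊗ₜ b)) (ι (c ⊗ₜ d)) = G (ι (a ⊗ₜ b)) (ι (c ⊗ₜ d))) : F = G :=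
  dense_lin ι hd F G fun a b => dense_lin ι hd _ _ fun c d => h a b c d

lemma ι_norm_le (NA : ∀ p : ℕ, Matrix (Fin p) (Fin p) A → ℝ)
    (NB : ∀ q : ℕ, Matrix (Fin q) (Fin q) B → ℝ)
    (hNA : ∀ p, IsCStarNorm (NA p)) (hNB : ∀ q, IsCStarNorm (NB q))
    (ι : A ⊗[ℂ] B →ₗ[ℂ] X) (hX : IsTensorCompletion (osProjNorm NA NB) X ι) (a : A) (b : B) :
    ‖ι (a ⊗ₜ b)‖ ≤ ‖a‖ * ‖b‖ := by
  have h1 := osProj_nonempty_le NA NB (fun p v => (hNA p).nonneg v) (fun p v => (hNB p).nonneg v) 1 1 (fun _ => 1)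
    (fun _ _ => a) (fun _ _ => b) (fun _ => 1)
  have h2 : NA 1 (fun _ _ => a) = ‖a‖ := by
    let φ : A →⋆ₙₐ[ℂ] Matrix (Fin 1) (Fin 1) A :=
      { toFun := fun x => Matrix.of (fun _ _ => x)
        map_smul' := fun _ _ => rfl
        map_zero' := rfl
        map_add' := fun _ _ => rfl
        map_mul' := fun _ _ => by ext i j; simp [Matrix.mul_apply]
        map_star' := fun _ => by ext i j; simp [Matrix.star_apply] }
    exact cstarnorm_eq (hNA 1) φ (fun x y h => congrFun (congrFun h 0) 0) a
  have h3 : NB 1 (fun _ _ => b) = ‖b‖ := by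
    let φ : B →⋆ₙₐ[ℂ] Matrix (Fin 1) (Fin 1) B :=
      { toFun := fun x => Matrix.of (fun _ _ => x)
        map_smul' := fun _ _ => rfl
        map_zero' := rfl
        map_add' := fun _ _ => rfl
        map_mul' := fun _ _ => by ext i j; simp [Matrix.mul_apply]
        map_star' := fun _ => by ext i j; simp [Matrix.star_apply] }
    exact cstarnorm_eq (hNB 1) φ (fun x y h => congrFun (congrFun h 0) 0) b
  rw [h2, h3] at h1
  rw [hX.norm_eq]
  simpa [Fintype.sum_prod_type] using h1

variable (NA : ∀ p : ℕ, Matrix (Fin p) (Fin p) A → ℝ)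
    (NB : ∀ q : ℕ, Matrix (Fin q) (Fin q) B → ℝ)
    (hNA : ∀ p, IsCStarNorm (NA p)) (hNB : ∀ q, IsCStarNorm (NB q))

lemma repX_exists [IsScalarTower ℂ X X] [SMulCommClass ℂ X X] (NA : ∀ p : ℕ, Matrix (Fin p) (Fin p) A → ℝ)
    (NB : ∀ q : ℕ, Matrix (Fin q) (Fin q) B → ℝ)
    (hNA : ∀ p, IsCStarNorm (NA p)) (hNB : ∀ q, IsCStarNorm (NB q))
    (ι : A ⊗[ℂ] B →ₗ[ℂ] X) (hX : IsTensorCompletion (osProjNorm NA NB) X ι)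
    (t : (H₁ ⊗[ℂ] H₂) →ₗᵢ[ℂ] H) (ht : DenseRange t)
    (π₁ : A →⋆ₙₐ[ℂ] (H₁ →L[ℂ] H₁)) (π₂ : B →⋆ₙₐ[ℂ] (H₂ →L[ℂ] H₂)) :
    ∃ R : X →L[ℂ] (H →L[ℂ] H), (∀ u, R (ι u) = rep0 t ht π₁ π₂ u) ∧ (∀ x y, R (x * y) = R x * R y) := by
  have hb : ∀ u, ‖rep0 t ht π₁ π₂ u‖ ≤ 1 * ‖ι u‖ := fun u => by
    rw [one_mul, hX.norm_eq]
    exact rep0_norm NA NB hNA hNB t ht π₁ π₂ u (by rw [← hX.norm_eq]; positivity)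
  have hR : ∀ u, (rep0 t ht π₁ π₂).extendOfNorm ι (ι u) = rep0 t ht π₁ π₂ u :=
    LinearMap.extendOfNorm_eq hX.dense ⟨1, hb⟩
  refine ⟨(rep0 t ht π₁ π₂).extendOfNorm ι, hR, ?_⟩
  set R := (rep0 t ht π₁ π₂).extendOfNorm ι
  have := dense_bilin ι hX.dense ((ContinuousLinearMap.compL ℂ X X (H →L[ℂ] H) R) ∘L (ContinuousLinearMap.mul ℂ X))
    ((ContinuousLinearMap.mul ℂ (H →L[ℂ] H)).bilinearComp R R) (fun a b c d => by
      simp only [ContinuousLinearMap.comp_apply, ContinuousLinearMap.compL_apply, ContinuousLinearMap.mul_apply',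
        ContinuousLinearMap.bilinearComp_apply, hX.mul_tmul, hR, rep0_tmul, map_mul, tmap_mul t ht])
  intro x y
  exact congrArg (fun T => T x y) this

/-- kernel of the representation -/
lemma repX_ker (NA : ∀ p : ℕ, Matrix (Fin p) (Fin p) A → ℝ)
    (NB : ∀ q : ℕ, Matrix (Fin q) (Fin q) B → ℝ)
    (hNA : ∀ p, IsCStarNorm (NA p)) (hNB : ∀ q, IsCStarNorm (NB q))
    (ι : A ⊗[ℂ] B →ₗ[ℂ] X) (hX : IsTensorCompletion (osProjNorm NA NB) X ι)
    (t : (H₁ ⊗[ℂ] H₂) →ₗᵢ[ℂ] H) (ht : DenseRange t)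
    (π₁ : A →⋆ₙₐ[ℂ] (H₁ →L[ℂ] H₁)) (π₂ : B →⋆ₙₐ[ℂ] (H₂ →L[ℂ] H₂))
    (R : X →L[ℂ] (H →L[ℂ] H)) (hR : ∀ u, R (ι u) = rep0 t ht π₁ π₂ u) (x : X) (hx : R x = 0)
    (Q : Submodule ℂ (A ⊗[ℂ] B)) (hQ1 : ∀ a b, π₁ a = 0 → a ⊗ₜ b ∈ Q) (hQ2 : ∀ a b, π₂ b = 0 → a ⊗ₜ b ∈ Q) :
    x ∈ closure (ι '' (Q : Set (A ⊗[ℂ] B))) := by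
  refine inj_X NA NB hNA hNB ι hX π₁ π₂ x (fun u hu θ θ' ζ ζ' => ?_) Q hQ1 hQ2
  have h1 : Tendsto (fun n => inner ℂ (t (θ' ⊗ₜ ζ')) (R (ι (u n)) (t (θ ⊗ₜ ζ)))) atTop
      (𝓝 (inner ℂ (t (θ' ⊗ₜ ζ')) (R x (t (θ ⊗ₜ ζ))))) := by
    have hc : Continuous fun z : X => inner ℂ (t (θ' ⊗ₜ ζ')) (R z (t (θ ⊗ₜ ζ))) := by fun_prop
    exact (hc.tendsto x).comp hu
  rw [hx] at h1
  simp only [hR, rep0_vf] at h1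
  simpa using h1
end RepX

end SecP22

section SecP23
section PartS
open Filter Topology
variable {A B X : Type u} [NonUnitalCStarAlgebra A] [NonUnitalCStarAlgebra B]
    [NonUnitalNormedRing X] [StarRing X] [NormedSpace ℂ X] [CompleteSpace X]
    {H₁ H₂ H : Type*} [NormedAddCommGroup H₁] [InnerProductSpace ℂ H₁] [CompleteSpace H₁]
    [NormedAddCommGroup H₂] [InnerProductSpace ℂ H₂] [CompleteSpace H₂]

lemma ι_cont (ι : A ⊗[ℂ] B →ₗ[ℂ] X) (hι : ∀ a b, ‖ι (a ⊗ₜ b)‖ ≤ ‖a‖ * ‖b‖) :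
    Continuous (fun p : A × B => ι (p.1 ⊗ₜ p.2)) := by
  let f : A →L[ℂ] B →L[ℂ] X := LinearMap.mkContinuous₂ ((TensorProduct.mk ℂ A B).compr₂ ι) 1 (fun a b => by
    simpa using hι a b)
  exact f.continuous₂

lemma apx_left (ι : A ⊗[ℂ] B →ₗ[ℂ] X) (hι : ∀ a b, ‖ι (a ⊗ₜ b)‖ ≤ ‖a‖ * ‖b‖)
    (hm : ∀ (a c : A) (b d : B), ι (a ⊗ₜ[ℂ] b) * ι (c ⊗ₜ[ℂ] d) = ι ((a * c) ⊗ₜ[ℂ] (b * d)))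
    {L : Filter (A × B)} (a : A) (b : B) (h1 : Tendsto (fun p => p.1 * a) L (𝓝 a)) (h2 : Tendsto (fun p => p.2 * b) L (𝓝 b)) :
    Tendsto (fun p => ι (p.1 ⊗ₜ p.2) * ι (a ⊗ₜ b)) L (𝓝 (ι (a ⊗ₜ b))) := by
  simp only [hm]
  exact ((ι_cont ι hι).tendsto (a, b)).comp (h1.prodMk_nhds h2)

lemma apx_right (ι : A ⊗[ℂ] B →ₗ[ℂ] X) (hι : ∀ a b, ‖ι (a ⊗ₜ b)‖ ≤ ‖a‖ * ‖b‖)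
    (hm : ∀ (a c : A) (b d : B), ι (a ⊗ₜ[ℂ] b) * ι (c ⊗ₜ[ℂ] d) = ι ((a * c) ⊗ₜ[ℂ] (b * d)))
    {L : Filter (A × B)} (a : A) (b : B) (h1 : Tendsto (fun p => a * p.1) L (𝓝 a)) (h2 : Tendsto (fun p => b * p.2) L (𝓝 b)) :
    Tendsto (fun p => ι (a ⊗ₜ b) * ι (p.1 ⊗ₜ p.2)) L (𝓝 (ι (a ⊗ₜ b))) := by
  simp only [hm]
  exact ((ι_cont ι hι).tendsto (a, b)).comp (h1.prodMk_nhds h2)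

lemma apx_span [IsScalarTower ℂ X X] [SMulCommClass ℂ X X] (ι : A ⊗[ℂ] B →ₗ[ℂ] X) (hι : ∀ a b, ‖ι (a ⊗ₜ b)‖ ≤ ‖a‖ * ‖b‖)
    (hm : ∀ (a c : A) (b d : B), ι (a ⊗ₜ[ℂ] b) * ι (c ⊗ₜ[ℂ] d) = ι ((a * c) ⊗ₜ[ℂ] (b * d)))
    {L : Filter (A × B)} (S : Set A) (T : Set B) (h1 : ∀ a ∈ S, Tendsto (fun p => p.1 * a) L (𝓝 a))
    (h2 : ∀ b ∈ T, Tendsto (fun p => p.2 * b) L (𝓝 b)) (u : A ⊗[ℂ] B)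
    (hu : u ∈ Submodule.span ℂ (Set.image2 (fun a b => a ⊗ₜ[ℂ] b) S T)) :
    Tendsto (fun p => ι (p.1 ⊗ₜ p.2) * ι u) L (𝓝 (ι u)) := by
  induction hu using Submodule.span_induction with
  | mem x hx =>
    obtain ⟨a, ha, b, hb, rfl⟩ := hx
    exact apx_left ι hι hm a b (h1 a ha) (h2 b hb)
  | zero => simp [tendsto_const_nhds]
  | add x y _ _ hx hy => simpa only [map_add, mul_add] using hx.add hy
  | smul c x _ hx => simpa only [map_smul, mul_smul_comm] using hx.const_smul c

lemma apx_ker (π₁ : A →⋆ₙₐ[ℂ] (H₁ →L[ℂ] H₁)) : ∃ l : Filter A, l.NeBot ∧ (∀ᶠ e in l, π₁ e = 0 ∧ ‖e‖ ≤ 1) ∧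
    (∀ m, π₁ m = 0 → Tendsto (fun e => e * m) l (𝓝 m)) := by
  let E' : NonUnitalStarSubalgebra ℂ A :=
    { carrier := {a | π₁ a = 0}
      add_mem' := fun {a b} ha hb => by simp only [Set.mem_setOf_eq] at *; rw [map_add, ha, hb, add_zero]
      zero_mem' := map_zero π₁
      mul_mem' := fun {a b} ha hb => by simp only [Set.mem_setOf_eq] at *; rw [map_mul, ha, zero_mul]
      smul_mem' := fun c {a} ha => by simp only [Set.mem_setOf_eq] at *; rw [map_smul, ha, smul_zero]
      star_mem' := fun {a} ha => by simp only [Set.mem_setOf_eq] at *; rw [map_star, ha, star_zero] }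
  have hc : Continuous π₁ := AddMonoidHomClass.continuous_of_bound π₁ 1 (by simpa only [one_mul] using NonUnitalStarAlgHom.norm_apply_le π₁)
  haveI : IsClosed (E' : Set A) := isClosed_eq hc continuous_const
  obtain ⟨l, hl, h1, -, h2⟩ := apx_exists E'
  refine ⟨l.map Subtype.val, hl.map _, ?_, ?_⟩
  · rw [eventually_map]
    filter_upwards [h1] with e he
    exact ⟨e.2, he.2⟩
  · intro m hm
    rw [tendsto_map'_iff]
    exact (continuous_subtype_val.tendsto _).comp (h2 ⟨m, hm⟩)

/-- nondegeneracy -/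
lemma X_nondeg [IsScalarTower ℂ X X] [SMulCommClass ℂ X X] (ι : A ⊗[ℂ] B →ₗ[ℂ] X) (hι : ∀ a b, ‖ι (a ⊗ₜ b)‖ ≤ ‖a‖ * ‖b‖)
    (hm : ∀ (a c : A) (b d : B), ι (a ⊗ₜ[ℂ] b) * ι (c ⊗ₜ[ℂ] d) = ι ((a * c) ⊗ₜ[ℂ] (b * d)))
    (hd : DenseRange ι) (x : X) (hx : ∀ u, ι u * x = 0) : x = 0 := by
  obtain ⟨lA, hlA, hA1, hA2, hA3⟩ := apx_exists A
  obtain ⟨lB, hlB, hB1, hB2, hB3⟩ := apx_exists B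
  by_contra hx0
  have hpos : 0 < ‖x‖ := norm_pos_iff.mpr hx0
  obtain ⟨u, hu⟩ := hd.exists_dist_lt x (ε := ‖x‖ / 3) (by positivity)
  rw [dist_eq_norm] at hu
  have h1 : Tendsto (fun p : A × B => ι (p.1 ⊗ₜ p.2) * ι u) (lA ×ˢ lB) (𝓝 (ι u)) := by
    refine apx_span ι hι hm Set.univ Set.univ (fun a _ => (hA3 a).comp tendsto_fst) (fun b _ => (hB3 b).comp tendsto_snd) u ?_
    have := TensorProduct.span_tmul_eq_top ℂ A B
    have h2 : (Set.image2 (fun (a : A) (b : B) => a ⊗ₜ[ℂ] b) Set.univ Set.univ) = { t | ∃ m n, m ⊗ₜ[ℂ] n = t } := by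
      ext z; simp [Set.image2]
    rw [h2, this]
    trivial
  have h2 := (Metric.tendsto_nhds.mp h1) (‖x‖ / 3) (by positivity)
  have h3 : ∀ᶠ p : A × B in lA ×ˢ lB, ‖ι (p.1 ⊗ₜ p.2)‖ ≤ 1 := by
    filter_upwards [hA1.prod_inl lB, hB1.prod_inr lA] with p h4 h5
    exact (hι _ _).trans (mul_le_one₀ h4.2 (norm_nonneg _) h5.2)
  obtain ⟨p, hp1, hp2⟩ := (h2.and h3).exists
  rw [dist_eq_norm] at hp1
  have h6 : ‖ι (p.1 ⊗ₜ p.2) * ι u‖ < ‖x‖ / 3 := by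
    have : ι (p.1 ⊗ₜ p.2) * ι u = - (ι (p.1 ⊗ₜ p.2) * (x - ι u)) := by rw [mul_sub, hx]; abel
    rw [this, norm_neg]
    refine (norm_mul_le _ _).trans_lt ?_
    nlinarith [norm_nonneg (x - ι u), norm_nonneg (ι (p.1 ⊗ₜ p.2))]
  have h7 : ‖x‖ ≤ ‖x - ι u‖ + ‖ι (p.1 ⊗ₜ p.2) * ι u - ι u‖ + ‖ι (p.1 ⊗ₜ p.2) * ι u‖ := by
    calc ‖x‖ = ‖(x - ι u) - (ι (p.1 ⊗ₜ p.2) * ι u - ι u) + ι (p.1 ⊗ₜ p.2) * ι u‖ := by congr 1; abel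
      _ ≤ _ := (norm_add_le _ _).trans (by gcongr; exact norm_sub_le _ _)
  linarith

lemma sum_closed [IsScalarTower ℂ X X] [SMulCommClass ℂ X X] (ι : A ⊗[ℂ] B →ₗ[ℂ] X) (hι : ∀ a b, ‖ι (a ⊗ₜ b)‖ ≤ ‖a‖ * ‖b‖)
    (hm : ∀ (a c : A) (b d : B), ι (a ⊗ₜ[ℂ] b) * ι (c ⊗ₜ[ℂ] d) = ι ((a * c) ⊗ₜ[ℂ] (b * d)))
    (π₁ : A →⋆ₙₐ[ℂ] (H₁ →L[ℂ] H₁)) (π₂ : B →⋆ₙₐ[ℂ] (H₂ →L[ℂ] H₂)) (x : X)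
    (hx : x ∈ closure (ι '' ((Submodule.span ℂ (Set.image2 (fun a b => a ⊗ₜ[ℂ] b) Set.univ {b | π₂ b = 0}) ⊔
      Submodule.span ℂ (Set.image2 (fun a b => a ⊗ₜ[ℂ] b) {a | π₁ a = 0} Set.univ) : Submodule ℂ (A ⊗[ℂ] B)) : Set (A ⊗[ℂ] B)))) :
    x ∈ tensorIdeal ι (Set.univ : Set A) {b | π₂ b = 0} + tensorIdeal ι {a | π₁ a = 0} (Set.univ : Set B) := by
  set SU := Submodule.span ℂ (Set.image2 (fun a b => a ⊗ₜ[ℂ] b) (Set.univ : Set A) {b | π₂ b = 0}) with hSU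
  set SW := Submodule.span ℂ (Set.image2 (fun a b => a ⊗ₜ[ℂ] b) {a | π₁ a = 0} (Set.univ : Set B)) with hSW
  let U := (SU.map ι).topologicalClosure
  let W := (SW.map ι).topologicalClosure
  have hUc : (U : Set X) = closure (ι '' SU) := by simp [U]
  have hWc : (W : Set X) = closure (ι '' SW) := by simp [W]
  have hUcl : IsClosed (U : Set X) := by rw [hUc]; exact isClosed_closure
  have hWcl : IsClosed (W : Set X) := by rw [hWc]; exact isClosed_closure
  haveI : CompleteSpace U := hUcl.completeSpace_coe
  haveI : CompleteSpace W := hWcl.completeSpace_coe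
  let f : NormedAddGroupHom (U × W) X := AddMonoidHom.mkNormedAddGroupHom
    { toFun := fun p => (p.1 : X) + p.2
      map_zero' := by simp
      map_add' := fun p q => by simp; abel } 2 (fun p => by
      have h1 : ‖(p.1 : X)‖ ≤ ‖p‖ := norm_fst_le p
      have h2 : ‖(p.2 : X)‖ ≤ ‖p‖ := norm_snd_le p
      exact (norm_add_le _ _).trans (by linarith))
  have hf : ∀ p, f p = (p.1 : X) + p.2 := fun p => rfl
  let K : AddSubgroup X := ((SU ⊔ SW).map ι).toAddSubgroup
  have hyp : f.SurjectiveOnWith K 3 := by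
    rintro d ⟨z, hz, rfl⟩
    obtain ⟨u, hu, w, hw, rfl⟩ := Submodule.mem_sup.mp hz
    by_cases hd : ι (u + w) = 0
    · exact ⟨0, by rw [hf, hd]; simp, by simp⟩
    have hpos : 0 < ‖ι (u + w)‖ := norm_pos_iff.mpr hd
    obtain ⟨lA, hlA, hA1, hA3⟩ := apx_ker π₁
    obtain ⟨lB, hlB, hB1, hB2, hB3⟩ := apx_exists B
    have h1 : Tendsto (fun p : A × B => ι (p.1 ⊗ₜ p.2) * ι w) (lA ×ˢ lB) (𝓝 (ι w)) :=
      apx_span ι hι hm _ _ (fun a ha => (hA3 a ha).comp tendsto_fst) (fun b _ => (hB3 b).comp tendsto_snd) w hw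
    have h2 := (Metric.tendsto_nhds.mp h1) (‖ι (u + w)‖) hpos
    have h3 : ∀ᶠ p : A × B in lA ×ˢ lB, ‖ι (p.1 ⊗ₜ p.2)‖ ≤ 1 ∧ π₁ p.1 = 0 := by
      filter_upwards [hA1.prod_inl lB, hB1.prod_inr lA] with p h4 h5
      exact ⟨(hι _ _).trans (mul_le_one₀ h4.2 (norm_nonneg _) h5.2), h4.1⟩
    obtain ⟨p, hp1, hp2, hp3⟩ := (h2.and h3).exists
    rw [dist_eq_norm, ← norm_neg, neg_sub] at hp1
    have mW : ∀ z : A ⊗[ℂ] B, ι (p.1 ⊗ₜ p.2) * ι z ∈ SW.map ι := by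
      intro z
      induction z using TensorProduct.induction_on with
      | zero => simp
      | tmul a b =>
        rw [hm]
        exact Submodule.mem_map_of_mem (Submodule.subset_span ⟨_, by simp [hp3], _, trivial, rfl⟩)
      | add a b ha hb => rw [map_add, mul_add]; exact add_mem ha hb
    have mU : ι (p.1 ⊗ₜ p.2) * ι u ∈ SU.map ι := by
      clear hz hd hpos h1 h2 hp1
      induction hu using Submodule.span_induction with
      | mem x hx =>
        obtain ⟨a, -, b, hb, rfl⟩ := hx
        rw [hm]
        refine Submodule.mem_map_of_mem (Submodule.subset_span ⟨_, trivial, _, ?_, rfl⟩)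
        simp only [Set.mem_setOf_eq] at hb ⊢
        rw [map_mul, hb, mul_zero]
      | zero => simp
      | add x y _ _ hx hy => rw [map_add, mul_add]; exact add_mem hx hy
      | smul c x _ hx => rw [map_smul, mul_smul_comm]; exact Submodule.smul_mem _ _ hx
    set m := ι (p.1 ⊗ₜ p.2)
    have g1 : ι u - m * ι u ∈ U := Submodule.le_topologicalClosure _ (sub_mem (Submodule.mem_map_of_mem hu) mU)
    have g2 : m * ι (u + w) + (ι w - m * ι w) ∈ W := Submodule.le_topologicalClosure _
      (add_mem (mW _) (sub_mem (Submodule.mem_map_of_mem hw) (mW _)))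
    have e1 : ι u - m * ι u + (m * ι (u + w) + (ι w - m * ι w)) = ι (u + w) := by
      rw [map_add, mul_add]; abel
    have n2 : ‖m * ι (u + w) + (ι w - m * ι w)‖ ≤ 2 * ‖ι (u + w)‖ := by
      refine (norm_add_le _ _).trans ?_
      have := norm_mul_le m (ι (u + w))
      nlinarith [norm_nonneg m]
    have n1 : ‖ι u - m * ι u‖ ≤ 3 * ‖ι (u + w)‖ := by
      rw [eq_sub_of_add_eq e1]
      refine (norm_sub_le _ _).trans ?_
      linarith
    refine ⟨(⟨_, g1⟩, ⟨_, g2⟩), ?_, ?_⟩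
    · rw [hf]; exact e1
    · refine max_le ?_ ?_
      · exact n1
      · refine n2.trans ?_
        show 2 * ‖ι (u + w)‖ ≤ 3 * ‖ι (u + w)‖
        linarith
  have hcl := controlled_closure_of_complete (by norm_num : (0:ℝ) < 3) one_pos hyp
  obtain ⟨⟨g1, g2⟩, hg, -⟩ := hcl x (by
    rw [← SetLike.mem_coe, AddSubgroup.topologicalClosure_coe]
    exact hx)
  refine Set.mem_add.mpr ⟨g1, ?_, g2, ?_, hg⟩
  · rw [tensorIdeal, ← hUc]; exact g1.2
  · rw [tensorIdeal, ← hWc]; exact g2.2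
end PartS

end SecP23

section SecP24
section PartT
open Filter Topology

lemma sr_le {X 𝔅 : Type*} [NonUnitalNormedRing X] [NormedSpace ℂ X] [CompleteSpace X]
    [IsScalarTower ℂ X X] [SMulCommClass ℂ X X] [NormedRing 𝔅] [NormedAlgebra ℂ 𝔅] (ρ : X →ₙₐ[ℂ] 𝔅) (w : X) :
    spectralRadius ℂ (ρ w) ≤ ENNReal.ofReal ‖w‖ := by
  refine iSup₂_le fun k hk => ?_
  have h1 : k ∈ quasispectrum ℂ w :=
    NonUnitalAlgHom.quasispectrum_apply_subset ρ w (spectrum_subset_quasispectrum ℂ _ hk)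
  rw [Unitization.quasispectrum_eq_spectrum_inr' ℂ ℂ,
    ← AlgEquiv.spectrum_eq (WithLp.unitizationAlgEquiv ℂ).symm (w : Unitization ℂ X)] at h1
  have h2 := spectrum.norm_le_norm_mul_of_mem h1
  have h3 : ‖(1 : WithLp 1 (Unitization ℂ X))‖ = 1 := by
    rw [WithLp.unitization_norm_def]
    show ‖(1 : Unitization ℂ X).fst‖ + ‖(1 : Unitization ℂ X).snd‖ = 1
    simp
  rw [h3, mul_one] at h2
  have h4 : ‖(WithLp.unitizationAlgEquiv ℂ).symm (w : Unitization ℂ X)‖ = ‖w‖ := WithLp.unitization_norm_inr w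
  rw [h4] at h2
  show ‖k‖ₑ ≤ _
  rw [← ofReal_norm_eq_enorm]
  exact ENNReal.ofReal_le_ofReal h2

lemma unif_pow {𝔅 : Type*} [NormedRing 𝔅] [NormedAlgebra ℂ 𝔅] [CompleteSpace 𝔅] (f : ℂ → 𝔅) (hf : Continuous f)
    (K : Set ℂ) (hK : IsCompact K) (b : ℝ) (hb : 0 < b)
    (h : ∀ z ∈ K, spectralRadius ℂ (f z) < ENNReal.ofReal b) : ∃ k : ℕ, ∀ z ∈ K, ‖f z ^ (2 ^ k)‖ < b ^ (2 ^ k) := by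
  have hmono : Monotone fun k : ℕ => {z | ‖f z ^ (2 ^ k)‖ < b ^ (2 ^ k)} := by
    refine monotone_nat_of_le_succ fun k z hz => ?_
    simp only [Set.mem_setOf_eq] at hz ⊢
    rw [pow_succ, pow_mul, pow_mul, pow_two]
    calc ‖f z ^ 2 ^ k * f z ^ 2 ^ k‖ ≤ ‖f z ^ 2 ^ k‖ * ‖f z ^ 2 ^ k‖ := norm_mul_le _ _
      _ < (b ^ 2 ^ k) ^ 2 := by
        have := norm_nonneg (f z ^ 2 ^ k)
        nlinarith
  have hcov : K ⊆ ⋃ k : ℕ, {z | ‖f z ^ (2 ^ k)‖ < b ^ (2 ^ k)} := by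
    intro z hz
    have h1 := (spectrum.pow_norm_pow_one_div_tendsto_nhds_spectralRadius (f z)).eventually (gt_mem_nhds (h z hz))
    have h2 := (tendsto_pow_atTop_atTop_of_one_lt (one_lt_two : (1:ℕ) < 2)).eventually h1
    obtain ⟨k, hk⟩ := h2.exists
    refine Set.mem_iUnion.mpr ⟨k, ?_⟩
    simp only [Set.mem_setOf_eq]
    have h3 := (ENNReal.ofReal_lt_ofReal_iff hb).mp hk
    have h4 : (‖f z ^ 2 ^ k‖ ^ (1 / ((2 ^ k : ℕ) : ℝ))) ^ (2 ^ k) < b ^ (2 ^ k) :=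
      pow_lt_pow_left₀ h3 (by positivity) (by positivity)
    rwa [one_div, Real.rpow_inv_natCast_pow (norm_nonneg _) (by positivity)] at h4
  obtain ⟨k, hk⟩ := hK.elim_directed_cover _ (fun k => isOpen_lt (by fun_prop) continuous_const) hcov hmono.directed_le
  exact ⟨k, fun z hz => hk hz⟩

lemma three_circ {𝔅 : Type*} [NormedRing 𝔅] [NormedAlgebra ℂ 𝔅] [CompleteSpace 𝔅] (P Q : 𝔅) (r : ℝ) (hr : 1 < r)
    (b s : ℝ) (hb0 : 0 < b) (hs0 : 0 ≤ s)
    (hb : ∀ z : ℂ, ‖z‖ = r → spectralRadius ℂ (z • P + Q) < ENNReal.ofReal b)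
    (hs : ∀ z : ℂ, ‖z‖ = r⁻¹ → ‖z • P + Q‖ ≤ s) :
    ∃ k : ℕ, ‖(P + Q) ^ (2 ^ k)‖ ^ 2 ≤ (b * s) ^ (2 ^ k) := by
  have hr0 : 0 < r := by linarith
  have hlog : 0 < Real.log r := Real.log_pos hr
  obtain ⟨k, hk⟩ := unif_pow (fun z : ℂ => z • P + Q) (by fun_prop) (Metric.sphere 0 r) (isCompact_sphere _ _) b hb0
    (fun z hz => hb z (by simpa using hz))
  refine ⟨k, ?_⟩
  let g : ℂ → 𝔅 := fun w => (Complex.exp w • P + Q) ^ (2 ^ k)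
  have hdiff : Differentiable ℂ g := by
    intro w
    have : Differentiable ℂ fun w => Complex.exp w • P + Q := by fun_prop
    exact (this w).fun_pow _
  have key := Complex.HadamardThreeLines.norm_le_interp_of_mem_verticalClosedStrip' (f := g) (z := 0)
    (l := -Real.log r) (u := Real.log r) (a := s ^ 2 ^ k) (b := b ^ 2 ^ k) (by linarith)
    (by simp [Complex.HadamardThreeLines.verticalClosedStrip]; linarith) hdiff.diffContOnCl
    (by
      refine ⟨(r * ‖P‖ + ‖Q‖) ^ 2 ^ k, ?_⟩
      rintro _ ⟨w, hw, rfl⟩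
      simp only [Complex.HadamardThreeLines.verticalClosedStrip, Set.mem_preimage, Set.mem_Icc] at hw
      simp only [Function.comp_apply, g]
      refine (norm_pow_le' _ (by positivity)).trans ?_
      gcongr
      refine (norm_add_le _ _).trans ?_
      gcongr
      rw [norm_smul, Complex.norm_exp]
      gcongr
      exact (Real.exp_le_exp.mpr hw.2).trans (by rw [Real.exp_log hr0]))
    (by
      intro w hw
      simp only [Set.mem_preimage, Set.mem_singleton_iff] at hw
      refine (norm_pow_le' _ (by positivity)).trans ?_
      gcongr
      refine hs _ ?_
      rw [Complex.norm_exp, hw, Real.exp_neg, Real.exp_log hr0])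
    (by
      intro w hw
      simp only [Set.mem_preimage, Set.mem_singleton_iff] at hw
      refine (hk (Complex.exp w) ?_).le
      rw [mem_sphere_zero_iff_norm, Complex.norm_exp, hw, Real.exp_log hr0])
  have e1 : ((0:ℂ).re - -Real.log r) / (Real.log r - -Real.log r) = 1 / 2 := by
    have h2 : Real.log r - -Real.log r = 2 * Real.log r := by ring
    rw [h2, Complex.zero_re, zero_sub, neg_neg]
    field_simp
  rw [e1] at key
  have e2 : g 0 = (P + Q) ^ 2 ^ k := by simp [g]
  rw [e2] at key
  norm_num at key
  rw [← Real.sqrt_eq_rpow, ← Real.sqrt_eq_rpow, ← Real.sqrt_mul (by positivity)] at key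
  have := pow_le_pow_left₀ (norm_nonneg _) key 2
  rw [Real.sq_sqrt (by positivity)] at this
  rw [mul_comm b s, mul_pow]
  exact this

lemma tc_main {X 𝔅 : Type*} [NonUnitalNormedRing X] [NormedSpace ℂ X] [CompleteSpace X]
    [IsScalarTower ℂ X X] [SMulCommClass ℂ X X] [CStarAlgebra 𝔅] (ρ : X →ₙₐ[ℂ] 𝔅) (a : X)
    (x : ℕ → X) (hx : Tendsto x atTop (𝓝 0)) (hρ : Tendsto (fun n => ρ (x n)) atTop (𝓝 (ρ a)))
    (hsa : IsSelfAdjoint (ρ a)) : ρ a = 0 := by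
  have h1 : ∀ r : ℝ, 1 < r → ∀ n, ‖ρ a‖ ^ 2 ≤ (((r + 1) * ‖x n‖ + ‖a‖) + 1) * (r⁻¹ * ‖ρ (x n)‖ + ‖ρ a - ρ (x n)‖) := by
    intro r hr n
    have hr0 : 0 < r := by linarith
    obtain ⟨k, hk⟩ := three_circ (ρ (x n)) (ρ a - ρ (x n)) r hr (((r + 1) * ‖x n‖ + ‖a‖) + 1)
      (r⁻¹ * ‖ρ (x n)‖ + ‖ρ a - ρ (x n)‖) (by positivity) (by positivity) (by
        intro z hz
        have e : z • ρ (x n) + (ρ a - ρ (x n)) = ρ (z • x n + (a - x n)) := by simp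
        rw [e]
        refine (sr_le ρ _).trans_lt ?_
        refine (ENNReal.ofReal_lt_ofReal_iff (by positivity)).mpr ?_
        have := norm_add_le (z • x n) (a - x n)
        have := norm_sub_le a (x n)
        rw [norm_smul, hz] at *
        linarith) (by
        intro z hz
        refine (norm_add_le _ _).trans ?_
        rw [norm_smul, hz])
    rw [add_sub_cancel, hsa.norm_pow_two_pow, ← pow_mul, mul_comm (2 ^ k) 2, pow_mul] at hk
    exact le_of_pow_le_pow_left₀ (by positivity) (by positivity) hk
  have h2 : ∀ r : ℝ, 1 < r → ‖ρ a‖ ^ 2 ≤ (‖a‖ + 1) * (r⁻¹ * ‖ρ a‖) := by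
    intro r hr
    have ht : Tendsto (fun n => (((r + 1) * ‖x n‖ + ‖a‖) + 1) * (r⁻¹ * ‖ρ (x n)‖ + ‖ρ a - ρ (x n)‖)) atTop
        (𝓝 ((((r + 1) * ‖(0:X)‖ + ‖a‖) + 1) * (r⁻¹ * ‖ρ a‖ + ‖ρ a - ρ a‖))) :=
      ((((hx.norm.const_mul _).add_const _).add_const _)).mul ((hρ.norm.const_mul _).add (hρ.const_sub _).norm)
    have := ge_of_tendsto' ht (h1 r hr)
    simpa using this
  have h3 : Tendsto (fun r : ℝ => (‖a‖ + 1) * (r⁻¹ * ‖ρ a‖)) atTop (𝓝 ((‖a‖ + 1) * (0 * ‖ρ a‖))) :=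
    (tendsto_inv_atTop_zero.mul_const _).const_mul _
  have h4 := ge_of_tendsto h3 (eventually_gt_atTop 1 |>.mono h2)
  rw [zero_mul, mul_zero] at h4
  have h5 : ‖ρ a‖ = 0 := by nlinarith [norm_nonneg (ρ a), sq_nonneg ‖ρ a‖, pow_eq_zero_iff (two_ne_zero) (a := ‖ρ a‖)]
  simpa using h5
end PartT

end SecP24

section SecP25
section StarX
open Filter Topology
variable {A B X : Type u} [NonUnitalCStarAlgebra A] [NonUnitalCStarAlgebra B]
    [NonUnitalNormedRing X] [StarRing X] [NormedSpace ℂ X] [CompleteSpace X]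
    {H₁ H₂ H : Type*} [NormedAddCommGroup H₁] [InnerProductSpace ℂ H₁] [CompleteSpace H₁]
    [NormedAddCommGroup H₂] [InnerProductSpace ℂ H₂] [CompleteSpace H₂]
    [NormedAddCommGroup H] [InnerProductSpace ℂ H] [CompleteSpace H]

lemma star_ι {ν : A ⊗[ℂ] B → ℝ} (ι : A ⊗[ℂ] B →ₗ[ℂ] X) (hX : IsTensorCompletion ν X ι) (u : A ⊗[ℂ] B) :
    star (ι u) = ι (star u) := by
  induction u using TensorProduct.induction_on with
  | zero => simp
  | tmul a b => rw [hX.star_tmul, TensorProduct.star_tmul]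
  | add a b ha hb => rw [map_add, star_add, ha, hb, star_add, map_add]

lemma osProj_star_le (NA : ∀ p : ℕ, Matrix (Fin p) (Fin p) A → ℝ)
    (NB : ∀ q : ℕ, Matrix (Fin q) (Fin q) B → ℝ)
    (hNA : ∀ p, IsCStarNorm (NA p)) (hNB : ∀ q, IsCStarNorm (NB q)) (u : A ⊗[ℂ] B) :
    osProjNorm NA NB (star u) ≤ osProjNorm NA NB u := by
  refine le_of_forall_gt_imp_ge_of_dense fun δ hδ => ?_
  obtain ⟨p, q, α, v, w, β, hu, hr⟩ := osProj_rep NA NB u δ hδ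
  have h1 := osProj_nonempty_le NA NB (fun p v => (hNA p).nonneg v) (fun p v => (hNB p).nonneg v) p q (fun i => star (β i))
    (star v) (star w) (fun i => star (α i))
  have h2 : star u = ∑ ik : Fin p × Fin q, ∑ jl : Fin p × Fin q,
            ((star (β ik)) * (star (α jl))) • ((star v) ik.1 jl.1 ⊗ₜ[ℂ] (star w) ik.2 jl.2) := by
    rw [hu, star_sum, Finset.sum_comm]
    refine Finset.sum_congr rfl fun i _ => ?_
    rw [star_sum]
    refine Finset.sum_congr rfl fun j _ => ?_
    rw [star_smul, TensorProduct.star_tmul, star_mul]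
    rfl
  rw [h2]
  refine h1.trans ?_
  rw [(hNA p).star, (hNB q).star]
  simp only [norm_star]
  refine le_trans (le_of_eq ?_) hr.le
  ring

lemma norm_star_ι (NA : ∀ p : ℕ, Matrix (Fin p) (Fin p) A → ℝ)
    (NB : ∀ q : ℕ, Matrix (Fin q) (Fin q) B → ℝ)
    (hNA : ∀ p, IsCStarNorm (NA p)) (hNB : ∀ q, IsCStarNorm (NB q))
    (ι : A ⊗[ℂ] B →ₗ[ℂ] X) (hX : IsTensorCompletion (osProjNorm NA NB) X ι) (u : A ⊗[ℂ] B) :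
    ‖star (ι u)‖ ≤ ‖ι u‖ := by
  rw [star_ι ι hX, hX.norm_eq, hX.norm_eq]
  exact osProj_star_le NA NB hNA hNB u

lemma star_smul_X [IsScalarTower ℂ X X] [SMulCommClass ℂ X X] (NA : ∀ p : ℕ, Matrix (Fin p) (Fin p) A → ℝ)
    (NB : ∀ q : ℕ, Matrix (Fin q) (Fin q) B → ℝ)
    (hNA : ∀ p, IsCStarNorm (NA p)) (hNB : ∀ q, IsCStarNorm (NB q))
    (ι : A ⊗[ℂ] B →ₗ[ℂ] X) (hX : IsTensorCompletion (osProjNorm NA NB) X ι) (c : ℂ) (x : X) :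
    star (c • x) = star c • star x := by
  rw [← sub_eq_zero]
  refine X_nondeg ι (ι_norm_le NA NB hNA hNB ι hX) hX.mul_tmul hX.dense _ fun u => ?_
  have h1 : ι u * star (c • x) = star ((c • x) * star (ι u)) := by rw [star_mul, star_star]
  have h2 : (c • x) * star (ι u) = x * star (ι (star c • u)) := by
    rw [star_ι ι hX, star_ι ι hX, star_smul, star_star, map_smul, smul_mul_assoc, mul_smul_comm]
  rw [mul_sub, h1, h2, star_mul, star_star, map_smul, smul_mul_assoc, mul_smul_comm, sub_self]

/-- the adjoint of an operator in the range of `R` is in the range of `R` -/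
lemma R_star_ι {ν : A ⊗[ℂ] B → ℝ} (ι : A ⊗[ℂ] B →ₗ[ℂ] X) (hX : IsTensorCompletion ν X ι)
    (t : (H₁ ⊗[ℂ] H₂) →ₗᵢ[ℂ] H) (ht : DenseRange t)
    (π₁ : A →⋆ₙₐ[ℂ] (H₁ →L[ℂ] H₁)) (π₂ : B →⋆ₙₐ[ℂ] (H₂ →L[ℂ] H₂))
    (R : X →L[ℂ] (H →L[ℂ] H)) (hR : ∀ u, R (ι u) = rep0 t ht π₁ π₂ u) (u : A ⊗[ℂ] B) :
    R (star (ι u)) = star (R (ι u)) := by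
  rw [star_ι ι hX, hR, hR]
  induction u using TensorProduct.induction_on with
  | zero => simp
  | tmul a b => rw [TensorProduct.star_tmul, rep0_tmul, rep0_tmul, map_star, map_star, tmap_star t ht]
  | add a b ha hb => rw [star_add, map_add, ha, hb, map_add, star_add]

/-- abstract automatic `*`-preservation -/
lemma star_auto [IsScalarTower ℂ X X] [SMulCommClass ℂ X X] (D : Submodule ℝ X) (hD : Dense (D : Set X))
    (hn : ∀ d ∈ D, ‖star d‖ ≤ ‖d‖) (hsm : ∀ (c : ℂ) (x : X), star (c • x) = star c • star x)
    (R : X →L[ℂ] (H →L[ℂ] H)) (hm : ∀ x y, R (x * y) = R x * R y)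
    (hs : ∀ d ∈ D, R (star d) = star (R d)) (x : X) : R (star x) = star (R x) := by
  -- adjoints are in the range
  have hadj : ∀ y, ∃ c, R c = star (R y) := by
    intro y
    obtain ⟨d, hd, hdy⟩ := mem_closure_iff_seq_limit.mp (hD y)
    have hc : CauchySeq (fun n => star (d n)) := by
      have := hdy.cauchySeq
      rw [Metric.cauchySeq_iff] at this ⊢
      intro ε hε
      obtain ⟨N, hN⟩ := this ε hε
      refine ⟨N, fun m hm n hn' => lt_of_le_of_lt ?_ (hN m hm n hn')⟩
      rw [dist_eq_norm, dist_eq_norm, ← star_sub]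
      exact hn _ (D.sub_mem (hd m) (hd n))
    obtain ⟨c, hc⟩ := cauchySeq_tendsto_of_complete hc
    refine ⟨c, tendsto_nhds_unique ((R.continuous.tendsto c).comp hc) ?_⟩
    refine (((continuous_star.comp R.continuous).tendsto y).comp hdy).congr fun n => ?_
    exact (hs _ (hd n)).symm
  let ρ : X →ₙₐ[ℂ] (H →L[ℂ] H) :=
    { toFun := fun x => star (R (star x))
      map_smul' := fun c x => by simp [hsm]
      map_zero' := by simp
      map_add' := fun x y => by simp
      map_mul' := fun x y => by simp [hm] }
  have hρ : ∀ x, ρ x = star (R (star x)) := fun _ => rfl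
  have hd : ∀ (z : ℕ → X) (y : X), Tendsto z atTop (𝓝 0) → Tendsto (fun n => star (z n)) atTop (𝓝 y) → R y = 0 := by
    intro z y hz hy
    obtain ⟨c, hc⟩ := hadj y
    have e1 : ρ (star y * star c) = star (R y) * R y := by
      rw [hρ, star_mul, star_star, star_star, hm, hc, star_mul, star_star]
    have h0 := tc_main ρ (star y * star c) (fun n => z n * star c) (by simpa using hz.mul_const (star c))
      (by
        have h1 : Tendsto (fun n => star (R (c * star (z n)))) atTop (𝓝 (star (R (c * y)))) :=
          ((continuous_star.comp R.continuous).tendsto _).comp (hy.const_mul c)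
        simpa [hρ] using h1)
      (by rw [e1]; exact IsSelfAdjoint.star_mul_self _)
    rw [e1] at h0
    exact CStarRing.star_mul_self_eq_zero_iff _ |>.mp h0
  -- closure of the graph of star
  let S : X →ₗ[ℝ] X := 
    { toFun := star
      map_add' := star_add
      map_smul' := fun r x => by
        have := hsm (r : ℂ) x
        simpa using this }
  let G : Submodule ℝ (X × X) := S.graph.topologicalClosure
  have hG : ∀ x, (x, star x) ∈ G := fun x => S.graph.le_topologicalClosure (by
    rw [LinearMap.mem_graph_iff]; rfl)
  haveI : CompleteSpace G := S.graph.isClosed_topologicalClosure.completeSpace_coe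
  let p : G →L[ℝ] X := (ContinuousLinearMap.fst ℝ X X).comp G.subtypeL
  have hp : Function.Surjective p := fun x => ⟨⟨(x, star x), hG x⟩, rfl⟩
  obtain ⟨C, hC, hpre⟩ := ContinuousLinearMap.exists_preimage_norm_le p hp
  have hR0 : ∀ y, ((0 : X), y) ∈ G → R y = 0 := by
    intro y hy
    have hy' : ((0 : X), y) ∈ closure (S.graph : Set (X × X)) := hy
    obtain ⟨w, hw, hwy⟩ := mem_closure_iff_seq_limit.mp hy'
    rw [Prod.tendsto_iff] at hwy
    refine hd (fun n => (w n).1) y hwy.1 (hwy.2.congr fun n => ?_)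
    have := hw n
    rw [SetLike.mem_coe, LinearMap.mem_graph_iff] at this
    exact this
  obtain ⟨d, hdD, hdx⟩ := mem_closure_iff_seq_limit.mp (hD x)
  choose g hg1 hg2 using fun n => hpre (x - d n)
  have hz : Tendsto (fun n => x - d n) atTop (𝓝 0) := by simpa using hdx.const_sub x
  have hy0 : Tendsto (fun n => (g n : X × X).2) atTop (𝓝 0) := by
    refine squeeze_zero_norm (a := fun n => C * ‖x - d n‖) (fun n => ?_) (by simpa using hz.norm.const_mul C)
    exact (norm_snd_le (g n : X × X)).trans (hg2 n)
  have key : ∀ n, R (star x) = star (R (d n)) + R (g n : X × X).2 := by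
    intro n
    have h1 : (g n : X × X).1 = x - d n := hg1 n
    have h2 := G.sub_mem (hG (x - d n)) (g n).2
    have h3 : ((x - d n, star (x - d n)) - (g n : X × X)) = ((0 : X), star x - star (d n) - (g n : X × X).2) := by
      ext
      · simp [h1]
      · simp
    rw [h3] at h2
    have h4 := hR0 _ h2
    rw [map_sub, map_sub, hs _ (hdD n), sub_sub, sub_eq_zero] at h4
    exact h4
  have l1 : Tendsto (fun n => star (R (d n)) + R (g n : X × X).2) atTop (𝓝 (star (R x) + R 0)) :=
    (((continuous_star.comp R.continuous).tendsto x).comp hdx).add ((R.continuous.tendsto 0).comp hy0)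
  rw [map_zero, add_zero] at l1
  exact tendsto_nhds_unique (tendsto_const_nhds.congr key) l1

lemma repX_star [IsScalarTower ℂ X X] [SMulCommClass ℂ X X] (NA : ∀ p : ℕ, Matrix (Fin p) (Fin p) A → ℝ)
    (NB : ∀ q : ℕ, Matrix (Fin q) (Fin q) B → ℝ)
    (hNA : ∀ p, IsCStarNorm (NA p)) (hNB : ∀ q, IsCStarNorm (NB q))
    (ι : A ⊗[ℂ] B →ₗ[ℂ] X) (hX : IsTensorCompletion (osProjNorm NA NB) X ι)
    (t : (H₁ ⊗[ℂ] H₂) →ₗᵢ[ℂ] H) (ht : DenseRange t)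
    (π₁ : A →⋆ₙₐ[ℂ] (H₁ →L[ℂ] H₁)) (π₂ : B →⋆ₙₐ[ℂ] (H₂ →L[ℂ] H₂))
    (R : X →L[ℂ] (H →L[ℂ] H)) (hR : ∀ u, R (ι u) = rep0 t ht π₁ π₂ u)
    (hm : ∀ x y, R (x * y) = R x * R y) (x : X) : R (star x) = star (R x) := by
  refine star_auto ((LinearMap.range ι).restrictScalars ℝ) ?_ ?_ (star_smul_X NA NB hNA hNB ι hX) R hm ?_ x
  · have := hX.dense
    rw [DenseRange, ← LinearMap.coe_range] at this
    exact this
  · rintro _ ⟨u, rfl⟩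
    exact norm_star_ι NA NB hNA hNB ι hX u
  · rintro _ ⟨u, rfl⟩
    exact R_star_ι ι hX t ht π₁ π₂ R hR u

end StarX

end SecP25

/-- If `E` is a primitive ideal of `A` and `F` is a primitive ideal of `B`,
then `A ⊗̂ F + E ⊗̂ B` is a primitive ideal of the Banach `*`-algebra `A ⊗̂ B`. -/
theorem primitive_of_primitive_factors {A B X : Type u} [NonUnitalCStarAlgebra A] [NonUnitalCStarAlgebra B]
    [NonUnitalNormedRing X] [StarRing X] [NormedSpace ℂ X] [CompleteSpace X]
    [IsScalarTower ℂ X X] [SMulCommClass ℂ X X]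
    (NA : ∀ p : ℕ, Matrix (Fin p) (Fin p) A → ℝ)
    (NB : ∀ q : ℕ, Matrix (Fin q) (Fin q) B → ℝ)
    (hNA : ∀ p, IsCStarNorm (NA p)) (hNB : ∀ q, IsCStarNorm (NB q))
    (ι : A ⊗[ℂ] B →ₗ[ℂ] X) (hX : IsTensorCompletion (osProjNorm NA NB) X ι)
    (E : TwoSidedIdeal A) (F : TwoSidedIdeal B)
    (hE : IsPrimitiveIdeal E) (hF : IsPrimitiveIdeal F) :
    ∃ K : TwoSidedIdeal X,
      (K : Set X) =
        tensorIdeal ι (Set.univ : Set A) (F : Set B) +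
          tensorIdeal ι (E : Set A) (Set.univ : Set B) ∧
      IsPrimitiveIdeal K := by
  obtain ⟨⟨H₁, π₁, hc₁, hnz₁, hirr₁⟩, hE⟩ := hE
  obtain ⟨⟨H₂, π₂, hc₂, hnz₂, hirr₂⟩, hF⟩ := hF
  dsimp only at hE hF
  have hE' : (E : Set A) = {a | π₁ a = 0} := by ext a; exact hE a
  have hF' : (F : Set B) = {b | π₂ b = 0} := by ext b; exact hF b
  rw [hE', hF']
  let t : (H₁ ⊗[ℂ] H₂) →ₗᵢ[ℂ] UniformSpace.Completion (H₁ ⊗[ℂ] H₂) := UniformSpace.Completion.toComplₗᵢ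
  have ht : DenseRange t := UniformSpace.Completion.denseRange_coe
  obtain ⟨R, hR, hm⟩ := repX_exists NA NB hNA hNB ι hX t ht π₁ π₂
  have hs := repX_star NA NB hNA hNB ι hX t ht π₁ π₂ R hR hm
  let Rs : X →⋆ₙₐ[ℂ] (UniformSpace.Completion (H₁ ⊗[ℂ] H₂) →L[ℂ] UniformSpace.Completion (H₁ ⊗[ℂ] H₂)) :=
    { toFun := R
      map_smul' := fun c x => map_smul R c x
      map_zero' := map_zero R
      map_add' := map_add R
      map_mul' := hm
      map_star' := hs }
  have hι := ι_norm_le NA NB hNA hNB ι hX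
  let K : TwoSidedIdeal X := TwoSidedIdeal.ker Rs
  have hK : ∀ x, x ∈ K ↔ R x = 0 := fun x => TwoSidedIdeal.mem_ker Rs
  refine ⟨K, ?_, ⟨UniformSpace.Completion (H₁ ⊗[ℂ] H₂), Rs, R.continuous, ?_, ?_⟩, hK⟩
  · have hsub : ∀ (S : Set A) (T : Set B), (∀ a ∈ S, ∀ b ∈ T, R (ι (a ⊗ₜ b)) = 0) → ∀ x ∈ tensorIdeal ι S T, R x = 0 := by
      intro S T h x hx
      have hcl : IsClosed {x | R x = 0} := isClosed_eq R.continuous continuous_const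
      refine closure_minimal ?_ hcl hx
      rintro _ ⟨u, hu, rfl⟩
      have : Submodule.span ℂ (Set.image2 (fun a b => a ⊗ₜ[ℂ] b) S T) ≤ LinearMap.ker (R.toLinearMap ∘ₗ ι) := by
        rw [Submodule.span_le]
        rintro _ ⟨a, ha, b, hb, rfl⟩
        exact h a ha b hb
      exact this hu
    have z1 : ∀ b, π₂ b = 0 → ∀ a, R (ι (a ⊗ₜ b)) = 0 := by
      intro b hb a
      rw [hR, rep0_tmul, hb]
      exact dense_ext_op t ht fun θ ζ => by rw [tmap_tmul t ht]; simp
    have z2 : ∀ a, π₁ a = 0 → ∀ b, R (ι (a ⊗ₜ b)) = 0 := by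
      intro a ha b
      rw [hR, rep0_tmul, ha]
      exact dense_ext_op t ht fun θ ζ => by rw [tmap_tmul t ht]; simp
    ext x
    rw [SetLike.mem_coe, hK]
    constructor
    · intro hx
      refine sum_closed ι hι hX.mul_tmul π₁ π₂ x ?_
      refine repX_ker NA NB hNA hNB ι hX t ht π₁ π₂ R hR x hx _ (fun a b h => ?_) (fun a b h => ?_)
      · exact Submodule.mem_sup_right (Submodule.subset_span ⟨a, h, b, trivial, rfl⟩)
      · exact Submodule.mem_sup_left (Submodule.subset_span ⟨a, trivial, b, h, rfl⟩)
    · rintro ⟨y, hy, z, hz, rfl⟩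
      show R (y + z) = 0
      rw [map_add, hsub _ _ (fun a _ b hb => z1 b hb a) y hy, hsub _ _ (fun a ha b _ => z2 a ha b) z hz, add_zero]
  · obtain ⟨a, ha⟩ := hnz₁
    obtain ⟨b, hb⟩ := hnz₂
    refine ⟨ι (a ⊗ₜ b), fun h => ?_⟩
    have h : R (ι (a ⊗ₜ b)) = 0 := h
    rw [hR, rep0_tmul] at h
    obtain ⟨θ, hθ⟩ : ∃ θ, π₁ a θ ≠ 0 := by
      by_contra! hh; exact ha (ContinuousLinearMap.ext hh)
    obtain ⟨ζ, hζ⟩ : ∃ ζ, π₂ b ζ ≠ 0 := by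
      by_contra! hh; exact hb (ContinuousLinearMap.ext hh)
    have h2 := tmap_tmul t ht (π₁ a) (π₂ b) θ ζ
    rw [h, ContinuousLinearMap.zero_apply] at h2
    have h3 := congrArg norm h2
    rw [norm_zero, t.norm_map, TensorProduct.norm_tmul] at h3
    have := mul_pos (norm_pos_iff.mpr hθ) (norm_pos_iff.mpr hζ)
    linarith
  · intro S hS hinv
    refine tensor_irr t π₁ π₂ ht hnz₁ hirr₁ hnz₂ hirr₂ S hS fun a b v hv => ?_
    have h1 : R (ι (a ⊗ₜ b)) v ∈ S := hinv (ι (a ⊗ₜ b)) v hv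
    rwa [hR, rep0_tmul] at h1

end
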